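/- arXiv:1910.06252 — 5 statements merged into one kernel-verified Lean document; each statement's English description precedes it below -/
import Mathlib

section
/- Let p1 ≡ 1 (mod 4) be a prime, let k = ℚ(√p1), and let ε be a unit of the ring of integers 𝓞_k with norm N_{k/ℚ}(ε) = −1. Let q1 ≡ 1 (mod 4) be a prime with (p1/q1) = 1 (so q1 splits in k), and let 𝔮 be any prime ideal of 𝓞_k lying above q1. Then q1 is a norm from k(√ε), i.e., there exist a, b ∈ k with a² − ε·b² = q1, if and only if the image of ε in the residue field 𝓞_k/𝔮 is a square. -/
open NumberField IntermediateField

set_option synthInstance.maxHeartbeats 1000000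
set_option maxHeartbeats 1000000

noncomputable section

/-- The real quadratic field `ℚ(√m)`, realized inside `ℝ`. -/
def Qs (m : ℕ) : IntermediateField ℚ ℝ := ℚ⟮(Real.sqrt m)⟯

/-- The real multiquadratic field `ℚ(√a, √b)`, realized inside `ℝ`. -/
def Qs2 (a b : ℕ) : IntermediateField ℚ ℝ :=
  IntermediateField.adjoin ℚ {Real.sqrt a, Real.sqrt b}

theorem isIntegral_sqrt (a : ℕ) : IsIntegral ℚ (Real.sqrt a) := by
  refine ⟨Polynomial.X ^ 2 - Polynomial.C (a : ℚ), Polynomial.monic_X_pow_sub_C _ two_ne_zero, ?_⟩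
  have : Real.sqrt a ^ 2 = (a : ℝ) := Real.sq_sqrt (by positivity)
  simp [Polynomial.eval₂_sub, this]

instance (m : ℕ) : NumberField (Qs m) where
  to_charZero := SubsemiringClass.instCharZero (Qs m)
  to_finiteDimensional := IntermediateField.adjoin.finiteDimensional (isIntegral_sqrt m)

instance (a b : ℕ) : NumberField (Qs2 a b) where
  to_charZero := SubsemiringClass.instCharZero (Qs2 a b)
  to_finiteDimensional := by
    have : Finite ({Real.sqrt a, Real.sqrt b} : Set ℝ) :=
      Set.Finite.ofFinset {Real.sqrt a, Real.sqrt b} (by simp)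
    exact IntermediateField.finiteDimensional_adjoin (fun x hx => by
      rcases hx with h | h <;> subst h <;> exact isIntegral_sqrt _)

theorem isSquare_zmod_mul {m n : ℕ} (h : m.Coprime n) {a : ℤ} (hm : IsSquare (a : ZMod m))
    (hn : IsSquare (a : ZMod n)) : IsSquare (a : ZMod (m * n)) := by
  have hprod : IsSquare (((a : ZMod m), (a : ZMod n)) : ZMod m × ZMod n) := by
    obtain ⟨x, hx⟩ := hm
    obtain ⟨y, hy⟩ := hn
    exact ⟨(x, y), by rw [hx, hy, Prod.mk_mul_mk]⟩
  have := hprod.map (ZMod.chineseRemainder h).symm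
  rwa [show (((a : ZMod m), (a : ZMod n)) : ZMod m × ZMod n) = (a : ZMod m × ZMod n) from rfl,
    map_intCast] at this

theorem lt_mul_succ_sqrt (a b : ℕ) :
    a * b < (Nat.sqrt (a * b) + 1) * (Nat.sqrt a + 1) * (Nat.sqrt b + 1) := by
  have h1 := Nat.lt_succ_sqrt (a * b)
  have h2 := Nat.lt_succ_sqrt a
  have h3 := Nat.lt_succ_sqrt b
  have h4 : a * b * (a * b) < ((Nat.sqrt (a * b)).succ * (Nat.sqrt (a * b)).succ) *
      (((Nat.sqrt a).succ * (Nat.sqrt a).succ) * ((Nat.sqrt b).succ * (Nat.sqrt b).succ)) :=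
    Nat.mul_lt_mul'' h1 (Nat.mul_lt_mul'' h2 h3)
  refine lt_of_mul_self_lt_mul_self₀ (Nat.zero_le _) (h4.trans_eq ?_)
  simp only [Nat.succ_eq_add_one]
  ring

/-- A nonzero integral point in the lattice `x ≡ α y (mod w)`, `x ≡ β z (mod N)`, within the box
`x ^ 2 ≤ N w`, `y ^ 2 ≤ w`, `z ^ 2 ≤ N`. -/
theorem exists_small_lattice_point {N w : ℕ} (hN : N ≠ 0) (hw : w ≠ 0)
    (α : ZMod w) (β : ZMod N) :
    ∃ x y z : ℤ, ¬(x = 0 ∧ y = 0 ∧ z = 0) ∧ x ^ 2 ≤ N * w ∧ y ^ 2 ≤ w ∧ z ^ 2 ≤ N ∧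
      (x : ZMod w) = α * y ∧ (x : ZMod N) = β * z := by
  classical
  have : NeZero N := ⟨hN⟩
  have : NeZero w := ⟨hw⟩
  let S : Finset (ℕ × ℕ × ℕ) := Finset.range (Nat.sqrt (w * N) + 1) ×ˢ
    (Finset.range (Nat.sqrt w + 1) ×ˢ Finset.range (Nat.sqrt N + 1))
  let f : ℕ × ℕ × ℕ → ZMod w × ZMod N := fun v =>
    ((v.1 : ZMod w) - α * v.2.1, (v.1 : ZMod N) - β * v.2.2)
  have hcard : (Finset.univ : Finset (ZMod w × ZMod N)).card < S.card := by
    simp only [S, Finset.card_product, Finset.card_range, Finset.card_univ, Fintype.card_prod,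
      ZMod.card]
    rw [← mul_assoc]
    exact lt_mul_succ_sqrt w N
  obtain ⟨u, hu, v, hv, huv, hf⟩ :=
    Finset.exists_ne_map_eq_of_card_lt_of_maps_to (f := f) hcard (fun _ _ => Finset.mem_univ _)
  obtain ⟨u1, u2, u3⟩ := u
  obtain ⟨v1, v2, v3⟩ := v
  simp only [S, Finset.mem_product, Finset.mem_range, Nat.lt_succ_iff] at hu hv
  have key : ∀ {a b n : ℕ}, a ≤ Nat.sqrt n → b ≤ Nat.sqrt n → ((a : ℤ) - b) ^ 2 ≤ n := by
    intro a b n ha hb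
    have h1 : ((Nat.sqrt n : ℕ) : ℤ) * (Nat.sqrt n : ℕ) ≤ n := by exact_mod_cast Nat.sqrt_le n
    have h2 : |(a : ℤ) - b| ≤ (Nat.sqrt n : ℕ) := by rw [abs_le]; constructor <;> omega
    calc ((a : ℤ) - b) ^ 2 = |(a : ℤ) - b| ^ 2 := (sq_abs _).symm
      _ ≤ ((Nat.sqrt n : ℕ) : ℤ) ^ 2 := by gcongr
      _ ≤ n := by rw [sq]; exact h1
  simp only [f, Prod.mk.injEq] at hf
  refine ⟨u1 - v1, u2 - v2, u3 - v3, ?_, ?_, key hu.2.1 hv.2.1, key hu.2.2 hv.2.2, ?_, ?_⟩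
  · rintro ⟨h1, h2, h3⟩
    apply huv
    simp only [Prod.mk.injEq]
    omega
  · have := key hu.1 hv.1
    push_cast at this
    linarith
  · push_cast
    linear_combination hf.1
  · push_cast
    linear_combination hf.2

/-- A form of Legendre's theorem: if `N` and `w` are coprime positive integers, each a square
modulo the other, then `w` is a quotient of norms from `ℚ(√N)`. -/
theorem exists_norm_mul_eq_norm {N w : ℕ} (hN : N ≠ 0) (hw : w ≠ 0) (hcop : N.Coprime w)
    (hNsq : ¬ IsSquare (N : ℤ)) (hNwsq : ¬ IsSquare ((N : ℤ) * w))
    (h1 : IsSquare ((N : ℤ) : ZMod w)) (h2 : IsSquare ((w : ℤ) : ZMod N)) :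
    ∃ x y z t : ℤ, z ^ 2 - N * t ^ 2 ≠ 0 ∧ x ^ 2 - N * y ^ 2 = w * (z ^ 2 - N * t ^ 2) := by
  obtain ⟨α, hα⟩ := h1
  obtain ⟨β, hβ⟩ := h2
  obtain ⟨x, y, z, hne, hx, hy, hz, hxy, hxz⟩ := exists_small_lattice_point hN hw α β
  have hNpos : (0 : ℤ) < N := by positivity
  have hwpos : (0 : ℤ) < w := by positivity
  have hdw : (w : ℤ) ∣ x ^ 2 - N * y ^ 2 - w * z ^ 2 := by
    rw [← ZMod.intCast_zmod_eq_zero_iff_dvd _ w]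
    push_cast at hα ⊢
    rw [hxy, hα, ZMod.natCast_self]; ring
  have hdN : (N : ℤ) ∣ x ^ 2 - N * y ^ 2 - w * z ^ 2 := by
    rw [← ZMod.intCast_zmod_eq_zero_iff_dvd _ N]
    push_cast at hβ ⊢
    rw [hxz, hβ, ZMod.natCast_self]; ring
  obtain ⟨k, hk⟩ := (Nat.isCoprime_iff_coprime.mpr hcop).mul_dvd hdN hdw
  have hz' : z ^ 2 ≠ N := fun h => hNsq ⟨z, by rw [← h, sq]⟩
  have hx' : x ^ 2 ≠ N * w := fun h => hNwsq ⟨x, by rw [← h, sq]⟩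
  have hzlt : z ^ 2 < N := lt_of_le_of_ne hz hz'
  have hxlt : x ^ 2 < N * w := lt_of_le_of_ne hx hx'
  have hNw : (0 : ℤ) < N * w := by positivity
  have hk1 : k < 1 := by nlinarith [mul_nonneg hNpos.le (sq_nonneg y), mul_nonneg hwpos.le (sq_nonneg z)]
  have hk2 : -2 < k := by
    nlinarith [mul_le_mul_of_nonneg_left hy hNpos.le, mul_lt_mul_of_pos_left hzlt hwpos, sq_nonneg x]
  obtain rfl | rfl : k = 0 ∨ k = -1 := by omega
  · refine ⟨x, y, z, 0, ?_, by linarith⟩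
    intro h0
    have hz0 : z = 0 := by simpa using h0
    subst hz0
    have hxy2 : x ^ 2 = N * y ^ 2 := by linarith
    by_cases hy0 : y = 0
    · subst hy0
      exact hne ⟨by simpa using hxy2, rfl, rfl⟩
    · have hyx : y ∣ x := by
        rw [← Int.pow_dvd_pow_iff two_ne_zero]; exact ⟨N, by linarith⟩
      obtain ⟨c, rfl⟩ := hyx
      have : y ^ 2 * (c ^ 2 - N) = 0 := by linarith
      rcases mul_eq_zero.mp this with h | h
      · exact hy0 (by simpa using h)
      · exact hNsq ⟨c, by linarith⟩
  · exact ⟨x, y, z, 1, by intro h; apply hz'; linarith, by linarith⟩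

/-- `x` is represented by the norm form `a ^ 2 - q * b ^ 2`. -/
def IsNormValue {K : Type*} [Field K] (q x : K) : Prop := ∃ a b : K, a ^ 2 - q * b ^ 2 = x

namespace IsNormValue

variable {K : Type*} [Field K] {q x y : K}

theorem sq (q x : K) : IsNormValue q (x ^ 2) := ⟨x, 0, by ring⟩

theorem mul (hx : IsNormValue q x) (hy : IsNormValue q y) : IsNormValue q (x * y) := by
  obtain ⟨a, b, rfl⟩ := hx
  obtain ⟨c, d, rfl⟩ := hy
  exact ⟨a * c + q * b * d, a * d + b * c, by ring⟩

theorem of_mul_left (hxy : IsNormValue q (x * y)) (hx : IsNormValue q x) (h0 : x ≠ 0) :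
    IsNormValue q y := by
  have h := (hxy.mul hx).mul (sq q x⁻¹)
  rwa [show x * y * x * x⁻¹ ^ 2 = y by field_simp] at h

theorem of_sq_mul {r : K} (h : IsNormValue (q * r ^ 2) x) : IsNormValue q x := by
  obtain ⟨a, b, rfl⟩ := h
  exact ⟨a, r * b, by ring⟩

theorem of_isSquare_zmod [CharZero K] {N w : ℕ} (hN : N ≠ 0) (hw : w ≠ 0) (hcop : N.Coprime w)
    (hNsq : ¬ IsSquare (N : ℤ)) (hNwsq : ¬ IsSquare ((N : ℤ) * w))
    (h1 : IsSquare ((N : ℤ) : ZMod w)) (h2 : IsSquare ((w : ℤ) : ZMod N)) :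
    IsNormValue (N : K) (w : K) := by
  obtain ⟨x, y, z, t, h0, h⟩ := exists_norm_mul_eq_norm hN hw hcop hNsq hNwsq h1 h2
  have h' : ((x : K) ^ 2 - N * (y : K) ^ 2) = w * ((z : K) ^ 2 - N * (t : K) ^ 2) := by
    exact_mod_cast congrArg (Int.cast : ℤ → K) h
  refine of_mul_left (x := (z : K) ^ 2 - N * (t : K) ^ 2) ⟨x, y, by rw [h', mul_comm]⟩
    ⟨z, t, rfl⟩ ?_
  exact_mod_cast (Int.cast_ne_zero (α := K)).mpr h0

end IsNormValue

theorem not_isSquare_prime_mul {q m : ℕ} (hq : q.Prime) (hm : ¬ q ∣ m) :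
    ¬ IsSquare ((q : ℤ) * m) := by
  rintro ⟨x, hx⟩
  have hqp : Prime (q : ℤ) := Nat.prime_iff_prime_int.mp hq
  have hqx : (q : ℤ) ∣ x := or_self_iff.mp (hqp.dvd_or_dvd (hx ▸ dvd_mul_right _ _))
  obtain ⟨y, rfl⟩ := hqx
  apply hm
  have h : (m : ℤ) = q * (y * y) := by
    apply mul_left_cancel₀ hqp.ne_zero
    linarith
  exact Int.natCast_dvd_natCast.mp ⟨_, h⟩

theorem isSquare_zmod_two (x : ZMod 2) : IsSquare x := by
  revert x
  decide

section Legendre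

variable {p q : ℕ} [Fact p.Prime] [Fact q.Prime]

theorem isSquare_zmod_of_legendreSym_eq_one {a : ℤ} (h : legendreSym q a = 1) :
    IsSquare (a : ZMod q) := by
  by_contra hn
  rw [(legendreSym.eq_neg_one_iff q).mpr hn] at h
  norm_num at h

theorem ne_of_legendreSym_ne_zero {ℓ : ℕ} (h : legendreSym q ℓ ≠ 0) : ℓ ≠ q := by
  rintro rfl
  exact h ((legendreSym.eq_zero_iff _ _).mpr (by simp))

theorem legendreSym_comm {ℓ : ℕ} [Fact ℓ.Prime] (hq : q % 4 = 1) (hℓ : ℓ ≠ 2) :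
    legendreSym ℓ q = legendreSym q ℓ :=
  legendreSym.quadratic_reciprocity_one_mod_four hq hℓ

variable {K : Type*} [Field K] [CharZero K]

theorem isNormValue_prime {ℓ : ℕ} [Fact ℓ.Prime] (hq : q % 4 = 1) (h : legendreSym q ℓ = 1) :
    IsNormValue (q : K) (ℓ : K) := by
  have hq' : q.Prime := Fact.out
  have hl' : ℓ.Prime := Fact.out
  have hne : ℓ ≠ q := ne_of_legendreSym_ne_zero (by rw [h]; norm_num)
  have hdvd : ¬ q ∣ ℓ := fun hd => hne ((Nat.prime_dvd_prime_iff_eq hq' hl').mp hd).symm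
  refine IsNormValue.of_isSquare_zmod hq'.ne_zero hl'.ne_zero
    ((Nat.coprime_primes hq' hl').mpr hne.symm) ?_ (not_isSquare_prime_mul hq' hdvd) ?_
    (isSquare_zmod_of_legendreSym_eq_one h)
  · simpa using not_isSquare_prime_mul (m := 1) hq' hq'.not_dvd_one
  · by_cases h2 : ℓ = 2
    · subst h2
      exact isSquare_zmod_two _
    · exact isSquare_zmod_of_legendreSym_eq_one (by rw [legendreSym_comm hq h2, h])

theorem isSquare_mul_zmod {ℓ : ℕ} [Fact ℓ.Prime] (hp : p % 4 = 1) (hq : q % 4 = 1)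
    (h : legendreSym q ℓ = -1) (h' : legendreSym p ℓ = -1) :
    IsSquare (((q * p : ℕ) : ℤ) : ZMod ℓ) := by
  by_cases h2 : ℓ = 2
  · subst h2
    exact isSquare_zmod_two _
  · apply isSquare_zmod_of_legendreSym_eq_one
    rw [Nat.cast_mul, legendreSym.mul, legendreSym_comm hq h2, legendreSym_comm hp h2, h, h']
    norm_num

theorem isNormValue_mul_prime {ℓ m : ℕ} [Fact ℓ.Prime] [Fact m.Prime] (hp : p % 4 = 1) (hq : q % 4 = 1)
    (hpq : p ≠ q) {θ : K} (hθ : θ ^ 2 = p)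
    (hl : legendreSym q ℓ = -1) (hl' : legendreSym p ℓ = -1)
    (hm : legendreSym q m = -1) (hm' : legendreSym p m = -1) :
    IsNormValue (q : K) ((ℓ : K) * m) := by
  have hp0 : p.Prime := Fact.out
  have hq0 : q.Prime := Fact.out
  have hl0 : ℓ.Prime := Fact.out
  have hm0 : m.Prime := Fact.out
  by_cases hlm : ℓ = m
  · subst hlm
    rw [← _root_.sq]
    exact IsNormValue.sq _ _
  have hql : q.Coprime ℓ := (Nat.coprime_primes hq0 hl0).mpr
    (ne_of_legendreSym_ne_zero (by rw [hl]; norm_num)).symm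
  have hqm : q.Coprime m := (Nat.coprime_primes hq0 hm0).mpr
    (ne_of_legendreSym_ne_zero (by rw [hm]; norm_num)).symm
  have hpl : p.Coprime ℓ := (Nat.coprime_primes hp0 hl0).mpr
    (ne_of_legendreSym_ne_zero (by rw [hl']; norm_num)).symm
  have hpm : p.Coprime m := (Nat.coprime_primes hp0 hm0).mpr
    (ne_of_legendreSym_ne_zero (by rw [hm']; norm_num)).symm
  have hqp : q.Coprime p := (Nat.coprime_primes hq0 hp0).mpr hpq.symm
  have key : IsNormValue (((q * p : ℕ)) : K) ((ℓ * m : ℕ) : K) := by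
    refine IsNormValue.of_isSquare_zmod (mul_ne_zero hq0.ne_zero hp0.ne_zero)
      (mul_ne_zero hl0.ne_zero hm0.ne_zero)
      (Nat.Coprime.mul_left (hql.mul_right hqm) (hpl.mul_right hpm)) ?_ ?_ ?_ ?_
    · push_cast
      exact not_isSquare_prime_mul hq0 (hq0.coprime_iff_not_dvd.mp hqp)
    · have := not_isSquare_prime_mul hq0
        (hq0.coprime_iff_not_dvd.mp (hqp.mul_right (hql.mul_right hqm)))
      push_cast at this ⊢
      rwa [mul_assoc]
    · exact isSquare_zmod_mul ((Nat.coprime_primes hl0 hm0).mpr hlm)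
        (isSquare_mul_zmod hp hq hl hl') (isSquare_mul_zmod hp hq hm hm')
    · refine isSquare_zmod_mul hqp (isSquare_zmod_of_legendreSym_eq_one ?_)
        (isSquare_zmod_of_legendreSym_eq_one ?_)
      · rw [Nat.cast_mul, legendreSym.mul, hl, hm]; norm_num
      · rw [Nat.cast_mul, legendreSym.mul, hl', hm']; norm_num
  push_cast at key
  rw [← hθ] at key
  exact key.of_sq_mul

/-- A prime `ℓ` at which the quaternion algebra `(q, ℓ)` can only be ramified if `ℓ` is inert in
`ℚ(√p)`. -/
def GoodPrime (p q ℓ : ℕ) [Fact p.Prime] [Fact q.Prime] : Prop :=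
  legendreSym q ℓ = 1 ∨ (legendreSym q ℓ = -1 ∧ legendreSym p ℓ = -1)

theorem isNormValue_of_goodPrime (hp : p % 4 = 1) (hq : q % 4 = 1)
    (hpq : p ≠ q) {θ : K} (hθ : θ ^ 2 = p) (n : ℕ) :
    n ≠ 0 → (∀ ℓ : ℕ, ℓ.Prime → ℓ ∣ n → GoodPrime p q ℓ) →
    (legendreSym q n = 1 ∧ IsNormValue (q : K) (n : K)) ∨
    (legendreSym q n = -1 ∧ ∀ ℓ : ℕ, ℓ.Prime → legendreSym q ℓ = -1 → legendreSym p ℓ = -1 →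
      IsNormValue (q : K) ((ℓ : K) * n)) := by
  induction n using induction_on_primes with
  | zero => exact fun h => absurd rfl h
  | one =>
    intro _ _
    left
    refine ⟨by simp, ?_⟩
    simpa using IsNormValue.sq (q : K) 1
  | prime_mul ℓ a hℓ ih =>
    intro hne hgood
    have ha : a ≠ 0 := right_ne_zero_of_mul hne
    have : Fact ℓ.Prime := ⟨hℓ⟩
    have hℓ0 : (ℓ : K) ≠ 0 := by exact_mod_cast hℓ.ne_zero
    have ih' := ih ha fun m hm hd => hgood m hm (hd.mul_left _)
    push_cast
    rw [legendreSym.mul]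
    rcases hgood ℓ hℓ (dvd_mul_right _ _) with h1 | ⟨h1, h2⟩
    · have hN : IsNormValue (q : K) (ℓ : K) := isNormValue_prime hq h1
      rw [h1, one_mul]
      refine ih'.imp (fun h => ⟨h.1, hN.mul h.2⟩) fun h => ⟨h.1, fun m hm e1 e2 => ?_⟩
      rw [mul_left_comm]
      exact hN.mul (h.2 m hm e1 e2)
    · rcases ih' with ⟨e, h⟩ | ⟨e, h⟩
      · right
        rw [h1, e]
        refine ⟨by norm_num, fun m hm e1 e2 => ?_⟩
        have : Fact m.Prime := ⟨hm⟩
        rw [← mul_assoc]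
        exact (isNormValue_mul_prime hp hq hpq hθ e1 e2 h1 h2).mul h
      · left
        rw [h1, e]
        exact ⟨by norm_num, h ℓ hℓ h1 h2⟩

end Legendre

theorem sq_emod_eight_of_odd {x : ℤ} (h : Odd x) : x ^ 2 % 8 = 1 := by
  obtain ⟨k, rfl⟩ := h
  obtain ⟨m, hm⟩ := Int.even_mul_succ_self k
  have : (2 * k + 1) ^ 2 = 8 * m + 1 := by linear_combination 4 * hm
  omega

/-- When `2` splits in `ℚ(√p)` but not in `ℚ(√q)`, it divides `t d + 2 c` to an even power. -/
theorem odd_or_eq_four_mul_odd {p q : ℕ} {c d t u : ℤ} (hp : p % 8 = 1) (hq : q % 8 = 5)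
    (hcd : c ^ 2 + d ^ 2 = q) (hc : Even c) (hd : Odd d) (htu : t ^ 2 + 4 = p * u ^ 2) :
    Odd (t * d + 2 * c) ∨ ∃ r, Odd r ∧ t * d + 2 * c = 2 ^ 2 * r := by
  rcases Int.even_or_odd t with ht | ht
  swap
  · exact Or.inl ((ht.mul hd).add_even (even_two_mul c))
  right
  obtain ⟨T, rfl⟩ := ht
  obtain ⟨a, rfl⟩ := hc
  have hd2 := sq_emod_eight_of_odd hd
  have ha : Odd a := by
    by_contra h
    obtain ⟨b, rfl⟩ := Int.not_odd_iff_even.mp h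
    have : (b + b + (b + b)) ^ 2 = 8 * (2 * b ^ 2) := by ring
    omega
  have hp' : (p : ℤ) = 8 * (p / 8 : ℕ) + 1 := by omega
  have hu : Even u := by
    by_contra h
    have h1 := sq_emod_eight_of_odd (Int.not_even_iff_odd.mp h)
    have h2 : (T + T) ^ 2 = 4 * T ^ 2 := by ring
    have h3 : (p : ℤ) * u ^ 2 = 8 * ((p / 8 : ℕ) * u ^ 2) + u ^ 2 := by
      conv_lhs => rw [hp']
      ring
    omega
  obtain ⟨U, rfl⟩ := hu
  have hTU : T ^ 2 + 1 = 8 * ((p / 8 : ℕ) * U ^ 2) + U ^ 2 := by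
    have : (p : ℤ) * U ^ 2 = 8 * ((p / 8 : ℕ) * U ^ 2) + U ^ 2 := by
      conv_lhs => rw [hp']
      ring
    linarith
  have hUodd : Odd U := by
    by_contra h
    obtain ⟨V, rfl⟩ := Int.not_odd_iff_even.mp h
    have h1 : (V + V) ^ 2 = 4 * V ^ 2 := by ring
    rcases Int.even_or_odd T with hT | hT
    · obtain ⟨S, rfl⟩ := hT
      have h2 : (S + S) ^ 2 = 4 * S ^ 2 := by ring
      omega
    · have h2 := sq_emod_eight_of_odd hT
      omega
  have hU2 := sq_emod_eight_of_odd hUodd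
  have hT4 : T % 4 = 0 := by
    have hT8 : T ^ 2 % 8 = 0 := by omega
    have : T % 8 = 0 ∨ T % 8 = 1 ∨ T % 8 = 2 ∨ T % 8 = 3 ∨ T % 8 = 4 ∨ T % 8 = 5 ∨ T % 8 = 6 ∨
      T % 8 = 7 := by omega
    rcases this with h | h | h | h | h | h | h | h <;> simp [pow_two, Int.mul_emod, h] at hT8 <;>
      omega
  obtain ⟨W, rfl⟩ := Int.dvd_of_emod_eq_zero hT4
  exact ⟨2 * W * d + a, (even_two_mul (W * d)).add_odd ha |> (by simpa [mul_assoc] using ·), by ring⟩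

section SumTwoSquares

variable {p q : ℕ} [Fact p.Prime] [Fact q.Prime]

theorem exists_sq_add_sq_odd (hq : q % 4 = 1) :
    ∃ c d : ℤ, c ^ 2 + d ^ 2 = q ∧ Even c ∧ Odd d := by
  obtain ⟨a, b, hab⟩ := Nat.Prime.sq_add_sq (p := q) (by omega)
  have hab' : (a : ℤ) ^ 2 + (b : ℤ) ^ 2 = q := by exact_mod_cast hab
  have hodd : Odd ((a : ℤ) ^ 2 + (b : ℤ) ^ 2) := by
    rw [hab', Int.odd_iff]; omega
  rcases Int.even_or_odd (a : ℤ) with ha | ha <;> rcases Int.even_or_odd (b : ℤ) with hb | hb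
  · simp [Int.odd_add, Int.odd_pow, Int.even_pow, Int.not_odd_iff_even.mpr ha, hb] at hodd
  · exact ⟨a, b, hab', ha, hb⟩
  · exact ⟨b, a, by linarith, hb, ha⟩
  · simp [Int.odd_add, Int.odd_pow, Int.even_pow, ha, Int.not_even_iff_odd.mpr hb] at hodd

theorem not_dvd_of_sq_add_sq {c d : ℤ} (hcd : c ^ 2 + d ^ 2 = q) : ¬ (q : ℤ) ∣ d := by
  have hq : Prime (q : ℤ) := Nat.prime_iff_prime_int.mp Fact.out
  intro hd
  have hc : (q : ℤ) ∣ c := by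
    apply hq.dvd_of_dvd_pow (n := 2)
    rw [show c ^ 2 = q - d * d by linarith]
    exact dvd_sub dvd_rfl (hd.mul_right _)
  obtain ⟨x, rfl⟩ := hd
  obtain ⟨y, rfl⟩ := hc
  apply hq.not_dvd_one
  refine ⟨y ^ 2 + x ^ 2, mul_left_cancel₀ hq.ne_zero ?_⟩
  linarith

theorem natCast_zmod_ne_zero_of_ne {ℓ : ℕ} (hℓ : ℓ.Prime) (hne : ℓ ≠ q) :
    ((q : ℤ) : ZMod ℓ) ≠ 0 := by
  have hq : q.Prime := Fact.out
  rw [Int.cast_natCast, Ne, ZMod.natCast_eq_zero_iff, Nat.prime_dvd_prime_iff_eq hℓ hq]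
  exact hne

theorem goodPrime_of_dvd {c d : ℤ} (hq : q % 4 = 1) (hcd : c ^ 2 + d ^ 2 = q) {ℓ : ℕ}
    (hℓ : ℓ.Prime) (h2 : ℓ ≠ 2) (hd : (ℓ : ℤ) ∣ d) : GoodPrime p q ℓ := by
  have : Fact ℓ.Prime := ⟨hℓ⟩
  left
  have hne : ℓ ≠ q := by
    rintro rfl
    exact not_dvd_of_sq_add_sq hcd hd
  rw [← legendreSym_comm hq h2, legendreSym.eq_one_iff _ (natCast_zmod_ne_zero_of_ne hℓ hne)]
  rw [← ZMod.intCast_zmod_eq_zero_iff_dvd] at hd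
  refine ⟨c, ?_⟩
  rw [← hcd]
  push_cast
  rw [hd]; ring

theorem goodPrime_of_dvd_add {c d t u : ℤ} (hp : p % 4 = 1) (hq : q % 4 = 1)
    (hcd : c ^ 2 + d ^ 2 = q) (htu : t ^ 2 + 4 = p * u ^ 2) {ℓ : ℕ}
    (hℓ : ℓ.Prime) (h2 : ℓ ≠ 2) (hne : ℓ ≠ q) (hd : (ℓ : ℤ) ∣ t * d + 2 * c) :
    GoodPrime p q ℓ := by
  have : Fact ℓ.Prime := ⟨hℓ⟩
  have hq0 := natCast_zmod_ne_zero_of_ne hℓ hne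
  have h20 : ((2 : ℤ) : ZMod ℓ) ≠ 0 := by
    have : Fact (Nat.Prime 2) := ⟨Nat.prime_two⟩
    exact natCast_zmod_ne_zero_of_ne (q := 2) hℓ h2
  rw [← ZMod.intCast_zmod_eq_zero_iff_dvd] at hd
  have hid : (p : ℤ) * (u * d) ^ 2 = (t * d + 2 * c) * (t * d - 2 * c) + 2 ^ 2 * q := by
    rw [← hcd]; linear_combination (-d ^ 2) * htu
  have hz : (((p : ℤ) * (u * d) ^ 2 : ℤ) : ZMod ℓ) = ((2 ^ 2 * q : ℤ) : ZMod ℓ) := by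
    rw [hid, Int.cast_add, Int.cast_mul, hd, zero_mul, zero_add]
  have hud : ((u * d : ℤ) : ZMod ℓ) ≠ 0 := by
    intro h0
    rw [Int.cast_mul, Int.cast_pow, h0, Int.cast_mul, Int.cast_pow] at hz
    have := mul_ne_zero (pow_ne_zero 2 h20) hq0
    apply this
    rw [← hz]; ring
  have hsym : legendreSym ℓ p = legendreSym ℓ q := by
    have h : legendreSym ℓ ((p : ℤ) * (u * d) ^ 2) = legendreSym ℓ (2 ^ 2 * q) := by
      unfold legendreSym; rw [hz]
    rwa [legendreSym.mul, legendreSym.mul, legendreSym.sq_one' _ hud,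
      legendreSym.sq_one' _ h20, mul_one, one_mul] at h
  rw [legendreSym_comm hp h2, legendreSym_comm hq h2] at hsym
  have hor := legendreSym.eq_one_or_neg_one ℓ hq0
  rw [legendreSym_comm hq h2] at hor
  exact hor.imp id fun h => ⟨h, hsym.trans h⟩

theorem legendreSym_two_of_mod_eight (h : q % 8 = 1) : legendreSym q 2 = 1 := by
  rw [legendreSym.at_two (by rintro rfl; omega), ZMod.χ₈_nat_mod_eight, h]; rfl

theorem legendreSym_two_of_mod_eight' (h : q % 8 = 5) : legendreSym q 2 = -1 := by
  rw [legendreSym.at_two (by rintro rfl; omega), ZMod.χ₈_nat_mod_eight, h]; rfl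

theorem goodPrime_two (hq : q % 4 = 1) (h : q % 8 = 1 ∨ p % 8 = 5) : GoodPrime p q 2 := by
  by_cases hq8 : q % 8 = 1
  · exact Or.inl (legendreSym_two_of_mod_eight hq8)
  · exact Or.inr ⟨legendreSym_two_of_mod_eight' (by omega),
      legendreSym_two_of_mod_eight' (h.resolve_left hq8)⟩

variable {K : Type*} [Field K] [CharZero K]

theorem isNormValue_neg_one {c d : ℤ} (hcd : c ^ 2 + d ^ 2 = q) :
    IsNormValue (q : K) (-1) := by
  have hd : (d : K) ≠ 0 := by
    rintro h
    rw [Int.cast_eq_zero] at h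
    exact not_dvd_of_sq_add_sq hcd (h ▸ dvd_zero _)
  have h : ((c : K) ^ 2 + (d : K) ^ 2) = q := by exact_mod_cast congrArg (Int.cast : ℤ → K) hcd
  refine ⟨c / d, 1 / d, ?_⟩
  field_simp
  linear_combination h

theorem legendreSym_natAbs (hq : q % 4 = 1) (r : ℤ) :
    legendreSym q (r.natAbs : ℤ) = legendreSym q r := by
  have h1 : legendreSym q (-1) = 1 := by
    rw [legendreSym.at_neg_one (by rintro rfl; omega), ZMod.χ₄_nat_one_mod_four hq]
  rcases Int.natAbs_eq r with h | h
  · rw [← h]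
  · conv_rhs => rw [h, neg_eq_neg_one_mul, legendreSym.mul, h1, one_mul]

theorem isNormValue_intCast_of_goodPrime (hp : p % 4 = 1) (hq : q % 4 = 1)
    (hpq : p ≠ q) {θ : K} (hθ : θ ^ 2 = p) {r : ℤ} (hr : legendreSym q r = 1)
    (hgood : ∀ ℓ : ℕ, ℓ.Prime → (ℓ : ℤ) ∣ r → GoodPrime p q ℓ) :
    IsNormValue (q : K) (r : K) := by
  have hr0 : r.natAbs ≠ 0 := by
    rw [Int.natAbs_ne_zero]
    rintro rfl
    simp at hr
  have h := isNormValue_of_goodPrime hp hq hpq hθ r.natAbs hr0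
    fun ℓ hℓ hd => hgood ℓ hℓ (Int.natCast_dvd.mpr hd)
  rw [legendreSym_natAbs hq, hr] at h
  have hN : IsNormValue (q : K) (r.natAbs : K) := h.elim (·.2) fun h => by norm_num at h
  obtain ⟨c, d, hcd, -⟩ := exists_sq_add_sq_odd hq
  rcases Int.natAbs_eq r with h | h
  · rw [h, Int.cast_natCast]; exact hN
  · rw [h, Int.cast_neg, Int.cast_natCast, neg_eq_neg_one_mul]
    exact (isNormValue_neg_one hcd).mul hN

theorem isNormValue_mul_add {c d t u : ℤ} (hp : p % 4 = 1) (hq : q % 4 = 1)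
    (hpq : p ≠ q) {θ : K} (hθ : θ ^ 2 = p) (hcd : c ^ 2 + d ^ 2 = q) (hc : Even c) (hd : Odd d)
    (htu : t ^ 2 + 4 = p * u ^ 2) (hr : legendreSym q (d * (t * d + 2 * c)) = 1) :
    IsNormValue (q : K) ((d : K) * (t * d + 2 * c)) := by
  have hneq : ∀ s : ℤ, legendreSym q s = 1 → ∀ ℓ : ℕ, (ℓ : ℤ) ∣ s → ℓ ≠ q := by
    rintro s hs ℓ hdvd rfl
    rw [(legendreSym.eq_zero_iff _ _).mpr ((ZMod.intCast_zmod_eq_zero_iff_dvd _ _).mpr hdvd)] at hs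
    norm_num at hs
  have hodd : ∀ r : ℤ, Odd r → ∀ ℓ : ℕ, (ℓ : ℤ) ∣ r → ℓ ≠ 2 := by
    rintro r hr ℓ hdvd rfl
    exact Int.not_even_iff_odd.mpr hr (even_iff_two_dvd.mpr hdvd)
  have h20 : ((2 : ℤ) : ZMod q) ≠ 0 := by
    have : Fact (Nat.Prime 2) := ⟨Nat.prime_two⟩
    exact natCast_zmod_ne_zero_of_ne (q := 2) Fact.out (by rintro rfl; omega)
  by_cases h8 : (Odd (t * d + 2 * c) ∨ (q % 8 = 1 ∨ p % 8 = 5))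
  · have := isNormValue_intCast_of_goodPrime hp hq hpq hθ hr fun ℓ hℓ hdvd => ?_
    · exact_mod_cast this
    · rcases (Nat.prime_iff_prime_int.mp hℓ).dvd_or_dvd hdvd with h | h
      · exact goodPrime_of_dvd hq hcd hℓ (hodd d hd ℓ h) h
      · by_cases h2 : ℓ = 2
        · subst h2
          exact goodPrime_two hq (h8.resolve_left fun ho => hodd _ ho 2 h rfl)
        · exact goodPrime_of_dvd_add hp hq hcd htu hℓ h2 (hneq _ hr ℓ hdvd) h
  · rw [not_or, not_or] at h8
    obtain ⟨r, hrodd, hr4⟩ := (odd_or_eq_four_mul_odd (p := p) (q := q) (by omega) (by omega)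
      hcd hc hd htu).resolve_left h8.1
    have hr' : legendreSym q (d * r) = 1 := by
      rwa [hr4, mul_left_comm, legendreSym.mul, legendreSym.sq_one' _ h20, one_mul] at hr
    have := isNormValue_intCast_of_goodPrime hp hq hpq hθ hr' fun ℓ hℓ hdvd => ?_
    · have h4 := congrArg (Int.cast : ℤ → K) hr4
      push_cast at h4 this
      rw [h4, mul_left_comm]
      rw [show (4 : K) = 2 ^ 2 by norm_num]
      exact (IsNormValue.sq _ _).mul this
    · rcases (Nat.prime_iff_prime_int.mp hℓ).dvd_or_dvd hdvd with h | h
      · exact goodPrime_of_dvd hq hcd hℓ (hodd d hd ℓ h) h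
      · exact goodPrime_of_dvd_add hp hq hcd htu hℓ (hodd r hrodd ℓ h) (hneq _ hr' ℓ hdvd)
          (hr4 ▸ h.mul_left _)

/-- If `ε` is a root of `X ^ 2 - t X - 1`, and `e` is a root of the same polynomial modulo `q`
which is a square, then `ε` is represented by `a ^ 2 - q b ^ 2`. -/
theorem isNormValue_of_isSquare_zmod {t u : ℤ} (hp : p % 4 = 1) (hq : q % 4 = 1)
    (hpq : p ≠ q) {θ : K} (hθ : θ ^ 2 = p) (htu : t ^ 2 + 4 = p * u ^ 2)
    {ε : K} (hε : ε ^ 2 = t * ε + 1) {e : ℤ} (he : ((e ^ 2 : ℤ) : ZMod q) = (t * e + 1 : ℤ))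
    (hsq : IsSquare (e : ZMod q)) : IsNormValue (q : K) ε := by
  have h20 : ((2 : ℤ) : ZMod q) ≠ 0 := by
    have : Fact (Nat.Prime 2) := ⟨Nat.prime_two⟩
    exact natCast_zmod_ne_zero_of_ne (q := 2) Fact.out (by rintro rfl; omega)
  have he0 : (e : ZMod q) ≠ 0 := by
    intro h0
    push_cast at he
    simp [h0] at he
  obtain ⟨c, d, hcd, hc, hd, hR⟩ : ∃ c d : ℤ, c ^ 2 + d ^ 2 = q ∧ Even c ∧ Odd d ∧
      ((t * d + 2 * c : ℤ) : ZMod q) ≠ 0 := by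
    obtain ⟨c, d, hcd, hc, hd⟩ := exists_sq_add_sq_odd hq
    by_cases hR : ((t * d + 2 * c : ℤ) : ZMod q) = 0
    · refine ⟨-c, d, by rw [neg_sq, hcd], hc.neg, hd, fun hR' => ?_⟩
      have hc0 : (c : ZMod q) ≠ 0 := by
        rw [Ne, ZMod.intCast_zmod_eq_zero_iff_dvd]
        exact not_dvd_of_sq_add_sq (c := d) (by rw [add_comm, hcd])
      apply mul_ne_zero (mul_ne_zero h20 h20) hc0
      push_cast at hR hR' ⊢
      linear_combination hR - hR'
    · exact ⟨c, d, hcd, hc, hd, hR⟩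
  have hd0 : (d : ZMod q) ≠ 0 := by
    rw [Ne, ZMod.intCast_zmod_eq_zero_iff_dvd]
    exact not_dvd_of_sq_add_sq hcd
  have hcdz : (c : ZMod q) ^ 2 + (d : ZMod q) ^ 2 = 0 := by
    have := congrArg (Int.cast : ℤ → ZMod q) hcd
    push_cast at this
    rwa [ZMod.natCast_self] at this
  have hr0 : ((d * (t * d + 2 * c) : ℤ) : ZMod q) ≠ 0 := by
    rw [Int.cast_mul]; exact mul_ne_zero hd0 hR
  have hr : legendreSym q (d * (t * d + 2 * c)) = 1 := by
    rw [legendreSym.eq_one_iff _ hr0]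
    obtain ⟨f, hf⟩ := hsq
    have hf0 : f ≠ 0 := by rintro rfl; simp at hf; exact he0 hf
    refine ⟨(d * e + c) / f, ?_⟩
    rw [div_mul_div_comm, ← hf, eq_div_iff he0]
    push_cast at he ⊢
    linear_combination -hcdz - (d : ZMod q) ^ 2 * he
  have hN := isNormValue_mul_add (K := K) hp hq hpq hθ hcd hc hd htu hr
  have hcdK : (c : K) ^ 2 + (d : K) ^ 2 = q := by
    exact_mod_cast congrArg (Int.cast : ℤ → K) hcd
  refine IsNormValue.of_mul_left (x := (d : K) * (t * d + 2 * c)) ⟨d * ε + c, 1, ?_⟩ hN ?_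
  · linear_combination hcdK + (d : K) ^ 2 * hε
  · have : (d * (t * d + 2 * c) : ℤ) ≠ 0 := by
      intro h0; rw [h0] at hr0; simp at hr0
    exact_mod_cast (Int.cast_ne_zero (α := K)).mpr this

end SumTwoSquares

section Padic

variable {q : ℕ} [Fact q.Prime]

theorem padic_norm_sq_ne (x : ℚ_[q]) : ‖x‖ ^ 2 ≠ (q : ℝ)⁻¹ := by
  have hq : 1 < (q : ℝ) := by exact_mod_cast (Fact.out : q.Prime).one_lt
  intro h
  have hx : x ≠ 0 := by
    rintro rfl
    rw [norm_zero, zero_pow two_ne_zero] at h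
    exact (inv_ne_zero (by positivity)) h.symm
  rw [Padic.norm_eq_zpow_neg_valuation hx, ← zpow_natCast, ← zpow_mul, ← zpow_neg_one] at h
  have := zpow_right_injective₀ (by positivity) hq.ne' h
  push_cast at this
  omega

theorem padicInt_norm_eq_one_of_toZMod_ne_zero {x : ℤ_[q]} (h : PadicInt.toZMod x ≠ 0) :
    ‖x‖ = 1 := by
  rw [← PadicInt.isUnit_iff]
  by_contra hu
  have : x ∈ RingHom.ker (PadicInt.toZMod : ℤ_[q] →+* ZMod q) := by
    rw [PadicInt.ker_toZMod]
    exact (IsLocalRing.mem_maximalIdeal x).mpr hu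
  exact h this

/-- If `E` is not a square modulo `q`, then `q` is not a norm from `ℚ_q(√E)`. -/
theorem padic_sq_sub_mul_sq_ne {E : ℤ_[q]} (hE : ¬ IsSquare (PadicInt.toZMod E))
    (a b : ℚ_[q]) : a ^ 2 - E * b ^ 2 ≠ (q : ℚ_[q]) := by
  intro h
  have hE1 : ‖(E : ℚ_[q])‖ = 1 :=
    padicInt_norm_eq_one_of_toZMod_ne_zero fun h0 => hE (h0 ▸ IsSquare.zero)
  have hnorm : ‖a ^ 2 - E * b ^ 2‖ = (q : ℝ)⁻¹ := by rw [h, Padic.norm_p]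
  rcases lt_or_ge ‖b‖ ‖a‖ with hlt | hle
  · have hsq : ‖E * b ^ 2‖ < ‖a ^ 2‖ := by
      rw [norm_mul, hE1, one_mul, norm_pow, norm_pow]
      exact pow_lt_pow_left₀ hlt (norm_nonneg _) two_ne_zero
    rw [sub_eq_add_neg, Padic.add_eq_max_of_ne (by rw [norm_neg]; exact hsq.ne'), norm_neg,
      max_eq_left hsq.le, norm_pow] at hnorm
    exact padic_norm_sq_ne a hnorm
  · by_cases hb : b = 0
    · subst hb
      rw [norm_zero, norm_le_zero_iff] at hle
      subst hle
      rw [zero_pow two_ne_zero, mul_zero, sub_zero, norm_zero] at hnorm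
      exact inv_ne_zero (by exact_mod_cast (Fact.out : q.Prime).ne_zero) hnorm.symm
    have hc : ‖a / b‖ ≤ 1 := by
      rw [norm_div]
      exact div_le_one_of_le₀ hle (norm_nonneg _)
    let c : ℤ_[q] := ⟨a / b, hc⟩
    have hcE : ‖c ^ 2 - E‖ = 1 := by
      apply padicInt_norm_eq_one_of_toZMod_ne_zero
      rw [map_sub, map_pow, sub_ne_zero]
      intro h0
      exact hE ⟨_, by rw [← h0, sq]⟩
    have hcE' : ‖(a / b) ^ 2 - (E : ℚ_[q])‖ = 1 := by
      rw [PadicInt.norm_def] at hcE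
      exact_mod_cast hcE
    have hfac : a ^ 2 - E * b ^ 2 = ((a / b) ^ 2 - E) * b ^ 2 := by field_simp
    rw [hfac, norm_mul, hcE', one_mul, norm_pow] at hnorm
    exact padic_norm_sq_ne b hnorm

theorem exists_padicInt_sq_eq {p : ℕ} {s : ℤ} (hq2 : q ≠ 2)
    (hp0 : ((p : ℤ) : ZMod q) ≠ 0) (hs : ((s ^ 2 : ℤ) : ZMod q) = (p : ℤ)) :
    ∃ σ : ℤ_[q], σ ^ 2 = p ∧ PadicInt.toZMod σ = (s : ZMod q) := by
  have hq : q.Prime := Fact.out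
  have hs0 : ((2 * s : ℤ) : ZMod q) ≠ 0 := by
    rw [Int.cast_mul]
    refine mul_ne_zero ?_ fun h0 => hp0 ?_
    · have h2 : ¬ q ∣ 2 := fun h => hq2 ((Nat.prime_dvd_prime_iff_eq hq Nat.prime_two).mp h)
      rwa [← ZMod.natCast_eq_zero_iff, ← Int.cast_natCast] at h2
    · rw [← hs, Int.cast_pow, h0, zero_pow two_ne_zero]
  have hder : ‖Polynomial.aeval (s : ℤ_[q])
      (Polynomial.derivative (Polynomial.X ^ 2 - Polynomial.C (p : ℤ_[q])))‖ = 1 := by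
    apply padicInt_norm_eq_one_of_toZMod_ne_zero
    rw [Int.cast_mul] at hs0
    have h2 : PadicInt.toZMod (2 : ℤ_[q]) = 2 := map_ofNat _ 2
    simpa [one_add_one_eq_two, h2] using hs0
  have hval : ‖Polynomial.aeval (s : ℤ_[q])
      (Polynomial.X ^ 2 - Polynomial.C (p : ℤ_[q]))‖ < 1 := by
    have : (q : ℤ) ∣ s ^ 2 - p := by
      rw [← ZMod.intCast_zmod_eq_zero_iff_dvd, Int.cast_sub, hs, sub_self]
    rw [← PadicInt.norm_int_lt_one_iff_dvd] at this
    simpa using this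
  obtain ⟨σ, h1, h2, -, -⟩ := hensels_lemma (p := q) (R := ℤ_[q])
    (F := Polynomial.X ^ 2 - Polynomial.C (p : ℤ_[q])) (a := (s : ℤ_[q]))
    (by rw [hder, one_pow]; exact hval)
  refine ⟨σ, ?_, ?_⟩
  · simpa [sub_eq_zero] using h1
  · rw [hder] at h2
    have hk : PadicInt.toZMod (σ - (s : ℤ_[q])) = 0 := by
      by_contra hne
      exact h2.ne (padicInt_norm_eq_one_of_toZMod_ne_zero hne)
    rwa [map_sub, sub_eq_zero, map_intCast] at hk

end Padic

section QuadraticField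

variable {K : Type*} [Field K] [NumberField K]

open QuadraticAlgebra in
theorem norm_algEquiv {p : ℕ} (e : QuadraticAlgebra ℚ (p : ℚ) 0 ≃ₐ[ℚ] K)
    (z : QuadraticAlgebra ℚ (p : ℚ) 0) : Algebra.norm ℚ (e z) = z.norm := by
  rw [Algebra.norm_eq_of_algEquiv, ← det_toLinearMap_eq_norm, Algebra.norm_apply]
  rfl

open QuadraticAlgebra in
theorem algEquiv_omega_sq {p : ℕ} (e : QuadraticAlgebra ℚ (p : ℚ) 0 ≃ₐ[ℚ] K) :
    e ω ^ 2 = p := by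
  rw [← map_pow, sq, omega_mul_omega_eq_algebraMap]
  simp

open QuadraticAlgebra in
theorem algEquiv_apply_eq {p : ℕ} (e : QuadraticAlgebra ℚ (p : ℚ) 0 ≃ₐ[ℚ] K)
    (z : QuadraticAlgebra ℚ (p : ℚ) 0) : e z = z.re + z.im * e ω := by
  conv_lhs => rw [show z = ⟨z.re, z.im⟩ from rfl, mk_eq_add_smul_omega]
  simp [Algebra.smul_def]

variable {p : ℕ} [Fact p.Prime]

theorem rat_sq_ne_prime (r : ℚ) : r ^ 2 ≠ p := fun h =>
  (Fact.out : p.Prime).prime.not_isSquare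
    (Rat.isSquare_natCast_iff.mp ⟨r, by rw [← h, sq]⟩)

theorem exists_int_eq_of_sq_mul_prime {s : ℚ} {j : ℤ} (h : s ^ 2 * p = j) :
    ∃ n : ℤ, s = n := by
  have hp : Prime (p : ℤ) := Nat.prime_iff_prime_int.mp Fact.out
  have hp0 : (p : ℚ) ≠ 0 := by exact_mod_cast (Fact.out : p.Prime).ne_zero
  obtain ⟨i, hi⟩ : ∃ i : ℤ, (i : ℚ) = s * p := by
    have hint : IsIntegral ℤ (s * p) := by
      refine IsIntegral.of_pow two_pos ?_
      rw [show (s * p) ^ 2 = ((j * p : ℤ) : ℚ) by push_cast; rw [← h]; ring]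
      exact isIntegral_algebraMap
    exact IsIntegrallyClosed.isIntegral_iff.mp hint
  have hi2 : i ^ 2 = j * p := by
    have : ((i ^ 2 : ℤ) : ℚ) = ((j * p : ℤ) : ℚ) := by
      push_cast; rw [hi, ← h]; ring
    exact_mod_cast this
  obtain ⟨n, rfl⟩ := hp.dvd_of_dvd_pow (⟨j, by rw [hi2, mul_comm]⟩ : (p : ℤ) ∣ i ^ 2)
  refine ⟨n, mul_right_cancel₀ hp0 ?_⟩
  rw [← hi]
  push_cast
  ring

theorem nonempty_algEquiv_Qs : Nonempty (QuadraticAlgebra ℚ (p : ℚ) 0 ≃ₐ[ℚ] Qs p) := by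
  have : Fact (∀ r : ℚ, r ^ 2 ≠ (p : ℚ) + 0 * r) := ⟨fun r => by
    rw [zero_mul, add_zero]; exact rat_sq_ne_prime r⟩
  have hmem : Real.sqrt p ∈ Qs p := IntermediateField.mem_adjoin_simple_self ℚ _
  have hsq : Real.sqrt p * Real.sqrt p = p := Real.mul_self_sqrt (Nat.cast_nonneg p)
  let f : QuadraticAlgebra ℚ (p : ℚ) 0 →ₐ[ℚ] Qs p :=
    QuadraticAlgebra.lift ⟨⟨Real.sqrt p, hmem⟩, by
      apply Subtype.ext
      simp [Algebra.smul_def, hsq]⟩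
  have hf : f QuadraticAlgebra.omega = ⟨Real.sqrt p, hmem⟩ := by
    change (0 : ℚ) • (1 : Qs p) + (1 : ℚ) • (⟨Real.sqrt p, hmem⟩ : Qs p) = _
    rw [zero_smul, one_smul, zero_add]
  have hinj : Function.Injective f := f.toRingHom.injective
  refine ⟨AlgEquiv.ofBijective f ⟨hinj, fun x => ?_⟩⟩
  have hle : Qs p ≤ ((Qs p).val.comp f).fieldRange := by
    refine IntermediateField.adjoin_simple_le_iff.mpr ⟨QuadraticAlgebra.omega, ?_⟩
    exact congrArg Subtype.val hf
  obtain ⟨z, hz⟩ := hle x.2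
  exact ⟨z, Subtype.ext hz⟩

open QuadraticAlgebra in
theorem exists_two_mul_eq_of_isIntegral (e : QuadraticAlgebra ℚ (p : ℚ) 0 ≃ₐ[ℚ] K)
    {x : K} (hx : IsIntegral ℤ x) : ∃ m n : ℤ, 2 * x = m + n * e ω ∧
      4 * Algebra.norm ℚ x = m ^ 2 - p * n ^ 2 := by
  obtain ⟨z, rfl⟩ := e.surjective x
  have hz : IsIntegral ℤ z := (isIntegral_algEquiv (e.restrictScalars ℤ)).mp hx
  let conj : QuadraticAlgebra ℚ (p : ℚ) 0 →ₐ[ℚ] QuadraticAlgebra ℚ (p : ℚ) 0 :=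
    lift ⟨-ω, by rw [neg_mul_neg, omega_mul_omega_eq_algebraMap, Algebra.algebraMap_eq_smul_one]; simp⟩
  have hconj : conj z = star z := by
    ext <;> simp [conj]
  have hz' : IsIntegral ℤ (star z) := by
    rw [← hconj]
    exact hz.map (conj.restrictScalars ℤ)
  have hinj : Function.Injective (algebraMap ℚ (QuadraticAlgebra ℚ (p : ℚ) 0)) :=
    FaithfulSMul.algebraMap_injective _ _
  have htr : IsIntegral ℤ (trace z) := by
    rw [← isIntegral_algebraMap_iff hinj, algebraMap_trace_eq_add_star]
    exact hz.add hz'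
  have hno : IsIntegral ℤ z.norm := by
    rw [← isIntegral_algebraMap_iff hinj, algebraMap_norm_eq_mul_star]
    exact hz.mul hz'
  obtain ⟨m, hm⟩ := IsIntegrallyClosed.isIntegral_iff.mp htr
  obtain ⟨k, hk⟩ := IsIntegrallyClosed.isIntegral_iff.mp hno
  simp only [trace_def, norm_def, zero_mul, add_zero, algebraMap_int_eq, eq_intCast] at hm hk
  obtain ⟨n, hn⟩ := exists_int_eq_of_sq_mul_prime (p := p) (s := 2 * z.im) (j := m ^ 2 - 4 * k)
    (by push_cast; rw [hm, hk]; ring)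
  refine ⟨m, n, ?_, ?_⟩
  · have h1 : (m : K) = 2 * z.re := by exact_mod_cast congrArg (Rat.cast : ℚ → K) hm
    have h2 : 2 * z.im = (n : K) := by exact_mod_cast congrArg (Rat.cast : ℚ → K) hn
    rw [algEquiv_apply_eq, h1, ← h2]; ring
  · rw [norm_algEquiv, norm_def, hm, ← hn]; ring

end QuadraticField

section Residue

variable {K : Type*} [Field K] {q : ℕ} [Fact q.Prime] {𝔮 : Ideal (𝓞 K)}

theorem dvd_of_intCast_mem (h𝔮 : 𝔮 ≠ ⊤) (hq : (q : 𝓞 K) ∈ 𝔮) {n : ℤ} (hn : (n : 𝓞 K) ∈ 𝔮) :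
    (q : ℤ) ∣ n := by
  by_contra hnd
  have hcop : IsCoprime (q : ℤ) n :=
    (Nat.prime_iff_prime_int.mp (Fact.out : q.Prime)).coprime_iff_not_dvd.mpr hnd
  obtain ⟨a, b, hab⟩ := hcop
  apply h𝔮
  rw [Ideal.eq_top_iff_one]
  have h1 : (a : 𝓞 K) * q + b * n = 1 := by exact_mod_cast congrArg (Int.cast : ℤ → 𝓞 K) hab
  rw [← h1]
  exact add_mem (𝔮.mul_mem_left _ hq) (𝔮.mul_mem_left _ hn)

theorem intCast_mem_iff (h𝔮 : 𝔮 ≠ ⊤) (hq : (q : 𝓞 K) ∈ 𝔮) {n : ℤ} :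
    (n : 𝓞 K) ∈ 𝔮 ↔ (n : ZMod q) = 0 := by
  rw [ZMod.intCast_zmod_eq_zero_iff_dvd]
  refine ⟨dvd_of_intCast_mem h𝔮 hq, ?_⟩
  rintro ⟨m, rfl⟩
  push_cast
  exact 𝔮.mul_mem_right _ hq

/-- If `𝓞 K / 𝔮` is the prime field, squares in it can be recognised in `ZMod q`. -/
theorem isSquare_mk_iff (h𝔮 : 𝔮 ≠ ⊤) (hq : (q : 𝓞 K) ∈ 𝔮)
    (hres : ∀ x : 𝓞 K, ∃ n : ℤ, x - n ∈ 𝔮) {x : 𝓞 K} {e : ℤ} (he : x - e ∈ 𝔮) :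
    IsSquare (Ideal.Quotient.mk 𝔮 x) ↔ IsSquare (e : ZMod q) := by
  rw [Ideal.Quotient.eq.mpr he]
  constructor
  · rintro ⟨y, hy⟩
    obtain ⟨y, rfl⟩ := Ideal.Quotient.mk_surjective y
    obtain ⟨n, hn⟩ := hres y
    rw [Ideal.Quotient.eq.mpr hn, ← map_mul, Ideal.Quotient.eq] at hy
    refine ⟨n, ?_⟩
    rw [← sub_eq_zero, ← Int.cast_mul, ← Int.cast_sub, ← intCast_mem_iff h𝔮 hq]
    exact_mod_cast hy
  · rintro ⟨y, hy⟩
    obtain ⟨n, rfl⟩ := ZMod.intCast_surjective y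
    refine ⟨Ideal.Quotient.mk 𝔮 n, ?_⟩
    rw [← map_mul, Ideal.Quotient.eq]
    rw [← sub_eq_zero, ← Int.cast_mul, ← Int.cast_sub, ← intCast_mem_iff h𝔮 hq] at hy
    exact_mod_cast hy

end Residue

open QuadraticAlgebra in
/-- If `2 ε = t + u θ` with `θ ^ 2 = p`, `θ` reduces to `s` modulo `q`, and `q` is a norm from
`K(√ε)`, then the reduction of `ε` is a square. -/
theorem isSquare_zmod_of_sq_sub_mul_sq {p q : ℕ} [Fact q.Prime] {K : Type*} [Field K]
    [NumberField K] (e : QuadraticAlgebra ℚ (p : ℚ) 0 ≃ₐ[ℚ] K) (hq2 : q ≠ 2)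
    (hp0 : ((p : ℤ) : ZMod q) ≠ 0) {s t u r : ℤ} (hs : ((s ^ 2 : ℤ) : ZMod q) = (p : ℤ))
    (hr : ((2 * r : ℤ) : ZMod q) = (t + u * s : ℤ)) {ε a b : K} (hε : 2 * ε = t + u * e ω)
    (hab : a ^ 2 - ε * b ^ 2 = q) : IsSquare (r : ZMod q) := by
  have h20 : (2 : ZMod q) ≠ 0 := by
    have h2 : ¬ q ∣ 2 := fun h =>
      hq2 ((Nat.prime_dvd_prime_iff_eq Fact.out Nat.prime_two).mp h)
    rwa [← ZMod.natCast_eq_zero_iff] at h2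
  obtain ⟨σ, hσ, hσs⟩ := exists_padicInt_sq_eq hq2 hp0 hs
  have hσ' : (σ : ℚ_[q]) * σ = p := by
    rw [← sq]; exact_mod_cast congrArg (Subtype.val : ℤ_[q] → ℚ_[q]) hσ
  let φ : K →ₐ[ℚ] ℚ_[q] := (lift ⟨(σ : ℚ_[q]), by simp [Algebra.smul_def, hσ']⟩).comp
    (e.symm : K →ₐ[ℚ] QuadraticAlgebra ℚ (p : ℚ) 0)
  have hφ : φ (e ω) = σ := by simp [φ]
  have hφε : 2 * φ ε = t + u * σ := by
    have := congrArg φ hε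
    rwa [map_mul, map_add, map_mul, hφ, map_intCast, map_intCast, map_ofNat] at this
  by_contra hns
  let E : ℤ_[q] := 2 * (t + u * σ)
  have hE : PadicInt.toZMod E = 2 ^ 2 * (r : ZMod q) := by
    push_cast at hr
    have h2 : PadicInt.toZMod (2 : ℤ_[q]) = 2 := map_ofNat _ 2
    simp only [E, map_mul, map_add, map_intCast, hσs, h2]
    rw [← hr]; ring
  have hEns : ¬ IsSquare (PadicInt.toZMod E) := by
    rintro ⟨x, hx⟩
    refine hns ⟨x / 2, ?_⟩
    rw [div_mul_div_comm, ← hx, hE]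
    field_simp
  apply padic_sq_sub_mul_sq_ne hEns (φ a) (φ b / 2)
  have h := congrArg φ hab
  rw [map_sub, map_mul, map_pow, map_pow, map_natCast] at h
  have hEφ : (E : ℚ_[q]) = 2 * (t + u * σ) := by
    have h2 : ((2 : ℤ_[q]) : ℚ_[q]) = 2 := rfl
    simp [E, h2]
  rw [← h, hEφ, ← hφε]
  ring

theorem exists_sq_sub_mul_sq_of_isNormValue {K : Type*} [Field K] [CharZero K] {q ε : K}
    (h : IsNormValue q ε) (hns : ¬ IsSquare ε) : ∃ a b : K, a ^ 2 - ε * b ^ 2 = q := by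
  obtain ⟨a, b, hab⟩ := h
  have hb : b ≠ 0 := by
    rintro rfl
    exact hns ⟨a, by rw [← hab]; ring⟩
  refine ⟨a / b, 1 / b, ?_⟩
  field_simp
  linear_combination hab

/-- Let `p1 ≡ 1 (mod 4)` be a prime, `k = ℚ(√p1)`, and `ε` a unit of `𝓞 k` of norm `-1`.
Let `q1 ≡ 1 (mod 4)` be a prime with `(p1/q1) = 1` and let `𝔮` be a prime ideal of `𝓞 k`
above `q1`. Then `q1` is a norm from `k(√ε)`, i.e. `q1 = a² - ε·b²` for some `a, b ∈ k`,
iff the image of `ε` in `𝓞 k / 𝔮` is a square. -/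
theorem statement_8 (p1 q1 : ℕ) [Fact p1.Prime] [Fact q1.Prime]
    (hp1 : p1 % 4 = 1) (hq1 : q1 % 4 = 1) (hleg : legendreSym q1 p1 = 1)
    (ε : (𝓞 (Qs p1))ˣ)
    (hnorm : Algebra.norm ℚ ((ε : 𝓞 (Qs p1)) : Qs p1) = -1)
    (𝔮 : Ideal (𝓞 (Qs p1))) (hprime : 𝔮.IsPrime)
    (habove : (q1 : 𝓞 (Qs p1)) ∈ 𝔮) :
    (∃ a b : Qs p1, a ^ 2 - ((ε : 𝓞 (Qs p1)) : Qs p1) * b ^ 2 = (q1 : Qs p1)) ↔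
      IsSquare (Ideal.Quotient.mk 𝔮 (ε : 𝓞 (Qs p1))) := by
  have hpq : p1 ≠ q1 := ne_of_legendreSym_ne_zero (by rw [hleg]; norm_num)
  have hq2 : q1 ≠ 2 := by rintro rfl; omega
  have hp0 : ((p1 : ℤ) : ZMod q1) ≠ 0 := natCast_zmod_ne_zero_of_ne Fact.out hpq.symm
  obtain ⟨e⟩ := nonempty_algEquiv_Qs (p := p1)
  obtain ⟨t, u, htu, hN⟩ := exists_two_mul_eq_of_isIntegral e (ε : 𝓞 (Qs p1)).isIntegral_coe
  set ε' : Qs p1 := ((ε : 𝓞 (Qs p1)) : Qs p1) with hε'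
  have hθ := algEquiv_omega_sq e
  set θ := e QuadraticAlgebra.omega with hθdef
  have htu4 : t ^ 2 + 4 = (p1 : ℤ) * u ^ 2 := by
    rw [hnorm] at hN
    have : (t : ℚ) ^ 2 + 4 = p1 * u ^ 2 := by linarith
    exact_mod_cast this
  have htu4K : (t : Qs p1) ^ 2 + 4 = p1 * u ^ 2 := by
    exact_mod_cast congrArg (Int.cast : ℤ → Qs p1) htu4
  have hεsq : ε' ^ 2 = t * ε' + 1 := by
    have h4 : (4 : Qs p1) ≠ 0 := by norm_num
    apply mul_left_cancel₀ h4
    linear_combination (2 * ε' - t + u * θ) * htu + u ^ 2 * hθ - htu4K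
  have hns : ¬ IsSquare ε' := by
    rintro ⟨x, hx⟩
    rw [hx, map_mul] at hnorm
    nlinarith [mul_self_nonneg (Algebra.norm ℚ x)]
  have hθint : IsIntegral ℤ θ := by
    refine IsIntegral.of_pow two_pos ?_
    rw [hθ]
    exact isIntegral_algebraMap (R := ℤ) (x := (p1 : ℤ)) |> (by simpa using ·)
  let Θ : 𝓞 (Qs p1) := ⟨θ, hθint⟩
  have hΘ : Θ ^ 2 = p1 := by
    apply RingOfIntegers.coe_injective
    rw [map_pow, map_natCast]
    exact hθ
  obtain ⟨s, hs, hΘs⟩ : ∃ s : ℤ, ((s ^ 2 : ℤ) : ZMod q1) = (p1 : ℤ) ∧ Θ - s ∈ 𝔮 := by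
    obtain ⟨x, hx⟩ := isSquare_zmod_of_legendreSym_eq_one hleg
    obtain ⟨s, rfl⟩ := ZMod.intCast_surjective x
    have hs : ((s ^ 2 : ℤ) : ZMod q1) = (p1 : ℤ) := by rw [hx]; push_cast; ring
    have hmem : (Θ - s) * (Θ + s) ∈ 𝔮 := by
      have : ((p1 - s ^ 2 : ℤ) : 𝓞 (Qs p1)) ∈ 𝔮 := by
        rw [intCast_mem_iff hprime.ne_top habove, Int.cast_sub, hs, sub_self]
      convert this using 1
      push_cast
      linear_combination hΘ
    rcases hprime.mem_or_mem hmem with h | h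
    · exact ⟨s, hs, h⟩
    · exact ⟨-s, by rw [neg_sq, hs], by simpa using h⟩
  obtain ⟨k, hk⟩ : ∃ k : ℤ, 2 * k = q1 + 1 := ⟨(q1 + 1) / 2, by omega⟩
  have hkO : 2 * (k : 𝓞 (Qs p1)) = q1 + 1 := by
    exact_mod_cast congrArg (Int.cast : ℤ → 𝓞 (Qs p1)) hk
  have hred : ∀ (x : 𝓞 (Qs p1)) (m n : ℤ), 2 * (x : Qs p1) = m + n * θ →
      x - ((k * (m + n * s) : ℤ) : 𝓞 (Qs p1)) ∈ 𝔮 := by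
    intro x m n h
    have h' : 2 * x = m + n * Θ := by
      apply RingOfIntegers.coe_injective
      rw [map_mul, map_add, map_mul, map_ofNat, map_intCast, map_intCast]
      exact h
    have : x - ((k * (m + n * s) : ℤ) : 𝓞 (Qs p1)) = k * n * (Θ - s) - x * q1 := by
      push_cast
      linear_combination k * h' - x * hkO
    rw [this]
    exact sub_mem (𝔮.mul_mem_left _ hΘs) (𝔮.mul_mem_left _ habove)
  have hres : ∀ x : 𝓞 (Qs p1), ∃ n : ℤ, x - n ∈ 𝔮 := by
    intro x
    obtain ⟨m, n, hmn, -⟩ := exists_two_mul_eq_of_isIntegral e x.isIntegral_coe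
    exact ⟨_, hred x m n hmn⟩
  rw [isSquare_mk_iff hprime.ne_top habove hres (hred ε t u htu)]
  have hkz : (2 : ZMod q1) * k = 1 := by
    have := congrArg (Int.cast : ℤ → ZMod q1) hk
    push_cast at this
    rwa [ZMod.natCast_self, zero_add] at this
  constructor
  · rintro ⟨a, b, hab⟩
    refine isSquare_zmod_of_sq_sub_mul_sq e hq2 hp0 hs ?_ htu hab
    push_cast
    linear_combination ((t : ZMod q1) + u * s) * hkz
  · intro hsq
    refine exists_sq_sub_mul_sq_of_isNormValue ?_ hns
    refine isNormValue_of_isSquare_zmod hp1 hq1 hpq hθ htu4 hεsq ?_ hsq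
    have htu4z := congrArg (Int.cast : ℤ → ZMod q1) htu4
    push_cast at htu4z hs ⊢
    linear_combination (k : ZMod q1) ^ 2 * u ^ 2 * hs - (k : ZMod q1) ^ 2 * htu4z +
      ((t : ZMod q1) * k * (t + u * s) + 2 * k + 1) * hkz
end
end

section
/- Let p1 ≡ 1 (mod 4) be a prime, let k = ℚ(√p1), and let ε be a unit of the ring of integers 𝓞_k with norm N_{k/ℚ}(ε) = −1. Let q1 ≡ 1 (mod 4) be a prime with (p1/q1) = 1, so that q1·𝓞_k = 𝔮·𝔮′ with two distinct prime ideals 𝔮, 𝔮′. Then the image of ε in the residue field 𝓞_k/𝔮 is a square if and only if the image of ε in the residue field 𝓞_k/𝔮′ is a square. -/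
open NumberField IntermediateField

set_option synthInstance.maxHeartbeats 1000000
set_option maxHeartbeats 1000000

noncomputable section

theorem finrank_Qs_of_prime {p : ℕ} (hp : p.Prime) : Module.finrank ℚ (Qs p) = 2 := by
  have hmin : minpoly ℚ (Real.sqrt p) = Polynomial.X ^ 2 - Polynomial.C (p : ℚ) := by
    refine (minpoly.eq_of_irreducible_of_monic
      (X_pow_sub_C_irreducible_of_prime Nat.prime_two fun b hb => ?_) ?_
      (Polynomial.monic_X_pow_sub_C _ two_ne_zero)).symm
    · refine hp.irrational_sqrt ⟨|b|, ?_⟩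
      have h : ((b : ℝ)) ^ 2 = p := by exact_mod_cast hb
      rw [← h, Real.sqrt_sq_eq_abs, Rat.cast_abs]
    · simp
  change Module.finrank ℚ ℚ⟮(Real.sqrt p)⟯ = 2
  rw [IntermediateField.adjoin.finrank (isIntegral_sqrt p), hmin, Polynomial.natDegree_X_pow_sub_C]

/-- In a quadratic extension, the norm of `x` is the product of `x` and its conjugate. -/
theorem algebraMap_norm_eq_mul_of_ne_one {F K : Type*} [Field F] [Field K] [Algebra F K]
    [Algebra.IsQuadraticExtension F K] [IsGalois F K] {σ : Gal(K/F)} (hσ : σ ≠ 1) (x : K) :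
    algebraMap F K (Algebra.norm F x) = x * σ x := by
  classical
  have hcard : Fintype.card Gal(K/F) = 2 := by
    rw [← Nat.card_eq_fintype_card, IsGalois.card_aut_eq_finrank,
      Algebra.IsQuadraticExtension.finrank_eq_two]
  have huniv : ({1, σ} : Finset Gal(K/F)) = Finset.univ :=
    Finset.eq_univ_of_card _ (by rw [Finset.card_pair hσ.symm, hcard])
  rw [Algebra.norm_eq_prod_automorphisms, ← huniv, Finset.prod_pair hσ.symm, AlgEquiv.one_apply]

theorem Ideal.mem_primesOver_span_natCast {R : Type*} [CommRing R] {q : ℕ} (hq : q.Prime)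
    {P : Ideal R} [hP : P.IsPrime] (hqP : (q : R) ∈ P) :
    P ∈ Ideal.primesOver (Ideal.span {(q : ℤ)}) R := by
  have hmax : (Ideal.span {(q : ℤ)}).IsMaximal :=
    PrincipalIdealRing.isMaximal_of_irreducible (Nat.prime_iff_prime_int.mp hq).irreducible
  refine ⟨hP, ⟨hmax.eq_of_le (Ideal.IsPrime.ne_top inferInstance) ?_⟩⟩
  rw [Ideal.span_singleton_le_iff_mem, Ideal.mem_comap]
  simpa using hqP

/-- A residue ring at an ideal containing a prime `q` with `q % 4 ≠ 3` contains a square root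
of `-1`. -/
theorem Ideal.Quotient.isSquare_neg_one {R : Type*} [CommRing R] {q : ℕ} [Fact q.Prime]
    (hq : q % 4 ≠ 3) {P : Ideal R} (hqP : (q : R) ∈ P) : IsSquare (-1 : R ⧸ P) := by
  have hq0 : (q : R ⧸ P) = 0 := by
    rw [← map_natCast (Ideal.Quotient.mk P), Ideal.Quotient.eq_zero_iff_mem]
    exact hqP
  obtain ⟨y, hy⟩ := (ZMod.exists_sq_eq_neg_one_iff (p := q)).mpr hq
  obtain ⟨n, rfl⟩ := ZMod.intCast_surjective y
  obtain ⟨m, hm⟩ := (ZMod.intCast_zmod_eq_zero_iff_dvd (n * n + 1) q).mp (by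
    push_cast
    rw [← hy, neg_add_cancel])
  have hn : (n : R ⧸ P) * n + 1 = q * m := by exact_mod_cast congrArg (Int.cast : ℤ → R ⧸ P) hm
  exact ⟨n, by linear_combination -hn - m * hq0⟩

/-- For an element of norm `-1` of a quadratic field, being a square modulo a prime above
`q ≡ 1 (mod 4)` passes to any other prime above `q`. -/
theorem isSquare_mk_of_norm_eq_neg_one {K : Type*} [Field K] [NumberField K]
    [Algebra.IsQuadraticExtension ℚ K] {q : ℕ} [Fact q.Prime] (hq : q % 4 = 1) {x : 𝓞 K}
    (hx : Algebra.norm ℚ (x : K) = -1) {P Q : Ideal (𝓞 K)} [P.IsPrime] [Q.IsPrime]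
    (hP : (q : 𝓞 K) ∈ P) (hQ : (q : 𝓞 K) ∈ Q) (hPQ : P ≠ Q)
    (h : IsSquare (Ideal.Quotient.mk P x)) : IsSquare (Ideal.Quotient.mk Q x) := by
  have hprime : q.Prime := Fact.out
  obtain ⟨σ, hσ⟩ := Ideal.exists_comap_galRestrict_eq ℤ ℚ K (𝓞 K)
    (Ideal.mem_primesOver_span_natCast hprime hQ) (Ideal.mem_primesOver_span_natCast hprime hP)
  have hσ1 : σ ≠ 1 := by
    rintro rfl
    apply hPQ
    rw [← hσ, map_one]
    exact Ideal.comap_id Q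
  have hmul : x * galRestrict ℤ ℚ K (𝓞 K) σ x = -1 := by
    apply RingOfIntegers.coe_injective
    have := algebraMap_norm_eq_mul_of_ne_one hσ1 (x : K)
    rw [hx] at this
    rw [map_mul, algebraMap_galRestrict_apply, ← this]
    simp
  have hconj : IsSquare (Ideal.Quotient.mk Q (galRestrict ℤ ℚ K (𝓞 K) σ x)) := by
    obtain ⟨a, ha⟩ := h
    obtain ⟨a, rfl⟩ := Ideal.Quotient.mk_surjective a
    refine ⟨Ideal.Quotient.mk Q (galRestrict ℤ ℚ K (𝓞 K) σ a), ?_⟩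
    rw [← map_mul, Ideal.Quotient.eq, ← hσ, Ideal.mem_comap] at ha
    rw [← map_mul, Ideal.Quotient.eq]
    simpa using ha
  have hfactor : x = -1 * (x * x) * galRestrict ℤ ℚ K (𝓞 K) σ x := by
    linear_combination x * hmul
  rw [hfactor, map_mul, map_mul, map_mul, map_neg, map_one]
  exact ((Ideal.Quotient.isSquare_neg_one (by omega) hQ).mul (IsSquare.mul_self _)).mul hconj

/-- Let `p1 ≡ 1 (mod 4)` be a prime, `k = ℚ(√p1)`, and `ε` a unit of `𝓞 k` of norm `-1`.
Let `q1 ≡ 1 (mod 4)` be a prime with `(p1/q1) = 1`, so `q1·𝓞 k = 𝔮·𝔮'` with distinct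
primes `𝔮, 𝔮'`. Then `ε` is a square mod `𝔮` iff `ε` is a square mod `𝔮'`. -/
theorem statement_9 (p1 q1 : ℕ) [Fact p1.Prime] [Fact q1.Prime]
    (hp1 : p1 % 4 = 1) (hq1 : q1 % 4 = 1) (hleg : legendreSym q1 p1 = 1)
    (ε : (𝓞 (Qs p1))ˣ)
    (hnorm : Algebra.norm ℚ ((ε : 𝓞 (Qs p1)) : Qs p1) = -1)
    (𝔮 𝔮' : Ideal (𝓞 (Qs p1))) (hprime : 𝔮.IsPrime) (hprime' : 𝔮'.IsPrime)
    (hne : 𝔮 ≠ 𝔮')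
    (hsplit : Ideal.span {(q1 : 𝓞 (Qs p1))} = 𝔮 * 𝔮') :
    (IsSquare (Ideal.Quotient.mk 𝔮 (ε : 𝓞 (Qs p1))) ↔
      IsSquare (Ideal.Quotient.mk 𝔮' (ε : 𝓞 (Qs p1)))) := by
  have : Algebra.IsQuadraticExtension ℚ (Qs p1) := ⟨finrank_Qs_of_prime Fact.out⟩
  have hmem : (q1 : 𝓞 (Qs p1)) ∈ 𝔮 * 𝔮' := hsplit ▸ Ideal.mem_span_singleton_self _
  have hq := Ideal.mul_le_left hmem
  have hq' := Ideal.mul_le_right hmem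
  exact ⟨isSquare_mk_of_norm_eq_neg_one hq1 hnorm hq hq' hne,
    isSquare_mk_of_norm_eq_neg_one hq1 hnorm hq' hq hne.symm⟩
end
end

section
/- Let p1, q1, q2 be three distinct primes and let K = ℚ(√p1, √(q1·q2)). Then the class number h_K is a power of 2 if and only if h_{ℚ(√p1)} = 1 and both h_{ℚ(√(q1·q2))} and h_{ℚ(√(p1·q1·q2))} are powers of 2. -/
open NumberField IntermediateField

set_option synthInstance.maxHeartbeats 1000000
set_option maxHeartbeats 1000000

noncomputable section

/-- The class number of a number field `K`: the cardinality of the ideal class group of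
its ring of integers. -/
def classNum (K : Type*) [Field K] : ℕ := Nat.card (ClassGroup (𝓞 K))

open scoped nonZeroDivisors

theorem exists_sq_of_mul_eq_prime_mul_sq {p u v w : ℤ} (hp : Prime p) (hp0 : 0 < p) (hu : 0 ≤ u)
    (hv : 0 ≤ v) (huv : IsCoprime u v) (h : u * v = p * w ^ 2) (hpu : p ∣ u) :
    ∃ a b : ℤ, u = p * a ^ 2 ∧ v = b ^ 2 ∧ 0 ≤ b := by
  obtain ⟨u', rfl⟩ := hpu
  have h' : u' * v = w ^ 2 := by
    apply mul_left_cancel₀ hp.ne_zero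
    linarith
  have hu' : 0 ≤ u' := nonneg_of_mul_nonneg_right hu hp0
  have hc : IsCoprime u' v := huv.of_mul_left_right
  obtain ⟨a, ha⟩ := Int.sq_of_isCoprime hc h'
  obtain ⟨b, hb⟩ := Int.sq_of_isCoprime hc.symm (by rw [mul_comm]; exact h')
  refine ⟨a, |b|, ?_, ?_, abs_nonneg b⟩
  · rcases ha with rfl | rfl
    · ring
    · have : a = 0 := by nlinarith [sq_nonneg a]
      simp [this]
  · rw [sq_abs]
    rcases hb with rfl | rfl
    · rfl
    · have : b = 0 := by nlinarith [sq_nonneg b]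
      simp [this]

theorem exists_sq_sub_prime_mul_sq {p : ℕ} (hp : p.Prime) (hodd : p % 2 = 1) :
    (∃ a b : ℤ, a ^ 2 - p * b ^ 2 = -1) ∨ (p % 4 = 3 ∧ ∃ a b : ℤ, a ^ 2 - p * b ^ 2 = 2) ∨
      (p % 4 = 3 ∧ ∃ a b : ℤ, a ^ 2 - p * b ^ 2 = -2) := by
  have hpi : Prime (p : ℤ) := Nat.prime_iff_prime_int.mp hp
  have hp0 : (0 : ℤ) < p := by exact_mod_cast hp.pos
  obtain ⟨f, hf⟩ := Pell.IsFundamental.exists_of_not_isSquare hp0 hpi.irreducible.not_isSquare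
  have hx := hf.1
  have hy := hf.2.1
  have hxy := f.prop
  set x := f.x with hxdef
  set y := f.y
  rcases Int.even_or_odd' x with ⟨u, hu | hu⟩
  · have hyodd : y % 2 = 1 := by
      rcases Int.even_or_odd' y with ⟨t, ht | ht⟩
      · rw [hu, ht] at hxy
        ring_nf at hxy
        omega
      · omega
    have hp4 : p % 4 = 3 := by
      obtain ⟨t, ht⟩ : ∃ t, y = 2 * t + 1 := ⟨y / 2, by omega⟩
      by_contra hne
      obtain ⟨k, hk⟩ : ∃ k : ℕ, p = 4 * k + 1 := ⟨p / 4, by omega⟩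
      rw [hu, ht, hk] at hxy
      push_cast at hxy
      ring_nf at hxy
      omega
    have hmul : (x - 1) * (x + 1) = p * y ^ 2 := by linarith
    have hc : IsCoprime (x - 1) (x + 1) := ⟨u, 1 - u, by rw [hu]; ring⟩
    rcases hpi.dvd_or_dvd (Dvd.intro _ hmul.symm) with hd | hd
    · obtain ⟨b, a, hb, ha, -⟩ := exists_sq_of_mul_eq_prime_mul_sq hpi hp0 (by omega) (by omega)
        hc hmul hd
      exact Or.inr (Or.inl ⟨hp4, a, b, by linarith⟩)
    · obtain ⟨b, a, hb, ha, -⟩ := exists_sq_of_mul_eq_prime_mul_sq hpi hp0 (by omega) (by omega)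
        hc.symm (by rw [mul_comm]; exact hmul) hd
      exact Or.inr (Or.inr ⟨hp4, a, b, by linarith⟩)
  · have hyeven : y % 2 = 0 := by
      rcases Int.even_or_odd' y with ⟨t, ht | ht⟩
      · omega
      · obtain ⟨k, hk⟩ : ∃ k : ℕ, p = 2 * k + 1 := ⟨p / 2, by omega⟩
        rw [hu, ht, hk] at hxy
        push_cast at hxy
        ring_nf at hxy
        omega
    obtain ⟨w, hw⟩ : ∃ w, y = 2 * w := ⟨y / 2, by omega⟩
    have hmul : u * (u + 1) = p * w ^ 2 := by
      rw [hu, hw] at hxy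
      linarith
    have hc : IsCoprime u (u + 1) := ⟨-1, 1, by ring⟩
    rcases hpi.dvd_or_dvd (Dvd.intro _ hmul.symm) with hd | hd
    · exfalso
      obtain ⟨a, b, ha, hb, hb0⟩ := exists_sq_of_mul_eq_prime_mul_sq hpi hp0 (by omega) (by omega)
        hc hmul hd
      have hb1 : 1 < b := by nlinarith
      have := hf.x_le_x (a := Pell.Solution₁.mk b a (by linarith)) (by simpa using hb1)
      rw [Pell.Solution₁.x_mk] at this
      nlinarith
    · obtain ⟨b, a, hb, ha, -⟩ := exists_sq_of_mul_eq_prime_mul_sq hpi hp0 (by omega) (by omega)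
        hc.symm (by rw [mul_comm]; exact hmul) hd
      exact Or.inl ⟨a, b, by linarith⟩

theorem sq_sub_prime_mul_sq_ne_neg_sq {p : ℕ} (hp : p.Prime) (hp4 : p % 4 = 3) {a b n : ℤ}
    (hn : n ≠ 0) : a ^ 2 - p * b ^ 2 ≠ -n ^ 2 := by
  intro h
  have := Fact.mk hp
  have hb : b ≠ 0 := by
    rintro rfl
    have : 0 < n ^ 2 := by positivity
    nlinarith [sq_nonneg a]
  have hN : p * b.natAbs ^ 2 = a.natAbs ^ 2 + n.natAbs ^ 2 := by
    zify
    simp only [sq_abs]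
    linarith
  have hev := Nat.eq_sq_add_sq_iff.mp ⟨_, _, hN⟩ (q := p)
    (Nat.mem_primeFactors.mpr ⟨hp, Dvd.intro _ rfl, by simp [hp.ne_zero, hb]⟩) hp4
  rw [padicValNat.mul hp.ne_zero (by simp [hb]), padicValNat.pow,
    padicValNat_self] at hev
  rw [Nat.even_iff] at hev
  omega

theorem exists_algEquiv_of_adjoin_sqrt {F K : Type*} [Field F] [CharZero F] [Field K] [Algebra F K]
    {s : K} {d : F} (hs : s ^ 2 = algebraMap F K d) (hmem : s ∉ (algebraMap F K).range)
    (htop : F⟮s⟯ = ⊤) :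
    Module.finrank F K = 2 ∧ ∃ σ : K ≃ₐ[F] K, σ s = -s ∧
      (∀ x, algebraMap F K (Algebra.norm F x) = x * σ x) ∧
      ∀ x, algebraMap F K (Algebra.trace F K x) = x + σ x := by
  have hint : IsIntegral F s := ⟨Polynomial.X ^ 2 - Polynomial.C d,
    Polynomial.monic_X_pow_sub_C _ two_ne_zero, by simp [hs]⟩
  have hdeg : (minpoly F s).natDegree = 2 := by
    apply le_antisymm
    · have := Polynomial.natDegree_le_of_dvd (minpoly.dvd F s (p := Polynomial.X ^ 2 - Polynomial.C d)
        (by simp [hs])) (Polynomial.X_pow_sub_C_ne_zero two_pos d)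
      simpa using this
    · exact (minpoly.two_le_natDegree_iff hint).mpr hmem
  have hrank : Module.finrank F K = 2 := by
    rw [← IntermediateField.finrank_top', ← htop, IntermediateField.adjoin.finrank hint, hdeg]
  refine ⟨hrank, ?_⟩
  have hq : Algebra.IsQuadraticExtension F K :=
    { finrank_eq_two' := hrank, toFree := inferInstance }
  have : IsGalois F K := {}
  have hcard : Nat.card (K ≃ₐ[F] K) = 2 := by
    rw [IsGalois.card_aut_eq_finrank, hrank]
  have hfd : FiniteDimensional F K := inferInstance
  obtain ⟨σ, hσ⟩ : ∃ σ : K ≃ₐ[F] K, σ ≠ 1 := by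
    have : Nontrivial (K ≃ₐ[F] K) := by
      rw [← Finite.one_lt_card_iff_nontrivial, hcard]; norm_num
    exact exists_ne 1
  classical
  have huniv : (Finset.univ : Finset (K ≃ₐ[F] K)) = {1, σ} := by
    symm
    apply Finset.eq_univ_of_card
    rw [Finset.card_pair hσ.symm, ← hcard, Nat.card_eq_fintype_card]
  refine ⟨σ, ?_, fun x => ?_, fun x => ?_⟩
  · have h2 : (σ s) ^ 2 = s ^ 2 := by rw [← map_pow, hs, AlgEquiv.commutes]
    rcases sq_eq_sq_iff_eq_or_eq_neg.mp h2 with h | h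
    · exfalso
      apply hσ
      have hadj : Algebra.adjoin F {s} = ⊤ := by
        rw [← IntermediateField.adjoin_simple_toSubalgebra_of_isAlgebraic hint.isAlgebraic, htop,
          IntermediateField.top_toSubalgebra]
      have : (σ : K →ₐ[F] K) = AlgHom.id F K :=
        AlgHom.ext_of_adjoin_eq_top hadj (by simpa [Set.EqOn] using h)
      ext x
      exact DFunLike.congr_fun this x
    · exact h
  · rw [Algebra.norm_eq_prod_automorphisms, huniv, Finset.prod_pair hσ.symm]
    simp
  · rw [trace_eq_sum_automorphisms, huniv, Finset.sum_pair hσ.symm]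
    simp


section
variable {k K : Type*} [Field k] [NumberField k] [Field K] [NumberField K] [Algebra k K]

theorem map_relNorm_eq_mul_map (hrank : Module.finrank k K = 2)
    (σ : K ≃+* K) (hσ : ∀ x, algebraMap k K (Algebra.norm k x) = x * σ x)
    (I : Ideal (𝓞 K)) (hI : I ≠ ⊥) :
    (Ideal.relNorm (𝓞 k) I).map (algebraMap (𝓞 k) (𝓞 K)) =
      I * I.map (RingOfIntegers.mapRingEquiv σ) := by
  have hle : (Ideal.relNorm (𝓞 k) I).map (algebraMap (𝓞 k) (𝓞 K)) ≤
      I * I.map (RingOfIntegers.mapRingEquiv σ) := by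
    rw [← Ideal.spanNorm_eq, Ideal.spanNorm, Ideal.map_le_iff_le_comap]
    refine Ideal.span_le.mpr ?_
    rintro _ ⟨x, hx, rfl⟩
    have : algebraMap (𝓞 k) (𝓞 K) (Algebra.intNorm (𝓞 k) (𝓞 K) x) =
        x * RingOfIntegers.mapRingEquiv σ x := by
      apply RingOfIntegers.ext
      have := Algebra.algebraMap_intNorm (A := 𝓞 k) (B := 𝓞 K) (K := k) (L := K) x
      have h2 := hσ x
      rw [← this] at h2
      exact h2
    rw [SetLike.mem_coe, Ideal.mem_comap, this]
    exact Ideal.mul_mem_mul hx (Ideal.mem_map_of_mem _ hx)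
  obtain ⟨C, hC⟩ := Ideal.dvd_iff_le.mpr hle
  have hfr : Module.finrank (𝓞 k) (𝓞 K) = 2 := by
    rw [← hrank, IsFractionRing.finrank_eq (𝓞 k) k (𝓞 K) K]
  have hn := congrArg Ideal.absNorm hC
  have hmap : Ideal.absNorm (I.map (RingOfIntegers.mapRingEquiv σ)) = Ideal.absNorm I :=
    (Nat.card_congr (Ideal.quotientEquiv I _ (RingOfIntegers.mapRingEquiv σ) rfl).toEquiv).symm
  rw [Ideal.absNorm_algebraMap, Ideal.absNorm_relNorm, hfr, map_mul, map_mul, hmap, ← sq] at hn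
  have hC1 : Ideal.absNorm C = 1 := by
    have : Ideal.absNorm I ≠ 0 := by simpa [Ideal.absNorm_eq_zero_iff] using hI
    exact Nat.eq_of_mul_eq_mul_left (by positivity : 0 < Ideal.absNorm I ^ 2) (by linarith)
  rw [Ideal.absNorm_eq_one_iff] at hC1
  rw [hC, hC1, Ideal.mul_top]

theorem isPGroup_two_classGroup_of_finrank_eq_two (hrank : Module.finrank k K = 2)
    (h : IsPGroup 2 (ClassGroup (𝓞 K))) : IsPGroup 2 (ClassGroup (𝓞 k)) := by
  intro c
  obtain ⟨I, rfl⟩ := ClassGroup.mk0_surjective c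
  have hfr : Module.finrank (𝓞 k) (𝓞 K) = 2 := by
    rw [← hrank, IsFractionRing.finrank_eq (𝓞 k) k (𝓞 K) K]
  obtain ⟨n, hn⟩ := h (ClassGroup.mk0 (ClassGroup.extendedIdeal (𝓞 k) (𝓞 K) I))
  refine ⟨n + 1, ?_⟩
  have key : ∀ J : (Ideal (𝓞 K))⁰, ClassGroup.mk0 J = 1 → ∀ J' : (Ideal (𝓞 k))⁰,
      (J' : Ideal (𝓞 k)) = Ideal.relNorm (𝓞 k) (J : Ideal (𝓞 K)) → ClassGroup.mk0 J' = 1 := by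
    rintro ⟨J, hJ0⟩ hJ ⟨J', hJ0'⟩ hJJ'
    rw [ClassGroup.mk0_eq_one_iff] at hJ ⊢
    obtain ⟨a, rfl⟩ := hJ
    exact ⟨Algebra.intNorm (𝓞 k) (𝓞 K) a, hJJ'.trans (Ideal.relNorm_singleton _ _)⟩
  rw [← map_pow] at hn ⊢
  apply key _ hn
  rw [SubmonoidClass.coe_pow, SubmonoidClass.coe_pow, map_pow, Ideal.relNorm_algebraMap, hfr,
    pow_succ', pow_mul]

theorem exists_mk0_pow_eq_one_of_coe_eq_mul_map (hrank : Module.finrank k K = 2)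
    (h : IsPGroup 2 (ClassGroup (𝓞 k)))
    (σ : K ≃+* K) (hσ : ∀ x, algebraMap k K (Algebra.norm k x) = x * σ x)
    (I J : (Ideal (𝓞 K))⁰)
    (hJ : (J : Ideal (𝓞 K)) = (I : Ideal (𝓞 K)).map (RingOfIntegers.mapRingEquiv σ)) :
    ∃ n, (ClassGroup.mk0 I * ClassGroup.mk0 J) ^ 2 ^ n = 1 := by
  have hI : (I : Ideal (𝓞 K)) ≠ ⊥ := mem_nonZeroDivisors_iff_ne_zero.mp I.2
  have key := map_relNorm_eq_mul_map hrank σ hσ I hI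
  have hN : Ideal.relNorm (𝓞 k) (I : Ideal (𝓞 K)) ≠ ⊥ := Ideal.relNorm_eq_bot_iff.not.mpr hI
  let N : (Ideal (𝓞 k))⁰ := ⟨_, mem_nonZeroDivisors_iff_ne_zero.mpr hN⟩
  have hIJ : I * J = ClassGroup.extendedIdeal (𝓞 k) (𝓞 K) N := by
    ext1
    rw [Submonoid.coe_mul, hJ, ← key]
  obtain ⟨n, hn⟩ := h (ClassGroup.mk0 N)
  refine ⟨n, ?_⟩
  rw [← map_mul, hIJ, ← ClassGroup.extendedHom_mk0, ← map_pow, hn, map_one]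
end

theorem isPGroup_two_classGroup_of_biquadratic {K k₁ k₂ k₃ : Type*} [Field K] [NumberField K]
    [Field k₁] [NumberField k₁] [Algebra k₁ K] [Field k₂] [NumberField k₂] [Algebra k₂ K]
    [Field k₃] [NumberField k₃] [Algebra k₃ K]
    (hrank₁ : Module.finrank k₁ K = 2) (hrank₂ : Module.finrank k₂ K = 2)
    (hrank₃ : Module.finrank k₃ K = 2) (σ₁ σ₂ σ₃ : K ≃+* K)
    (hσ₁ : ∀ x, algebraMap k₁ K (Algebra.norm k₁ x) = x * σ₁ x)
    (hσ₂ : ∀ x, algebraMap k₂ K (Algebra.norm k₂ x) = x * σ₂ x)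
    (hσ₃ : ∀ x, algebraMap k₃ K (Algebra.norm k₃ x) = x * σ₃ x)
    (hσ : ∀ x, σ₃ x = σ₁ (σ₂ x))
    (h₁ : IsPGroup 2 (ClassGroup (𝓞 k₁))) (h₂ : IsPGroup 2 (ClassGroup (𝓞 k₂)))
    (h₃ : IsPGroup 2 (ClassGroup (𝓞 k₃))) : IsPGroup 2 (ClassGroup (𝓞 K)) := by
  intro c
  obtain ⟨I, rfl⟩ := ClassGroup.mk0_surjective c
  have hmap : ∀ (σ : K ≃+* K) (J : (Ideal (𝓞 K))⁰), (J : Ideal (𝓞 K)).map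
      (RingOfIntegers.mapRingEquiv σ) ∈ (Ideal (𝓞 K))⁰ := fun σ J =>
    mem_nonZeroDivisors_iff_ne_zero.mpr ((Ideal.map_eq_bot_iff_of_injective
      (RingOfIntegers.mapRingEquiv σ).injective).not.mpr (mem_nonZeroDivisors_iff_ne_zero.mp J.2))
  let I₂ : (Ideal (𝓞 K))⁰ := ⟨_, hmap σ₂ I⟩
  let I₃ : (Ideal (𝓞 K))⁰ := ⟨_, hmap σ₃ I⟩
  have hI₃ : (I₃ : Ideal (𝓞 K)) = (I₂ : Ideal (𝓞 K)).map (RingOfIntegers.mapRingEquiv σ₁) := by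
    change Ideal.map (RingOfIntegers.mapRingEquiv σ₃ : 𝓞 K →+* 𝓞 K) _ =
      Ideal.map (RingOfIntegers.mapRingEquiv σ₁ : 𝓞 K →+* 𝓞 K)
        (Ideal.map (RingOfIntegers.mapRingEquiv σ₂ : 𝓞 K →+* 𝓞 K) _)
    rw [Ideal.map_map]
    congr 1
    ext x
    exact hσ x
  obtain ⟨l, hl⟩ := exists_mk0_pow_eq_one_of_coe_eq_mul_map hrank₂ h₂ σ₂ hσ₂ I I₂ rfl
  obtain ⟨m, hm⟩ := exists_mk0_pow_eq_one_of_coe_eq_mul_map hrank₃ h₃ σ₃ hσ₃ I I₃ rfl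
  obtain ⟨n, hn⟩ := exists_mk0_pow_eq_one_of_coe_eq_mul_map hrank₁ h₁ σ₁ hσ₁ I₂ I₃ hI₃
  generalize ClassGroup.mk0 I = A at *
  generalize ClassGroup.mk0 I₂ = B at *
  generalize ClassGroup.mk0 I₃ = C at *
  have hsq : A ^ 2 = (A * B) * (A * C) * (B * C)⁻¹ := by
    rw [eq_mul_inv_iff_mul_eq, sq]
    ac_rfl
  refine ⟨1 + (l + m + n), ?_⟩
  rw [pow_add, pow_one, pow_mul, hsq, mul_pow, mul_pow, inv_pow]
  have e₁ : (A * B) ^ 2 ^ (l + m + n) = 1 := by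
    rw [add_assoc, pow_add, pow_mul, hl, one_pow]
  have e₂ : (A * C) ^ 2 ^ (l + m + n) = 1 := by
    rw [add_right_comm, add_comm, pow_add, pow_mul, hm, one_pow]
  have e₃ : (B * C) ^ 2 ^ (l + m + n) = 1 := by
    rw [add_comm, pow_add, pow_mul, hn, one_pow]
  rw [e₁, e₂, e₃]
  simp

/-- A conjugation on a ring `R` which behaves like the ring of integers of `ℚ(√p)`:
an involution with fixed ring `ℤ` sending a square root of `p` to its opposite. -/
structure QuadraticConj (R : Type*) [CommRing R] (p : ℕ) where
  /-- the conjugation -/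
  conj : R ≃+* R
  /-- the square root of `p` -/
  root : R
  root_sq : root ^ 2 = p
  conj_root : conj root = -root
  conj_conj : ∀ x, conj (conj x) = x
  exists_int : ∀ x, conj x = x → ∃ n : ℤ, x = n
  exists_half : p % 4 = 1 → ∃ w, 2 * w = 1 + root

theorem Ideal.exists_eq_span_mul_of_sq_eq {R : Type*} [CommRing R] [IsDedekindDomain R]
    {J K : Ideal R} {x : R} (hx : x ≠ 0) (h : J ^ 2 = Ideal.span {x} ^ 2 * K) :
    ∃ J', J = Ideal.span {x} * J' ∧ J' ^ 2 = K := by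
  have hd : Ideal.span {x} ∣ J :=
    (UniqueFactorizationMonoid.pow_dvd_pow_iff_dvd two_ne_zero).mp (Dvd.intro _ h.symm)
  obtain ⟨J', rfl⟩ := hd
  refine ⟨J', rfl, ?_⟩
  rw [mul_pow] at h
  exact mul_left_cancel₀ (pow_ne_zero 2 (by simpa using hx)) h

theorem Ideal.isPrincipal_span_mul {R : Type*} [CommRing R] {J : Ideal R} (x : R)
    (hJ : J.IsPrincipal) : (Ideal.span {x} * J).IsPrincipal := by
  obtain ⟨g, rfl⟩ := hJ
  exact ⟨x * g, Ideal.span_singleton_mul_span_singleton x g⟩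

theorem Ideal.isPrincipal_of_span_mul {R : Type*} [CommRing R] [IsDedekindDomain R] {J : Ideal R}
    {x : R} (hx : x ≠ 0) (hJ : (Ideal.span {x} * J).IsPrincipal) : J.IsPrincipal := by
  obtain ⟨g, hg⟩ := hJ
  change _ = Ideal.span {g} at hg
  have hle : Ideal.span {g} ≤ Ideal.span {x} := hg ▸ Ideal.mul_le_left
  obtain ⟨y, rfl⟩ := Ideal.span_singleton_le_span_singleton.mp hle
  refine ⟨y, mul_left_cancel₀ (b := J) (c := Ideal.span {y}) (a := Ideal.span {x})
    (by simpa using hx) ?_⟩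
  rw [hg, Ideal.span_singleton_mul_span_singleton]

namespace QuadraticConj

theorem root_ne_zero {R : Type*} [CommRing R] [CharZero R] {p : ℕ} (D : QuadraticConj R p)
    (hp : p.Prime) : D.root ≠ 0 := by
  intro h
  have := D.root_sq
  rw [h] at this
  exact hp.ne_zero (by exact_mod_cast this.symm.trans (zero_pow two_ne_zero))

section

variable {R : Type*} [CommRing R] [IsDomain R] [CharZero R] {p : ℕ}

theorem dvd_of_cast_dvd (D : QuadraticConj R p) {m n : ℤ} (h : (m : R) ∣ n) : m ∣ n := by
  obtain ⟨r, hr⟩ := h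
  rcases eq_or_ne m 0 with rfl | hm
  · simp at hr
    simp [hr]
  · have hr' := congrArg D.conj hr
    rw [map_mul, map_intCast, map_intCast, hr] at hr'
    obtain ⟨c, rfl⟩ := D.exists_int r (mul_left_cancel₀ (Int.cast_ne_zero.mpr hm) hr'.symm)
    exact ⟨c, by exact_mod_cast hr⟩

theorem exists_trace_norm (D : QuadraticConj R p) (hp : p.Prime) (x : R) :
    ∃ T N B : ℤ, x + D.conj x = T ∧ x * D.conj x = N ∧ x - D.conj x = B * D.root ∧
      T ^ 2 - p * B ^ 2 = 4 * N := by
  obtain ⟨T, hT⟩ := D.exists_int (x + D.conj x) (by rw [map_add, D.conj_conj, add_comm])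
  obtain ⟨N, hN⟩ := D.exists_int (x * D.conj x) (by rw [map_mul, D.conj_conj, mul_comm])
  obtain ⟨n, hn⟩ := D.exists_int (D.root * (x - D.conj x)) (by
    rw [map_mul, map_sub, D.conj_conj, D.conj_root]; ring)
  have hs := D.root_sq
  have h1 : n ^ 2 = p * (T ^ 2 - 4 * N) := by
    have : (n : R) ^ 2 = p * (T ^ 2 - 4 * N) := by
      rw [← hn, ← hT, ← hN, ← hs]; ring
    exact_mod_cast this
  have hpi := Nat.prime_iff_prime_int.mp hp
  obtain ⟨B, rfl⟩ := hpi.dvd_of_dvd_pow (Dvd.intro _ h1.symm)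
  refine ⟨T, N, B, hT, hN, ?_, ?_⟩
  · apply mul_left_cancel₀ (D.root_ne_zero hp)
    rw [hn]
    push_cast
    rw [← hs]
    ring
  · have : (p : ℤ) * (p * B ^ 2) = p * (T ^ 2 - 4 * N) := by rw [← h1]; ring
    have := mul_left_cancel₀ hpi.ne_zero this
    linarith

end

variable {R : Type*} [CommRing R] [IsDedekindDomain R] [CharZero R] {p : ℕ}

theorem isPrincipal_of_sq_eq_span_of_squarefree (D : QuadraticConj R p) (hp : p.Prime)
    {m : ℕ} (hm : Squarefree m) (hpm : ¬ p ∣ m) {J : Ideal R} (hJ : J ^ 2 = Ideal.span {(m : R)}) :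
    J.IsPrincipal := by
  have hs := D.root_sq
  have hmR : (m : R) ≠ 0 := Nat.cast_ne_zero.mpr hm.ne_zero
  have hJ0 : J ≠ 0 := by
    rintro rfl
    rw [zero_pow two_ne_zero] at hJ
    exact hmR (Ideal.span_singleton_eq_bot.mp hJ.symm)
  have hmZ : Squarefree (m : ℤ) := Int.squarefree_natCast.mpr hm
  have key : ∀ x ∈ J, ∃ T N B : ℤ, 2 * x = T + B * D.root ∧ T ^ 2 - p * B ^ 2 = 4 * N ∧
      (m : ℤ) ∣ T ∧ (m : ℤ) ∣ N ∧ (m : ℤ) ∣ B := by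
    intro x hx
    obtain ⟨T, N, B, hT, hN, hB, hTNB⟩ := D.exists_trace_norm hp x
    have hx2 : (m : R) ∣ x ^ 2 := by
      rw [← Ideal.mem_span_singleton, ← hJ]
      exact Ideal.pow_mem_pow hx 2
    have hx2' : (m : R) ∣ (D.conj x) ^ 2 := by
      have := map_dvd D.conj hx2
      rwa [map_natCast, map_pow] at this
    have hmN : (m : ℤ) ∣ N := by
      have : (((m : ℤ) ^ 2 : ℤ) : R) ∣ ((N ^ 2 : ℤ) : R) := by
        have := mul_dvd_mul hx2 hx2'
        push_cast
        rwa [← hN, mul_pow, sq (m : R)]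
      exact (Int.pow_dvd_pow_iff two_ne_zero).mp (D.dvd_of_cast_dvd this)
    have hmN' : (m : R) ∣ 2 * N := by
      have := Int.cast_dvd_cast (α := R) _ _ hmN
      rw [Int.cast_natCast] at this
      exact this.mul_left 2
    have hmT : (m : ℤ) ∣ T := by
      have : ((m : ℤ) : R) ∣ ((T ^ 2 : ℤ) : R) := by
        have := dvd_add (dvd_add hx2 hx2') hmN'
        push_cast
        rw [← hT]
        convert this using 1
        rw [← hN]
        ring
      exact (hmZ.dvd_pow_iff_dvd two_ne_zero).mp (D.dvd_of_cast_dvd this)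
    have hmB : (m : ℤ) ∣ B := by
      have : ((m : ℤ) : R) ∣ ((p * B ^ 2 : ℤ) : R) := by
        have := dvd_sub (dvd_add hx2 hx2') hmN'
        push_cast
        have e : (p : R) * B ^ 2 = (B * D.root) ^ 2 := by rw [← hs]; ring
        rw [e, ← hB]
        convert this using 1
        rw [← hN]
        ring
      have hc : IsCoprime (m : ℤ) p :=
        Nat.isCoprime_iff_coprime.mpr ((hp.coprime_iff_not_dvd.mpr hpm).symm)
      exact (hmZ.dvd_pow_iff_dvd two_ne_zero).mp (hc.dvd_of_dvd_mul_left (D.dvd_of_cast_dvd this))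
    refine ⟨T, N, B, ?_, hTNB, hmT, hmN, hmB⟩
    rw [← hT, ← hB]
    ring
  have htwo : J ∣ Ideal.span {(2 : R)} := by
    have : J * J ∣ Ideal.span {(2 : R)} * J := by
      rw [← sq, hJ, Ideal.dvd_iff_le, Ideal.span_singleton_mul_le_iff]
      intro x hx
      obtain ⟨T, N, B, h2x, -, hT, -, hB⟩ := key x hx
      rw [Ideal.mem_span_singleton, h2x]
      have hT' := Int.cast_dvd_cast (α := R) _ _ hT
      have hB' := Int.cast_dvd_cast (α := R) _ _ hB
      rw [Int.cast_natCast] at hT' hB'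
      exact dvd_add hT' (hB'.mul_right _)
    exact (mul_dvd_mul_iff_right hJ0).mp this
  have hm4 : m ∣ 4 := by
    have h := pow_dvd_pow_of_dvd htwo 2
    rw [hJ, Ideal.span_singleton_pow, Ideal.dvd_iff_le, Ideal.span_singleton_le_span_singleton] at h
    have h' : ((m : ℤ) : R) ∣ ((4 : ℤ) : R) := by
      convert h using 1 <;> push_cast
      · rfl
      · norm_num
    exact_mod_cast D.dvd_of_cast_dvd h'
  have hm12 : m = 1 ∨ m = 2 := by
    have hle := Nat.le_of_dvd (by norm_num) hm4
    interval_cases m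
    · exact absurd hm4 (by norm_num)
    · exact Or.inl rfl
    · exact Or.inr rfl
    · exact absurd hm4 (by norm_num)
    · exact absurd (hm 2 (by norm_num)) (by norm_num)
  rcases hm12 with rfl | rfl
  · have : J ∣ 1 := ⟨J, by rw [← sq, hJ]; simp⟩
    rw [Ideal.dvd_iff_le, Ideal.one_eq_top, top_le_iff] at this
    rw [this]
    exact top_isPrincipal
  · have hodd : p % 2 = 1 := by
      rcases hp.eq_two_or_odd with rfl | h
      · exact absurd dvd_rfl hpm
      · exact h
    push_cast at hJ
    have hcases : p % 4 = 1 ∨ ∃ (e a b : ℤ), e ^ 2 = 1 ∧ a ^ 2 - p * b ^ 2 = 2 * e := by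
      rcases exists_sq_sub_prime_mul_sq hp hodd with ⟨a, b, h⟩ | ⟨-, a, b, h⟩ | ⟨-, a, b, h⟩
      · left
        by_contra hne
        exact sq_sub_prime_mul_sq_ne_neg_sq hp (by omega) (one_ne_zero (α := ℤ)) (by simpa using h)
      · exact Or.inr ⟨1, a, b, by norm_num, by linarith⟩
      · exact Or.inr ⟨-1, a, b, by norm_num, by linarith⟩
    rcases hcases with hp1 | ⟨e, a, b, he, hab⟩
    · obtain ⟨w, hw⟩ := D.exists_half hp1
      have hJJ : J * J ∣ 1 * J := by
        rw [← sq, one_mul, hJ, Ideal.dvd_iff_le]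
        intro x hx
        obtain ⟨T, N, B, h2x, hTNB, ⟨T', rfl⟩, ⟨N', rfl⟩, ⟨B', rfl⟩⟩ := key x hx
        obtain ⟨q, rfl⟩ : ∃ q, p = 2 * q + 1 := ⟨p / 2, by omega⟩
        obtain ⟨t, ht⟩ : ∃ t, T' = B' + 2 * t := by
          have hpar : (T' - B') * (T' - B') = 2 * (N' + q * B' ^ 2 - T' * B' + B' ^ 2) := by
            push_cast at hTNB
            linarith
          obtain ⟨t, ht⟩ := Int.prime_two.dvd_mul.mp (Dvd.intro _ hpar.symm) |>.elim id id
          exact ⟨t, by linarith⟩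
        rw [Ideal.mem_span_singleton]
        refine ⟨t + B' * w, mul_left_cancel₀ (two_ne_zero (α := R)) ?_⟩
        rw [h2x, ht]
        push_cast
        linear_combination (-2 : R) * B' * hw
      have : J ∣ 1 := (mul_dvd_mul_iff_right hJ0).mp hJJ
      rw [Ideal.dvd_iff_le, Ideal.one_eq_top, top_le_iff] at this
      rw [this]
      exact top_isPrincipal
    · have habR : (a : R) ^ 2 - p * b ^ 2 = 2 * e := by exact_mod_cast congrArg (Int.cast : ℤ → R) hab
      have heR : (e : R) ^ 2 = 1 := by exact_mod_cast congrArg (Int.cast : ℤ → R) he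
      have hJg : J ^ 2 = Ideal.span {(a : R) + b * D.root} ^ 2 := by
        rw [hJ, Ideal.span_singleton_pow]
        apply le_antisymm <;> rw [Ideal.span_singleton_le_span_singleton]
        · refine ⟨(p * b ^ 2 + e) - a * b * D.root, ?_⟩
          linear_combination (-2 : R) * heR + (2 * p * b ^ 2 : R) * habR + (2 * a ^ 2 * b ^ 2 : R) * hs
            - (p * b ^ 2 + e - a * b * D.root) * (habR + (b : R) ^ 2 * hs)
        · refine ⟨(p * b ^ 2 + e) + a * b * D.root, ?_⟩
          linear_combination habR + (b : R) ^ 2 * hs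
      have : J = Ideal.span {(a : R) + b * D.root} :=
        dvd_antisymm ((UniqueFactorizationMonoid.pow_dvd_pow_iff_dvd two_ne_zero).mp hJg.dvd)
          ((UniqueFactorizationMonoid.pow_dvd_pow_iff_dvd two_ne_zero).mp hJg.symm.dvd)
      exact ⟨_, this⟩

theorem isPrincipal_of_sq_eq_span (D : QuadraticConj R p) (hp : p.Prime)
    {m : ℕ} (hm : m ≠ 0) {J : Ideal R} (hJ : J ^ 2 = Ideal.span {(m : R)}) : J.IsPrincipal := by
  obtain ⟨a, b, hab, ha⟩ := Nat.sq_mul_squarefree m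
  have hb : b ≠ 0 := by
    rintro rfl
    simp at hab
    exact hm hab.symm
  obtain ⟨J', rfl, hJ'⟩ := Ideal.exists_eq_span_mul_of_sq_eq (x := (b : R)) (K := Ideal.span {(a : R)})
    (Nat.cast_ne_zero.mpr hb) (by
      rw [hJ, ← hab, Ideal.span_singleton_pow, Ideal.span_singleton_mul_span_singleton]
      push_cast
      rfl)
  apply Ideal.isPrincipal_span_mul
  by_cases hpa : p ∣ a
  · obtain ⟨c, rfl⟩ := hpa
    obtain ⟨J'', rfl, hJ''⟩ := Ideal.exists_eq_span_mul_of_sq_eq (K := Ideal.span {(c : R)})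
      (D.root_ne_zero hp) (by
        rw [hJ', Ideal.span_singleton_pow, Ideal.span_singleton_mul_span_singleton, D.root_sq]
        push_cast
        rfl)
    apply Ideal.isPrincipal_span_mul
    refine D.isPrincipal_of_sq_eq_span_of_squarefree hp ha.of_mul_right (fun hpc => ?_) hJ''
    exact hp.one_lt.ne' (Nat.isUnit_iff.mp (ha p (mul_dvd_mul_left p hpc)))
  · exact D.isPrincipal_of_sq_eq_span_of_squarefree hp ha hpa hJ'

theorem isPrincipal_of_sq_isPrincipal [Module.Free ℤ R] [Module.Finite ℤ R]
    (D : QuadraticConj R p) (hp : p.Prime)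
    (hnorm : ∀ x : R, (Algebra.norm ℤ x : R) = x * D.conj x) {I : Ideal R} (hI : I ≠ ⊥)
    (h : (I ^ 2).IsPrincipal) : I.IsPrincipal := by
  obtain ⟨α₀, hα₀⟩ := h
  change _ = Ideal.span {α₀} at hα₀
  set n := Ideal.absNorm I with hndef
  have hn : n ≠ 0 := by simpa [hndef, Ideal.absNorm_eq_zero_iff] using hI
  have hs := D.root_sq
  obtain ⟨α, hα, hαn⟩ : ∃ α, I ^ 2 = Ideal.span {α} ∧ α * D.conj α = n ^ 2 := by
    have h1 := congrArg Ideal.absNorm hα₀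
    rw [map_pow, Ideal.absNorm_span_singleton, ← hndef] at h1
    rcases Int.natAbs_eq (Algebra.norm ℤ α₀) with h2 | h2
    · refine ⟨α₀, hα₀, ?_⟩
      rw [← hnorm, h2, ← h1]
      push_cast
      rfl
    · rw [← h1] at h2
      have h3 := hnorm α₀
      rw [h2] at h3
      have hunit : ∃ a b : ℤ, a ^ 2 - p * b ^ 2 = -1 := by
        rcases hp.eq_two_or_odd with rfl | hodd
        · exact ⟨1, 1, by norm_num⟩
        · have hne : ¬ p % 4 = 3 := by
            intro hp4
            obtain ⟨T, N, B, -, hN, -, hTNB⟩ := D.exists_trace_norm hp α₀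
            rw [← h3] at hN
            have hN' := Int.cast_injective hN
            refine sq_sub_prime_mul_sq_ne_neg_sq hp hp4 (a := T) (b := B) (n := 2 * n)
              (by positivity) ?_
            rw [hTNB, ← hN']
            push_cast
            ring
          rcases exists_sq_sub_prime_mul_sq hp hodd with h | ⟨h, -⟩ | ⟨h, -⟩
          · exact h
          · exact absurd h hne
          · exact absurd h hne
      obtain ⟨a, b, hab⟩ := hunit
      have habR : (a : R) ^ 2 - p * b ^ 2 = -1 := by exact_mod_cast congrArg (Int.cast : ℤ → R) hab
      have hu : IsUnit ((a : R) + b * D.root) := by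
        refine IsUnit.of_mul_eq_one (b * D.root - a) ?_
        linear_combination (-1 : R) * habR + (b : R) ^ 2 * hs
      refine ⟨α₀ * (a + b * D.root), ?_, ?_⟩
      · rw [hα₀, Ideal.span_singleton_mul_right_unit hu]
      · rw [map_mul, map_add, map_mul, map_intCast, map_intCast, D.conj_root]
        push_cast at h3
        linear_combination (-1 : R) * h3 * ((a : R) ^ 2 - b ^ 2 * D.root ^ 2) -
          (n : R) ^ 2 * habR + (n : R) ^ 2 * b ^ 2 * hs
  by_cases hβ : α + n = 0
  · refine D.isPrincipal_of_sq_eq_span hp hn ?_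
    rw [hα, eq_neg_of_add_eq_zero_left hβ, Ideal.span_singleton_neg]
  · have hβ' : D.conj (α + n) ≠ 0 := (map_ne_zero_iff _ D.conj.injective).mpr hβ
    apply Ideal.isPrincipal_of_span_mul hβ'
    have hN := hnorm (α + n)
    refine D.isPrincipal_of_sq_eq_span hp (m := n * (Algebra.norm ℤ (α + n)).natAbs) ?_ ?_
    · apply mul_ne_zero hn
      rw [Int.natAbs_ne_zero]
      intro h0
      rw [h0, Int.cast_zero] at hN
      exact mul_ne_zero hβ hβ' hN.symm
    · rw [mul_pow, hα, Ideal.span_singleton_pow, Ideal.span_singleton_mul_span_singleton]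
      have e : D.conj (α + n) ^ 2 * α = n * (Algebra.norm ℤ (α + n) : R) := by
        rw [hN, map_add, map_natCast]
        linear_combination (D.conj α + n) * hαn
      rw [e]
      rcases Int.natAbs_eq (Algebra.norm ℤ (α + n)) with h2 | h2
      · rw [h2]
        push_cast
        simp
      · rw [h2]
        push_cast
        rw [mul_neg, Ideal.span_singleton_neg]
        simp

end QuadraticConj

theorem exists_quadraticConj {k : Type*} [Field k] [NumberField k] {p : ℕ} {s : k}
    (hs : s ^ 2 = (p : k)) (hmem : s ∉ (algebraMap ℚ k).range) (htop : ℚ⟮s⟯ = ⊤) :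
    ∃ D : QuadraticConj (𝓞 k) p, ∀ x : 𝓞 k, (Algebra.norm ℤ x : 𝓞 k) = x * D.conj x := by
  obtain ⟨-, σ, hσs, hnorm, htrace⟩ :=
    exists_algEquiv_of_adjoin_sqrt (d := (p : ℚ)) (by simpa using hs) hmem htop
  have hinv : ∀ x, σ (σ x) = x := by
    intro x
    have h := congrArg σ (htrace x)
    rw [AlgEquiv.commutes, htrace, map_add] at h
    linear_combination -h
  have hsint : IsIntegral ℤ s := ⟨Polynomial.X ^ 2 - Polynomial.C (p : ℤ),
    Polynomial.monic_X_pow_sub_C _ two_ne_zero, by simp [hs]⟩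
  have hsR : (⟨s, hsint⟩ : 𝓞 k) ^ 2 = (p : 𝓞 k) := RingOfIntegers.ext hs
  refine ⟨{ conj := RingOfIntegers.mapRingEquiv σ.toRingEquiv
            root := ⟨s, hsint⟩
            root_sq := hsR
            conj_root := RingOfIntegers.ext hσs
            conj_conj := fun x => RingOfIntegers.ext (hinv x)
            exists_int := ?_
            exists_half := ?_ }, ?_⟩
  · intro x hx
    have hx' : σ (x : k) = x := congrArg (algebraMap (𝓞 k) k) hx
    have h := htrace x
    rw [hx'] at h
    have hxq : (x : k) = algebraMap ℚ k (Algebra.trace ℚ k x / 2) := by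
      rw [map_div₀, h, map_ofNat]
      ring
    have hint : IsIntegral ℤ (Algebra.trace ℚ k x / 2) := by
      have : IsIntegral ℤ (algebraMap ℚ k (Algebra.trace ℚ k x / 2)) := hxq ▸ x.isIntegral_coe
      exact (isIntegral_algebraMap_iff (algebraMap ℚ k).injective).mp this
    obtain ⟨n, hn⟩ := IsIntegrallyClosed.isIntegral_iff.mp hint
    refine ⟨n, RingOfIntegers.ext ?_⟩
    rw [hxq, ← hn]
    simp
  · intro hp
    obtain ⟨q, rfl⟩ : ∃ q, p = 4 * q + 1 := ⟨p / 4, by omega⟩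
    have hint : IsIntegral ℤ ((1 + s) / 2) := by
      refine ⟨Polynomial.X ^ 2 - (Polynomial.X + Polynomial.C (q : ℤ)), ?_, ?_⟩
      · apply Polynomial.monic_X_pow_sub
        exact (Polynomial.degree_X_add_C _).trans_lt (by norm_num)
      · simp only [Polynomial.eval₂_sub, Polynomial.eval₂_add, Polynomial.eval₂_pow,
          Polynomial.eval₂_X, Polynomial.eval₂_C]
        push_cast at hs ⊢
        linear_combination hs / 4
    refine ⟨⟨_, hint⟩, RingOfIntegers.ext ?_⟩
    change 2 * ((1 + s) / 2) = 1 + s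
    ring
  · intro x
    apply RingOfIntegers.ext
    have h := hnorm x
    rw [← Algebra.coe_norm_int] at h
    simpa using h

theorem eq_one_of_isPGroup_two_classGroup {k : Type*} [Field k] [NumberField k] {p : ℕ}
    (hp : p.Prime) {s : k} (hs : s ^ 2 = (p : k)) (hmem : s ∉ (algebraMap ℚ k).range)
    (htop : ℚ⟮s⟯ = ⊤) (h : IsPGroup 2 (ClassGroup (𝓞 k)))
    (c : ClassGroup (𝓞 k)) : c = 1 := by
  obtain ⟨D, hD⟩ := exists_quadraticConj hs hmem htop
  have hprinc : ∀ J : (Ideal (𝓞 k))⁰,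
      ClassGroup.mk0 J = 1 ↔ (J : Ideal (𝓞 k)).IsPrincipal := by
    rintro ⟨J, hJ⟩
    exact ClassGroup.mk0_eq_one_iff hJ
  have hsq : ∀ c : ClassGroup (𝓞 k), c ^ 2 = 1 → c = 1 := by
    intro c hc
    obtain ⟨I, rfl⟩ := ClassGroup.mk0_surjective c
    rw [← map_pow, hprinc, SubmonoidClass.coe_pow] at hc
    exact (hprinc I).mpr (D.isPrincipal_of_sq_isPrincipal hp hD
      (mem_nonZeroDivisors_iff_ne_zero.mp I.2) hc)
  obtain ⟨n, hn⟩ := h c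
  induction n with
  | zero => simpa using hn
  | succ n ih => exact ih (hsq _ (by rw [← pow_mul, ← pow_succ, hn]))

theorem adjoin_eq_top_of_le {L : IntermediateField ℚ ℝ} {F : Type*} [Field F] [Algebra ℚ F]
    [Algebra F L] [IsScalarTower ℚ F L] {s : L}
    (hL : ∀ M : IntermediateField ℚ ℝ, (∀ x : F, (algebraMap F L x : ℝ) ∈ M) →
      (s : ℝ) ∈ M → L ≤ M) :
    F⟮s⟯ = ⊤ := by
  rw [eq_top_iff]
  rintro x -
  have h := hL ((F⟮s⟯.restrictScalars ℚ).map L.val) (fun y => ⟨_, F⟮s⟯.algebraMap_mem y, rfl⟩)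
    ⟨s, mem_adjoin_simple_self F s, rfl⟩ x.2
  obtain ⟨y, hy, hyx⟩ := h
  rwa [← Subtype.ext hyx]

theorem sqrt_notMem_Qs {a b : ℕ} (ha : ¬ IsSquare a) (hab : ¬ IsSquare (a * b)) :
    Real.sqrt a ∉ Qs b := by
  intro h
  have hb2 : Real.sqrt b ^ 2 = b := Real.sq_sqrt (by positivity)
  have ha2 : Real.sqrt a ^ 2 = a := Real.sq_sqrt (by positivity)
  have hlin : ∀ x ∈ Algebra.adjoin ℚ {Real.sqrt b}, ∃ u v : ℚ, x = u + v * Real.sqrt b := by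
    intro x hx
    induction hx using Algebra.adjoin_induction with
    | mem x hx => exact ⟨0, 1, by simpa using hx⟩
    | algebraMap r => exact ⟨r, 0, by simp⟩
    | add x y _ _ hx hy =>
      obtain ⟨u, v, rfl⟩ := hx
      obtain ⟨u', v', rfl⟩ := hy
      exact ⟨u + u', v + v', by push_cast; ring⟩
    | mul x y _ _ hx hy =>
      obtain ⟨u, v, rfl⟩ := hx
      obtain ⟨u', v', rfl⟩ := hy
      refine ⟨u * u' + v * v' * b, u * v' + v * u', ?_⟩
      push_cast
      linear_combination (v * v' : ℝ) * hb2
  have hirra := irrational_sqrt_natCast_iff.mpr ha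
  have hirrab := irrational_sqrt_natCast_iff.mpr hab
  rw [Qs, ← IntermediateField.mem_toSubalgebra,
    IntermediateField.adjoin_simple_toSubalgebra_of_isAlgebraic (isIntegral_sqrt b).isAlgebraic] at h
  obtain ⟨u, v, huv⟩ := hlin _ h
  have hsq : (a : ℝ) = u ^ 2 + v ^ 2 * b + 2 * u * v * Real.sqrt b := by
    rw [← ha2, huv]
    linear_combination (v ^ 2 : ℝ) * hb2
  by_cases hv : v = 0
  · exact hirra ⟨u, by rw [huv, hv]; simp⟩
  by_cases hu : u = 0
  · refine hirrab ⟨v * b, ?_⟩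
    rw [Nat.cast_mul, Real.sqrt_mul (by positivity), huv, hu]
    push_cast
    linear_combination -(v : ℝ) * hb2
  · refine hirra ⟨u + v * ((a - u ^ 2 - v ^ 2 * b) / (2 * u * v)), ?_⟩
    have hu' : (u : ℝ) ≠ 0 := by exact_mod_cast hu
    have hv' : (v : ℝ) ≠ 0 := by exact_mod_cast hv
    rw [huv]
    push_cast
    rw [hsq]
    field_simp
    ring

theorem Qs_le_iff {m : ℕ} {M : IntermediateField ℚ ℝ} : Qs m ≤ M ↔ Real.sqrt m ∈ M := by
  rw [Qs, adjoin_simple_le_iff]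

theorem Qs2_le_iff {a b : ℕ} {M : IntermediateField ℚ ℝ} :
    Qs2 a b ≤ M ↔ Real.sqrt a ∈ M ∧ Real.sqrt b ∈ M := by
  rw [Qs2, adjoin_le_iff, Set.insert_subset_iff, Set.singleton_subset_iff]
  rfl

theorem sqrt_mem_Qs (m : ℕ) : Real.sqrt m ∈ Qs m := Qs_le_iff.mp le_rfl

theorem exists_conj_of_not_isSquare {m d : ℕ} {L : IntermediateField ℚ ℝ} (hm : Qs m ≤ L)
    (hd : Real.sqrt d ∈ L)
    (hL : ∀ M : IntermediateField ℚ ℝ, Real.sqrt m ∈ M → Real.sqrt d ∈ M → L ≤ M)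
    (hd1 : ¬ IsSquare d) (hd2 : ¬ IsSquare (d * m)) :
    letI : Algebra (Qs m) L := (inclusion hm).toRingHom.toAlgebra
    Module.finrank (Qs m) L = 2 ∧ ∃ σ : L ≃+* L, σ ⟨Real.sqrt d, hd⟩ = -⟨Real.sqrt d, hd⟩ ∧
      σ ⟨Real.sqrt m, Qs_le_iff.mp hm⟩ = ⟨Real.sqrt m, Qs_le_iff.mp hm⟩ ∧
      ∀ x, algebraMap (Qs m) L (Algebra.norm (Qs m) x) = x * σ x := by
  let : Algebra (Qs m) L := (inclusion hm).toRingHom.toAlgebra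
  have : IsScalarTower ℚ (Qs m) L := IsScalarTower.of_algebraMap_eq fun x => rfl
  obtain ⟨hrank, σ, hσ, hnorm, -⟩ := exists_algEquiv_of_adjoin_sqrt (F := Qs m) (K := L)
    (s := ⟨Real.sqrt d, hd⟩) (d := (d : Qs m)) (by
      ext
      rw [map_natCast]
      simp) (by
      rintro ⟨x, hx⟩
      apply sqrt_notMem_Qs hd1 hd2
      have := congrArg Subtype.val hx
      change (x : ℝ) = Real.sqrt d at this
      rw [← this]
      exact x.2) (adjoin_eq_top_of_le fun M h1 h2 =>
        hL M (h1 ⟨Real.sqrt m, sqrt_mem_Qs m⟩) h2)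
  exact ⟨hrank, σ.toRingEquiv, hσ, σ.commutes ⟨Real.sqrt m, sqrt_mem_Qs m⟩, hnorm⟩

theorem eq_one_of_isPGroup_two_classGroup_Qs {p : ℕ} (hp : p.Prime)
    (h : IsPGroup 2 (ClassGroup (𝓞 (Qs p)))) (c : ClassGroup (𝓞 (Qs p))) : c = 1 := by
  refine eq_one_of_isPGroup_two_classGroup hp (s := ⟨Real.sqrt p, sqrt_mem_Qs p⟩)
    ?_ ?_ ?_ h c
  · ext
    simp
  · rintro ⟨x, hx⟩
    exact hp.irrational_sqrt ⟨x, congrArg Subtype.val hx⟩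
  · exact adjoin_eq_top_of_le fun M _ h2 => Qs_le_iff.mpr h2

theorem isPGroup_two_classGroup_Qs2_iff {m n : ℕ} (hm : ¬ IsSquare m) (hn : ¬ IsSquare n)
    (hmn : ¬ IsSquare (m * n)) :
    IsPGroup 2 (ClassGroup (𝓞 (Qs2 m n))) ↔ IsPGroup 2 (ClassGroup (𝓞 (Qs m))) ∧
      IsPGroup 2 (ClassGroup (𝓞 (Qs n))) ∧ IsPGroup 2 (ClassGroup (𝓞 (Qs (m * n)))) := by
  obtain ⟨hm2, hn2⟩ := (Qs2_le_iff (a := m) (b := n)).mp le_rfl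
  have hsqrt : Real.sqrt (m * n : ℕ) = Real.sqrt m * Real.sqrt n := by
    rw [Nat.cast_mul, Real.sqrt_mul (by positivity)]
  have hm0 : m ≠ 0 := by rintro rfl; exact hm (IsSquare.zero)
  have hsm : Real.sqrt m ≠ 0 := by positivity
  have hmn2 : Real.sqrt (m * n : ℕ) ∈ Qs2 m n := hsqrt ▸ mul_mem hm2 hn2
  obtain ⟨hr₁, σ₁, hn₁, hm₁, hσ₁⟩ := exists_conj_of_not_isSquare (Qs_le_iff.mpr hm2) hn2
    (fun M h1 h2 => Qs2_le_iff.mpr ⟨h1, h2⟩) hn (by rwa [mul_comm])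
  obtain ⟨hr₂, σ₂, hm₂, hn₂, hσ₂⟩ := exists_conj_of_not_isSquare (Qs_le_iff.mpr hn2) hm2
    (fun M h1 h2 => Qs2_le_iff.mpr ⟨h2, h1⟩) hm hmn
  obtain ⟨hr₃, σ₃, hm₃, hmn₃, hσ₃⟩ := exists_conj_of_not_isSquare (Qs_le_iff.mpr hmn2) hm2
    (fun M h1 h2 => Qs2_le_iff.mpr ⟨h2, by
      have : Real.sqrt n = (Real.sqrt m)⁻¹ * Real.sqrt (m * n : ℕ) := by
        rw [hsqrt]; field_simp
      rw [this]
      exact mul_mem (inv_mem h2) h1⟩) hm (by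
      rintro ⟨r, hr⟩
      obtain ⟨t, rfl⟩ : m ∣ r := (Nat.pow_dvd_pow_iff two_ne_zero).mp ⟨n, by rw [sq, ← hr]; ring⟩
      refine hn ⟨t, Nat.eq_of_mul_eq_mul_left (show 0 < m * m by positivity) ?_⟩
      linarith)
  let : Algebra (Qs m) (Qs2 m n) := (inclusion (Qs_le_iff.mpr hm2)).toRingHom.toAlgebra
  let : Algebra (Qs n) (Qs2 m n) := (inclusion (Qs_le_iff.mpr hn2)).toRingHom.toAlgebra
  let : Algebra (Qs (m * n)) (Qs2 m n) := (inclusion (Qs_le_iff.mpr hmn2)).toRingHom.toAlgebra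
  constructor
  · intro h
    exact ⟨isPGroup_two_classGroup_of_finrank_eq_two hr₁ h,
      isPGroup_two_classGroup_of_finrank_eq_two hr₂ h,
      isPGroup_two_classGroup_of_finrank_eq_two hr₃ h⟩
  · rintro ⟨h₁, h₂, h₃⟩
    have hn₃ : σ₃ ⟨Real.sqrt n, hn2⟩ = -⟨Real.sqrt n, hn2⟩ := by
      have e : (⟨Real.sqrt (m * n : ℕ), hmn2⟩ : Qs2 m n) =
          ⟨Real.sqrt m, hm2⟩ * ⟨Real.sqrt n, hn2⟩ := Subtype.ext hsqrt
      rw [e, map_mul, hm₃] at hmn₃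
      have h0 : (⟨Real.sqrt m, hm2⟩ : Qs2 m n) ≠ 0 := fun h => hsm (congrArg Subtype.val h)
      apply mul_left_cancel₀ h0
      linear_combination -hmn₃
    have hσ : (σ₃ : Qs2 m n →+* Qs2 m n).toRatAlgHom =
        ((σ₁ : Qs2 m n →+* Qs2 m n).comp (σ₂ : Qs2 m n →+* Qs2 m n)).toRatAlgHom := by
      apply algHom_ext_of_eq_adjoin ℚ (S := Qs2 m n) (s := {Real.sqrt m, Real.sqrt n}) rfl
      rintro x (rfl | rfl)
      · change σ₃ ⟨Real.sqrt m, hm2⟩ = σ₁ (σ₂ ⟨Real.sqrt m, hm2⟩)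
        rw [hm₃, hm₂, map_neg, hm₁]
      · change σ₃ ⟨Real.sqrt n, hn2⟩ = σ₁ (σ₂ ⟨Real.sqrt n, hn2⟩)
        rw [hn₃, hn₂, hn₁]
    exact isPGroup_two_classGroup_of_biquadratic hr₁ hr₂ hr₃ σ₁ σ₂ σ₃ hσ₁ hσ₂ hσ₃
      (fun x => DFunLike.congr_fun hσ x) h₁ h₂ h₃

theorem exists_classNum_eq_two_pow_iff {K : Type*} [Field K] [NumberField K] :
    (∃ t : ℕ, classNum K = 2 ^ t) ↔ IsPGroup 2 (ClassGroup (𝓞 K)) :=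
  IsPGroup.iff_card.symm

/-- Let `p1, q1, q2` be three distinct primes and `K = ℚ(√p1, √(q1·q2))`. Then `h_K` is a
power of `2` iff `h_{ℚ(√p1)} = 1` and both `h_{ℚ(√(q1·q2))}` and `h_{ℚ(√(p1·q1·q2))}`
are powers of `2`. -/
theorem statement_11 (p1 q1 q2 : ℕ)
    (hp : p1.Prime) (hq1 : q1.Prime) (hq2 : q2.Prime)
    (hne1 : p1 ≠ q1) (hne2 : p1 ≠ q2) (hne3 : q1 ≠ q2) :
    (∃ t : ℕ, classNum (Qs2 p1 (q1 * q2)) = 2 ^ t) ↔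
      (classNum (Qs p1) = 1 ∧ (∃ t : ℕ, classNum (Qs (q1 * q2)) = 2 ^ t) ∧
        (∃ t : ℕ, classNum (Qs (p1 * q1 * q2)) = 2 ^ t)) := by
  have hsf : Squarefree (q1 * q2) :=
    Nat.squarefree_mul_iff.mpr ⟨(Nat.coprime_primes hq1 hq2).mpr hne3, hq1.squarefree,
      hq2.squarefree⟩
  have hsf' : Squarefree (p1 * (q1 * q2)) :=
    Nat.squarefree_mul_iff.mpr ⟨Nat.Coprime.mul_right ((Nat.coprime_primes hp hq1).mpr hne1)
      ((Nat.coprime_primes hp hq2).mpr hne2), hp.squarefree, hsf⟩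
  have hnsq : ∀ {m : ℕ}, Squarefree m → m ≠ 1 → ¬ IsSquare m := by
    rintro _ hm h1 ⟨r, rfl⟩
    exact h1 (by simp [Nat.isUnit_iff.mp (hm r dvd_rfl)])
  have key := isPGroup_two_classGroup_Qs2_iff (hnsq hp.squarefree hp.ne_one)
    (hnsq hsf (by simp [hq1.ne_one])) (hnsq hsf' (by simp [hp.ne_one]))
  simp only [exists_classNum_eq_two_pow_iff]
  rw [mul_assoc, key]
  refine and_congr_left fun _ => ⟨fun h => ?_, fun h => ?_⟩
  · exact Nat.card_eq_one_iff_unique.mpr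
      ⟨⟨fun a b => (eq_one_of_isPGroup_two_classGroup_Qs hp h a).trans
        (eq_one_of_isPGroup_two_classGroup_Qs hp h b).symm⟩, ⟨1⟩⟩
  · exact exists_classNum_eq_two_pow_iff.mp ⟨0, h⟩
end
end

section
/- Let d > 1 be a squarefree integer. The class number of the real quadratic field ℚ(√d) is odd if and only if one of the following holds: (i) d is prime; (ii) d = 2·p with p a prime and p ≡ 3 (mod 4); (iii) d = p·p′ with p, p′ distinct primes and p ≡ p′ ≡ 3 (mod 4). -/
open NumberField IntermediateField

set_option synthInstance.maxHeartbeats 1000000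
set_option maxHeartbeats 1000000

noncomputable section

/-- A real quadratic field `K = ℚ(θ)` with `θ ^ 2 = d` for a squarefree `d > 1`, together with a
real embedding. -/
structure RealQuadratic (K : Type*) [Field K] [NumberField K] (d : ℕ) where
  /-- the square root of `d` -/
  θ : K
  θ_sq : θ ^ 2 = (d : K)
  finrank_eq : Module.finrank ℚ K = 2
  /-- a real embedding -/
  ι : K →+* ℝ
  squarefree : Squarefree d
  one_lt : 1 < d

theorem eq_one_of_squarefree_of_isSquare {n : ℕ} (hn : Squarefree n) (h : IsSquare n) : n = 1 := by
  obtain ⟨k, rfl⟩ := h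
  have := Nat.isUnit_iff.1 (hn k dvd_rfl)
  simp [this]

theorem eq_of_squarefree_of_isSquare_mul {m n : ℕ} (hm : Squarefree m) (hn : Squarefree n)
    (h : IsSquare (m * n)) : m = n := by
  obtain ⟨k, hk⟩ := h
  have h0 : m ≠ 0 := hm.ne_zero
  have h1 : m ∣ k := by
    rw [← hm.dvd_pow_iff_dvd (n := 2) two_ne_zero, pow_two, ← hk]
    exact dvd_mul_right _ _
  obtain ⟨l, rfl⟩ := h1
  have h2 : n = m * (l * l) := by
    apply Nat.eq_of_mul_eq_mul_left (Nat.pos_of_ne_zero h0)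
    rw [hk]; ring
  have h3 := Nat.isUnit_iff.1 (hn l ⟨m, by rw [h2]; ring⟩)
  simp [h2, h3]

theorem exists_int_of_sq_mul_squarefree {d : ℕ} (hd : Squarefree d) (q : ℚ) (n : ℤ)
    (h : q ^ 2 * d = n) : ∃ m : ℤ, q = m := by
  have h1 : q.num ^ 2 * d = n * (q.den : ℤ) ^ 2 := by
    have h2 : (q.den : ℚ) ≠ 0 := by exact_mod_cast q.den_nz
    rw [← Rat.num_div_den q] at h
    field_simp at h
    rw [mul_comm n]
    exact_mod_cast h
  have h3 : ((q.den : ℤ) ^ 2) ∣ d := by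
    have hc : IsCoprime ((q.den : ℤ) ^ 2) (q.num ^ 2) := by
      apply IsCoprime.pow
      rw [Int.isCoprime_iff_gcd_eq_one, Int.gcd_comm]
      simpa [Int.gcd] using q.reduced
    exact hc.dvd_of_dvd_mul_left ⟨n, by rw [h1]; ring⟩
  have h4 : q.den * q.den ∣ d := by
    rw [← pow_two]; exact_mod_cast h3
  have h5 := Nat.isUnit_iff.1 (hd _ h4)
  exact ⟨q.num, by conv_lhs => rw [← Rat.num_div_den q, h5]; simp⟩

theorem norm_algebraMap_coe {K : Type*} [Field K] [NumberField K] (x : 𝓞 K) :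
    Algebra.norm ℚ (algebraMap (𝓞 K) K x) = (Algebra.norm ℤ x : ℚ) :=
  (Algebra.coe_norm_int x).symm

theorem trace_algebraMap_coe {K : Type*} [Field K] [NumberField K] (x : 𝓞 K) :
    Algebra.trace ℚ K (algebraMap (𝓞 K) K x) = (Algebra.trace ℤ (𝓞 K) x : ℚ) :=
  (Algebra.coe_trace_int x).symm

namespace RealQuadratic

variable {K : Type*} [Field K] [NumberField K] {d : ℕ} (Q : RealQuadratic K d)
include Q

theorem ne_zero : d ≠ 0 := Q.squarefree.ne_zero

theorem θ_ne_zero : Q.θ ≠ 0 := by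
  intro h
  have := Q.θ_sq
  rw [h] at this
  exact Q.ne_zero (by exact_mod_cast (by simpa using this.symm : (d : K) = 0))

theorem θ_ne_rat (q : ℚ) : Q.θ ≠ (q : K) := by
  intro h
  have h1 := Q.θ_sq
  rw [h] at h1
  have h2 : q ^ 2 = (d : ℚ) := by exact_mod_cast h1
  have h3 : IsSquare d := by
    rw [← Rat.isSquare_natCast_iff]
    exact ⟨q, by rw [← h2]; ring⟩
  have := eq_one_of_squarefree_of_isSquare Q.squarefree h3
  have := Q.one_lt
  omega

theorem coeff_eq_zero {a b : ℚ} (h : (a : K) + b * Q.θ = 0) : a = 0 ∧ b = 0 := by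
  by_cases hb : b = 0
  · subst hb
    simpa using h
  · exfalso
    apply Q.θ_ne_rat (-a / b)
    have hb' : (b : K) ≠ 0 := by exact_mod_cast hb
    push_cast
    field_simp
    linear_combination h

theorem linearIndependent : LinearIndependent ℚ ![(1 : K), Q.θ] := by
  rw [LinearIndependent.pair_iff]
  intro a b h
  apply Q.coeff_eq_zero
  simpa [Algebra.smul_def] using h

/-- The basis `1, θ`. -/
def basis : Module.Basis (Fin 2) ℚ K :=
  basisOfLinearIndependentOfCardEqFinrank Q.linearIndependent (by simp [Q.finrank_eq])

theorem basis_zero : Q.basis 0 = 1 := by simp [basis]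

theorem basis_one : Q.basis 1 = Q.θ := by simp [basis]

theorem exists_coeff (x : K) : ∃ a b : ℚ, x = a + b * Q.θ := by
  refine ⟨Q.basis.repr x 0, Q.basis.repr x 1, ?_⟩
  conv_lhs => rw [← Q.basis.sum_repr x]
  simp [basis_zero, basis_one, Algebra.smul_def]

theorem repr_eq (a b : ℚ) : ⇑(Q.basis.repr (a + b * Q.θ)) = ![a, b] := by
  have h : (a : K) + b * Q.θ = ∑ i, (![a, b] i) • Q.basis i := by
    simp [basis_zero, basis_one, Algebra.smul_def]
  rw [h, Q.basis.repr_sum_self]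

theorem leftMulMatrix_eq (a b : ℚ) :
    Algebra.leftMulMatrix Q.basis (a + b * Q.θ) = !![a, b * d; b, a] := by
  have h1 : (a + b * Q.θ) * Q.θ = ((b * d : ℚ) : K) + a * Q.θ := by
    push_cast; linear_combination (b : K) * Q.θ_sq
  ext i j
  rw [Algebra.leftMulMatrix_eq_repr_mul]
  fin_cases i <;> fin_cases j <;>
    simp only [Fin.zero_eta, Fin.mk_one, basis_zero, basis_one, mul_one, h1, repr_eq] <;> simp

theorem norm_eq (a b : ℚ) : Algebra.norm ℚ ((a : K) + b * Q.θ) = a ^ 2 - d * b ^ 2 := by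
  rw [Algebra.norm_eq_matrix_det Q.basis, leftMulMatrix_eq, Matrix.det_fin_two_of]
  ring

theorem trace_eq (a b : ℚ) : Algebra.trace ℚ K ((a : K) + b * Q.θ) = 2 * a := by
  rw [Algebra.trace_eq_matrix_trace Q.basis, leftMulMatrix_eq, Matrix.trace_fin_two_of]
  ring

theorem charpoly_eq (x : K) :
    x ^ 2 - (Algebra.trace ℚ K x : ℚ) * x + (Algebra.norm ℚ x : ℚ) = 0 := by
  obtain ⟨a, b, rfl⟩ := Q.exists_coeff x
  rw [norm_eq, trace_eq]
  push_cast
  linear_combination (b : K) ^ 2 * Q.θ_sq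

theorem int_charpoly_eq (x : 𝓞 K) :
    x ^ 2 - (Algebra.trace ℤ (𝓞 K) x : 𝓞 K) * x + (Algebra.norm ℤ x : 𝓞 K) = 0 := by
  have h := Q.charpoly_eq (algebraMap (𝓞 K) K x)
  rw [norm_algebraMap_coe, trace_algebraMap_coe] at h
  apply RingOfIntegers.coe_injective
  simpa using h

theorem isIntegral_of_trace_norm {x : K} {t n : ℤ} (ht : Algebra.trace ℚ K x = t)
    (hn : Algebra.norm ℚ x = n) : IsIntegral ℤ x := by
  have h := Q.charpoly_eq x
  rw [ht, hn] at h
  refine ⟨Polynomial.X ^ 2 + Polynomial.C (-t) * Polynomial.X + Polynomial.C n, by monicity!, ?_⟩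
  simp only [Polynomial.eval₂_add, Polynomial.eval₂_mul, Polynomial.eval₂_C,
    Polynomial.eval₂_X, Polynomial.eval₂_pow]
  push_cast at h ⊢
  simp only [eq_intCast]
  linear_combination h

theorem exists_half_int_coeff (x : 𝓞 K) : ∃ A B : ℤ,
    algebraMap (𝓞 K) K x = ((A / 2 : ℚ) : K) + ((B / 2 : ℚ) : K) * Q.θ ∧
    A = Algebra.trace ℤ (𝓞 K) x ∧ 4 * Algebra.norm ℤ x = A ^ 2 - d * B ^ 2 := by
  obtain ⟨a, b, hx⟩ := Q.exists_coeff (algebraMap (𝓞 K) K x)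
  have ht := (trace_algebraMap_coe x).symm
  have hn := (norm_algebraMap_coe x).symm
  rw [hx, trace_eq] at ht
  rw [hx, norm_eq] at hn
  obtain ⟨B, hB⟩ := exists_int_of_sq_mul_squarefree Q.squarefree (2 * b)
    (Algebra.trace ℤ (𝓞 K) x ^ 2 - 4 * Algebra.norm ℤ x) (by
      push_cast; rw [hn, ht]; ring)
  refine ⟨Algebra.trace ℤ (𝓞 K) x, B, ?_, rfl, ?_⟩
  · rw [hx, ht, ← hB]; simp
  · have : (4 * Algebra.norm ℤ x : ℚ) = (Algebra.trace ℤ (𝓞 K) x : ℚ) ^ 2 - d * (B : ℚ) ^ 2 := by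
      rw [hn, ht, ← hB]; ring
    exact_mod_cast this

theorem natCast_isSquare {n : ℕ} (hn : Squarefree n) (h : IsSquare (n : K)) : n = 1 ∨ n = d := by
  obtain ⟨x, hx⟩ := h
  obtain ⟨a, b, rfl⟩ := Q.exists_coeff x
  have h1 : ((a ^ 2 + d * b ^ 2 - n : ℚ) : K) + ((2 * a * b : ℚ) : K) * Q.θ = 0 := by
    push_cast
    linear_combination - hx - (b : K) ^ 2 * Q.θ_sq
  obtain ⟨h2, h3⟩ := Q.coeff_eq_zero h1
  have h4 : a = 0 ∨ b = 0 := by simpa using h3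
  rcases h4 with rfl | rfl
  · right
    apply eq_of_squarefree_of_isSquare_mul hn Q.squarefree
    rw [← Rat.isSquare_natCast_iff]
    exact ⟨d * b, by push_cast; linear_combination -(d : ℚ) * h2⟩
  · left
    apply eq_one_of_squarefree_of_isSquare hn
    rw [← Rat.isSquare_natCast_iff]
    exact ⟨a, by linear_combination -h2⟩

end RealQuadratic

theorem exists_coe_eq {K : Type*} [Field K] {x : K} (hx : IsIntegral ℤ x) :
    ∃ y : 𝓞 K, algebraMap (𝓞 K) K y = x := ⟨⟨x, hx⟩, rfl⟩

namespace RealQuadratic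

variable {K : Type*} [Field K] [NumberField K] {d : ℕ} (Q : RealQuadratic K d)
include Q

theorem rank_eq_one : Units.rank K = 1 := by
  have h1 := InfinitePlace.card_add_two_mul_card_eq_rank K
  rw [Q.finrank_eq] at h1
  have h2 : (InfinitePlace.mk (Complex.ofRealHom.comp Q.ι)).IsReal := by
    refine ⟨_, ?_, rfl⟩
    rw [ComplexEmbedding.isReal_iff]
    ext x
    simp [ComplexEmbedding.conjugate_coe_eq]
  have h3 : 0 < InfinitePlace.nrRealPlaces K := by
    classical
    exact Fintype.card_pos_iff.2 ⟨⟨_, h2⟩⟩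
  have h4 := InfinitePlace.card_eq_nrRealPlaces_add_nrComplexPlaces K
  rw [Units.rank]
  omega

theorem eq_one_or_neg_one_of_mem_torsion {ζ : (𝓞 K)ˣ} (h : ζ ∈ Units.torsion K) :
    ζ = 1 ∨ ζ = -1 := by
  rw [Units.torsion, CommGroup.mem_torsion, isOfFinOrder_iff_pow_eq_one] at h
  obtain ⟨n, hn, h⟩ := h
  have h1 : |Q.ι (ζ : K)| ^ n = 1 := by
    rw [← abs_pow, ← map_pow]
    have : ((ζ : K)) ^ n = 1 := by
      have := congrArg (fun u : (𝓞 K)ˣ => ((u : 𝓞 K) : K)) h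
      simpa using this
    simp [this]
  rw [pow_eq_one_iff_of_nonneg (abs_nonneg _) hn.ne', abs_eq zero_le_one] at h1
  rcases h1 with h1 | h1
  · left
    ext
    apply Q.ι.injective
    simpa using h1
  · right
    ext
    apply Q.ι.injective
    simpa using h1

theorem ι_unit_ne_zero (u : (𝓞 K)ˣ) : Q.ι (u : K) ≠ 0 := by
  simp

omit [NumberField K] Q in
theorem isSquare_unit {u : (𝓞 K)ˣ} (h : IsSquare (u : K)) : IsSquare u := by
  obtain ⟨x, hx⟩ := h
  have hi : IsIntegral ℤ x := by
    apply IsIntegral.of_pow (n := 2) two_pos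
    rw [pow_two, ← hx]
    exact RingOfIntegers.isIntegral_coe _
  obtain ⟨y, rfl⟩ := exists_coe_eq hi
  have h1 : (u : 𝓞 K) = y * y := by
    apply RingOfIntegers.coe_injective
    rw [hx, map_mul]
  obtain ⟨v, rfl⟩ : IsUnit y := isUnit_of_mul_isUnit_left (h1 ▸ u.isUnit)
  exact ⟨v, Units.ext h1⟩

theorem exists_fundamental_unit : ∃ ε : (𝓞 K)ˣ, 0 < Q.ι (ε : K) ∧ ¬ IsSquare (ε : K) ∧
    ∀ u : (𝓞 K)ˣ, 0 < Q.ι (u : K) → ∃ k : ℤ, u = ε ^ k := by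
  have hr := Q.rank_eq_one
  let hU : Unique (Fin (Units.rank K)) := (finCongr hr).unique
  obtain ⟨f, hf⟩ : ∃ f : (𝓞 K)ˣ, f = Units.fundSystem K default := ⟨_, rfl⟩
  have hex : ∀ u : (𝓞 K)ˣ, ∃ k : ℤ, u = f ^ k ∨ u = - f ^ k := by
    intro u
    obtain ⟨⟨ζ, e⟩, h, -⟩ := Units.exist_unique_eq_mul_prod K u
    refine ⟨e default, ?_⟩
    simp only [Fintype.prod_unique, ← hf] at h
    rcases Q.eq_one_or_neg_one_of_mem_torsion ζ.2 with h1 | h1 <;> rw [h1] at h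
    · left; simpa using h
    · right; simpa using h
  have huniq : ∀ k : ℤ, (f ^ k = 1 ∨ f ^ k = -1) → k = 0 := by
    intro k h
    have h1 : f ^ k ∈ Units.torsion K := by
      rcases h with h | h <;> rw [h]
      · exact one_mem _
      · rw [Units.torsion, CommGroup.mem_torsion, isOfFinOrder_iff_pow_eq_one]
        exact ⟨2, two_pos, by simp⟩
    have h2 := (Units.exist_unique_eq_mul_prod K 1).unique
      (y₁ := (⟨(f ^ k)⁻¹, inv_mem h1⟩, fun _ => k)) (y₂ := (1, 0))
      (by simp [← hf]) (by simp)
    have := congrFun (congrArg Prod.snd h2) default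
    simpa using this
  obtain ⟨ε, hε, hfε⟩ : ∃ ε : (𝓞 K)ˣ, 0 < Q.ι (ε : K) ∧ (ε = f ∨ ε = -f) := by
    rcases lt_or_gt_of_ne (Q.ι_unit_ne_zero f) with h | h
    · exact ⟨-f, by simpa using h, Or.inr rfl⟩
    · exact ⟨f, h, Or.inl rfl⟩
  have hzpow : ∀ k : ℤ, ε ^ k = f ^ k ∨ ε ^ k = - f ^ k := by
    intro k
    rcases hfε with rfl | rfl
    · exact Or.inl rfl
    · rcases Int.even_or_odd k with h | h
      · left; exact h.neg_zpow _
      · right; exact h.neg_zpow _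
  have hpos : ∀ u : (𝓞 K)ˣ, 0 < Q.ι (u : K) → ∃ k : ℤ, u = ε ^ k := by
    intro u hu
    obtain ⟨k, hk⟩ := hex u
    refine ⟨k, ?_⟩
    have h1 : u = ε ^ k ∨ u = - ε ^ k := by
      rcases hk with h | h <;> rcases hzpow k with h' | h' <;> rw [h, h'] <;> simp
    rcases h1 with h1 | h1
    · exact h1
    · exfalso
      rw [h1] at hu
      have : 0 < Q.ι (ε : K) ^ k := zpow_pos hε k
      have h2 : Q.ι ((ε ^ k : (𝓞 K)ˣ) : K) = Q.ι (ε : K) ^ k := by rw [Units.coe_zpow, map_zpow₀]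
      simp only [Units.val_neg, map_neg, h2] at hu
      linarith
  refine ⟨ε, hε, ?_, hpos⟩
  intro h
  obtain ⟨η, hη⟩ := isSquare_unit h
  obtain ⟨k, hk⟩ := hex η
  have h1 : ε = f ^ (2 * k) := by
    rw [hη, two_mul, zpow_add]
    rcases hk with hk | hk <;> rw [hk] <;> simp
  have h2 : 2 * k - 1 = 0 := by
    apply huniq
    rw [zpow_sub, ← h1]
    rcases hfε with rfl | rfl <;> simp
  omega

theorem isSquare_or_isSquare_mul {u v : (𝓞 K)ˣ} (hu : 0 < Q.ι (u : K)) (hv : 0 < Q.ι (v : K)) :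
    IsSquare (u : K) ∨ IsSquare (v : K) ∨ IsSquare ((u : K) * (v : K)) := by
  obtain ⟨ε, -, -, hε⟩ := Q.exists_fundamental_unit
  obtain ⟨k, rfl⟩ := hε u hu
  obtain ⟨l, rfl⟩ := hε v hv
  have key : ∀ m : ℤ, Even m → IsSquare (((ε ^ m : (𝓞 K)ˣ) : 𝓞 K) : K) := by
    rintro m ⟨n, rfl⟩
    exact ⟨((ε ^ n : (𝓞 K)ˣ) : K), by rw [zpow_add]; simp⟩
  rcases Int.even_or_odd k with h | h
  · exact Or.inl (key _ h)
  rcases Int.even_or_odd l with h' | h'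
  · exact Or.inr (Or.inl (key _ h'))
  · right; right
    have := key _ (h.add_odd h')
    rw [zpow_add] at this
    simpa using this

omit [NumberField K] Q in
theorem norm_unit (u : (𝓞 K)ˣ) :
    Algebra.norm ℤ (u : 𝓞 K) = 1 ∨ Algebra.norm ℤ (u : 𝓞 K) = -1 :=
  Int.isUnit_iff.1 (u.isUnit.map (Algebra.norm ℤ))

/-- If the rational prime `q` is unramified then `q𝓞` is a radical ideal. -/
theorem dvd_of_dvd_sq {q : ℕ} (hq : q.Prime) (hqd : ¬ q ∣ d) (hq2 : q = 2 → d % 4 = 1) {x : 𝓞 K}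
    (h : (q : 𝓞 K) ∣ x ^ 2) : (q : 𝓞 K) ∣ x := by
  obtain ⟨y, hy⟩ := h
  obtain ⟨A, B, hx, hA, hn⟩ := Q.exists_half_int_coeff x
  have hqZ : Prime (q : ℤ) := Nat.prime_iff_prime_int.1 hq
  have hnq : (q : ℤ) ∣ Algebra.norm ℤ x := by
    apply hqZ.dvd_of_dvd_pow (n := 2)
    rw [← map_pow, hy, map_mul]
    apply dvd_mul_of_dvd_left
    have : (q : 𝓞 K) = algebraMap ℤ (𝓞 K) (q : ℤ) := by simp
    rw [this, Algebra.norm_algebraMap]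
    exact dvd_pow_self _ (by rw [RingOfIntegers.rank, Q.finrank_eq]; exact two_ne_zero)
  obtain ⟨n, hnn⟩ := hnq
  have htr : Algebra.trace ℤ (𝓞 K) (x ^ 2) = A ^ 2 - 2 * Algebra.norm ℤ x := by
    have h1 : x ^ 2 = A • x - Algebra.norm ℤ x • (1 : 𝓞 K) := by
      have := Q.int_charpoly_eq x
      rw [← hA] at this
      simp only [zsmul_eq_mul, mul_one]
      linear_combination this
    rw [h1, map_sub, map_smul, map_smul, ← hA]
    have : Algebra.trace ℤ (𝓞 K) 1 = 2 := by
      have := Algebra.trace_algebraMap (R := ℤ) (S := 𝓞 K) 1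
      rw [RingOfIntegers.rank, Q.finrank_eq] at this
      simpa using this
    rw [this]
    simp; ring
  have htq : Algebra.trace ℤ (𝓞 K) (x ^ 2) = q * Algebra.trace ℤ (𝓞 K) y := by
    rw [hy]
    have : (q : 𝓞 K) * y = (q : ℤ) • y := by simp
    rw [this, map_smul, smul_eq_mul]
  set T := Algebra.trace ℤ (𝓞 K) y
  have hA2 : A ^ 2 = q * (T + 2 * n) := by rw [hnn] at htr; linarith
  have hB2 : d * B ^ 2 = q * (T - 2 * n) := by rw [hnn] at hn; linarith
  obtain ⟨A', rfl⟩ : (q : ℤ) ∣ A := hqZ.dvd_of_dvd_pow ⟨_, hA2⟩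
  obtain ⟨B', rfl⟩ : (q : ℤ) ∣ B := by
    rcases hqZ.dvd_or_dvd ⟨_, hB2⟩ with h | h
    · exact absurd (by exact_mod_cast h) hqd
    · exact hqZ.dvd_of_dvd_pow h
  have hqK : (q : K) ≠ 0 := by exact_mod_cast hq.ne_zero
  obtain ⟨N, hN⟩ : (4 : ℤ) ∣ A' ^ 2 - d * B' ^ 2 := by
    by_cases h2 : q = 2
    · subst h2
      have hd := hq2 rfl
      have h3 : A' ^ 2 - d * B' ^ 2 = 2 * n := by
        push_cast at hn hnn
        linarith
      have h4 : ((d : ℤ)) % 4 = 1 := by omega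
      have h5 : (A' ^ 2 - d * B' ^ 2) % 2 = 0 := by omega
      obtain ⟨e, he⟩ : ∃ e : ℤ, (d : ℤ) = 4 * e + 1 := ⟨d / 4, by omega⟩
      rw [he] at h5 ⊢
      rcases Int.even_or_odd' A' with ⟨s, rfl | rfl⟩ <;>
        rcases Int.even_or_odd' B' with ⟨t, rfl | rfl⟩
      · exact ⟨s ^ 2 - (4 * e + 1) * t ^ 2, by ring⟩
      · exfalso; ring_nf at h5; omega
      · exfalso; ring_nf at h5; omega
      · exact ⟨s ^ 2 + s - (4 * e + 1) * (t ^ 2 + t) - e, by ring⟩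
    · have hc : IsCoprime (4 : ℤ) ((q : ℤ) ^ 2) := by
        have : IsCoprime (2 : ℤ) (q : ℤ) := by
          exact_mod_cast (Nat.isCoprime_iff_coprime.2
            ((Nat.coprime_primes Nat.prime_two hq).2 (Ne.symm h2)))
        have := this.pow (m := 2) (n := 2)
        norm_num at this
        exact this
      apply hc.dvd_of_dvd_mul_left
      exact ⟨Algebra.norm ℤ x, by rw [hn]; ring⟩
  have h_integral : IsIntegral ℤ (((A' / 2 : ℚ) : K) + ((B' / 2 : ℚ) : K) * Q.θ) := by
    apply Q.isIntegral_of_trace_norm (t := A') (n := N)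
    · rw [trace_eq]; ring
    · rw [norm_eq]
      have : ((A' : ℚ) ^ 2 - d * B' ^ 2) = 4 * N := by exact_mod_cast hN
      linear_combination this / 4
  obtain ⟨z, hz⟩ := exists_coe_eq h_integral
  refine ⟨z, ?_⟩
  apply RingOfIntegers.coe_injective
  rw [hx, map_mul, hz]
  push_cast
  ring

end RealQuadratic

theorem odd_card_classGroup_of_forall {R : Type*} [CommRing R] [IsDedekindDomain R]
    [Finite (ClassGroup R)]
    (h : ∀ (I : Ideal R) (α : R), I ≠ ⊥ → I ^ 2 = Ideal.span {α} → I.IsPrincipal) :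
    Odd (Nat.card (ClassGroup R)) := by
  rw [← Nat.not_even_iff_odd, even_iff_two_dvd]
  intro h2
  have : Fact (Nat.Prime 2) := ⟨Nat.prime_two⟩
  obtain ⟨c, hc⟩ := exists_prime_orderOf_dvd_card' 2 h2
  obtain ⟨⟨I, hI⟩, rfl⟩ := ClassGroup.mk0_surjective c
  have h1 := pow_orderOf_eq_one (ClassGroup.mk0 ⟨I, hI⟩)
  rw [hc, ← map_pow] at h1
  have h3 : (I ^ 2).IsPrincipal := (ClassGroup.mk0_eq_one_iff (pow_mem hI 2)).1 h1
  obtain ⟨α, hα⟩ := h3.principal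
  have h4 : ClassGroup.mk0 ⟨I, hI⟩ = 1 :=
    (ClassGroup.mk0_eq_one_iff hI).2 (h I α (nonZeroDivisors.ne_zero hI) hα)
  rw [h4, orderOf_one] at hc
  omega

theorem isPrincipal_of_sq_eq_of_odd {K : Type*} [Field K] [NumberField K]
    (h : Odd (Nat.card (ClassGroup (𝓞 K)))) {I : Ideal (𝓞 K)} {α : 𝓞 K}
    (hI : I ^ 2 = Ideal.span {α}) : ∃ β, I = Ideal.span {β} := by
  have h1 : I.IsPrincipal := by
    apply Ideal.IsPrincipal.of_isPrincipal_pow_of_coprime (n := 2)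
    · rw [← Nat.card_eq_fintype_card]
      exact (Nat.coprime_two_left).2 h
    · rw [hI]; exact ⟨⟨α, rfl⟩⟩
  obtain ⟨β, hβ⟩ := h1.principal
  exact ⟨β, hβ⟩

theorem exists_unit_mul_eq_sq_of_odd {K : Type*} [Field K] [NumberField K]
    (h : Odd (Nat.card (ClassGroup (𝓞 K)))) {a b c : 𝓞 K}
    (haa : c ∣ a ^ 2) (hab : c ∣ a * b) (hbb : c ∣ b ^ 2)
    (hc : ∃ x y z, c = x * a ^ 2 + y * (a * b) + z * b ^ 2) :
    ∃ (u : (𝓞 K)ˣ) (β : 𝓞 K), c * u = β ^ 2 := by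
  have hI : (Ideal.span {a, b}) ^ 2 = Ideal.span {c} := by
    rw [pow_two, Ideal.span_pair_mul_span_pair]
    apply le_antisymm
    · rw [Ideal.span_le]
      rintro x hx
      simp only [Set.mem_insert_iff, Set.mem_singleton_iff] at hx
      rw [SetLike.mem_coe, Ideal.mem_span_singleton]
      rcases hx with rfl | rfl | rfl | rfl
      · rwa [← pow_two]
      · exact hab
      · rwa [mul_comm]
      · rwa [← pow_two]
    · rw [Ideal.span_singleton_le_iff_mem]
      obtain ⟨x, y, z, rfl⟩ := hc
      refine add_mem (add_mem ?_ ?_) ?_ <;> apply Ideal.mul_mem_left <;> apply Ideal.subset_span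
        <;> simp [pow_two]
  obtain ⟨β, hβ⟩ := isPrincipal_of_sq_eq_of_odd h hI
  rw [hβ, Ideal.span_singleton_pow, Ideal.span_singleton_eq_span_singleton] at hI
  obtain ⟨u, hu⟩ := hI.symm
  exact ⟨u, β, hu⟩

theorem sq_dvd_of_sq_dvd_coe {K : Type*} [Field K] [NumberField K] {q s : ℕ}
    (h : ((q ^ 2 : ℕ) : 𝓞 K) ∣ (s : 𝓞 K)) : q ^ 2 ∣ s := by
  have h1 := map_dvd (Algebra.norm ℤ) h
  have h2 : ∀ n : ℕ, Algebra.norm ℤ (n : 𝓞 K) = (n : ℤ) ^ Module.finrank ℤ (𝓞 K) := by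
    intro n
    rw [← Algebra.norm_algebraMap]
    simp
  rw [h2, h2] at h1
  have h3 : Module.finrank ℤ (𝓞 K) ≠ 0 := by
    rw [RingOfIntegers.rank]; exact Module.finrank_pos.ne'
  rw [Int.pow_dvd_pow_iff h3] at h1
  exact_mod_cast h1

namespace RealQuadratic

variable {K : Type*} [Field K] [NumberField K] {d : ℕ} (Q : RealQuadratic K d)
include Q

theorem norm_natCast (n : ℕ) : Algebra.norm ℤ (n : 𝓞 K) = (n : ℤ) ^ 2 := by
  have : (n : 𝓞 K) = algebraMap ℤ (𝓞 K) (n : ℤ) := by simp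
  rw [this, Algebra.norm_algebraMap, RingOfIntegers.rank, Q.finrank_eq]

theorem exists_int_mul_eq_sq {α : 𝓞 K} {n : ℤ} (hn : Algebra.norm ℤ α = n ^ 2) (hn0 : n ≠ 0) :
    ∃ (m : ℤ) (β : 𝓞 K), m ≠ 0 ∧ m * α = β ^ 2 := by
  have h := Q.int_charpoly_eq α
  rw [hn] at h
  set t := Algebra.trace ℤ (𝓞 K) α
  push_cast at h
  by_cases ht : t + 2 * n = 0
  · refine ⟨-n, n, neg_ne_zero.2 hn0, ?_⟩
    have h1 : (α + n) ^ 2 = 0 := by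
      have : (t : 𝓞 K) = -2 * n := by
        have : t = -2 * n := by linarith
        rw [this]; push_cast; ring
      rw [this] at h
      linear_combination h
    have h2 : α = -n := by
      have := pow_eq_zero_iff (two_ne_zero) |>.1 h1
      linear_combination this
    rw [h2]; push_cast; ring
  · refine ⟨t + 2 * n, α + n, ht, ?_⟩
    push_cast
    linear_combination -h

theorem exists_squarefree_mul_eq_sq {I : Ideal (𝓞 K)} {α : 𝓞 K} (hI0 : I ≠ ⊥)
    (hI : I ^ 2 = Ideal.span {α}) (hα : 0 < Algebra.norm ℤ α) :
    ∃ (s : ℕ) (β : 𝓞 K), Squarefree s ∧ (s * α = β ^ 2 ∨ -(s * α) = β ^ 2) ∧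
      Ideal.span {(s : 𝓞 K)} * I ^ 2 = Ideal.span {β} ^ 2 ∧
      ∀ q : ℕ, q.Prime → q ∣ s → q ∣ d ∨ (q = 2 ∧ d % 4 = 3) := by
  have hnorm : Algebra.norm ℤ α = (Ideal.absNorm I : ℤ) ^ 2 := by
    have h1 := congrArg Ideal.absNorm hI
    rw [map_pow, Ideal.absNorm_span_singleton] at h1
    have : ((Algebra.norm ℤ α).natAbs : ℤ) = Algebra.norm ℤ α := Int.natAbs_of_nonneg hα.le
    rw [← this, ← h1]; push_cast; rfl
  have hn0 : (Ideal.absNorm I : ℤ) ≠ 0 := by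
    intro h; rw [h] at hnorm; simp [hnorm] at hα
  obtain ⟨m, β₀, hm, hβ₀⟩ := Q.exists_int_mul_eq_sq hnorm hn0
  obtain ⟨s, k, hsk, hs⟩ := Nat.sq_mul_squarefree m.natAbs
  have hk0 : k ≠ 0 := by
    rintro rfl
    apply hm; rw [← Int.natAbs_eq_zero, ← hsk]; simp
  have hm' : (m : 𝓞 K) = (k : 𝓞 K) ^ 2 * s ∨ (m : 𝓞 K) = -((k : 𝓞 K) ^ 2 * s) := by
    have h1 : (m : ℤ) = k ^ 2 * s ∨ m = -(k ^ 2 * s) := by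
      have : ((k : ℤ) ^ 2 * s) = (m.natAbs : ℤ) := by rw [← hsk]; push_cast; rfl
      rw [this]; omega
    rcases h1 with h | h
    · left; rw [h]; push_cast; rfl
    · right; rw [h]; push_cast; rfl
  have hkβ : (k : 𝓞 K) ∣ β₀ := by
    rw [← IsIntegrallyClosed.pow_dvd_pow_iff (n := 2) two_ne_zero, ← hβ₀]
    apply dvd_mul_of_dvd_left
    rcases hm' with h | h <;> rw [h]
    · exact dvd_mul_right _ _
    · exact (dvd_neg).2 (dvd_mul_right _ _)
  obtain ⟨β, rfl⟩ := hkβ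
  have hkK : (k : 𝓞 K) ≠ 0 := by exact_mod_cast hk0
  have hsβ : s * α = β ^ 2 ∨ -(s * α) = β ^ 2 := by
    rcases hm' with h | h <;> rw [h] at hβ₀
    · left
      apply mul_left_cancel₀ (pow_ne_zero 2 hkK)
      linear_combination hβ₀
    · right
      apply mul_left_cancel₀ (pow_ne_zero 2 hkK)
      linear_combination hβ₀
  have hspan : Ideal.span {(s : 𝓞 K)} * I ^ 2 = Ideal.span {β} ^ 2 := by
    rw [hI, Ideal.span_singleton_mul_span_singleton, Ideal.span_singleton_pow]
    rcases hsβ with h | h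
    · rw [h]
    · rw [← h, Ideal.span_singleton_neg]
  refine ⟨s, β, hs, hsβ, hspan, ?_⟩
  have hdvd : I ∣ Ideal.span {β} := by
    rw [← UniqueFactorizationMonoid.pow_dvd_pow_iff_dvd (n := 2) two_ne_zero, ← hspan]
    exact dvd_mul_left _ _
  obtain ⟨J, hJ⟩ := hdvd
  have hJs : J ^ 2 = Ideal.span {(s : 𝓞 K)} := by
    rw [hJ, mul_pow, mul_comm] at hspan
    exact (mul_left_cancel₀ (pow_ne_zero 2 hI0) hspan).symm
  intro q hq hqs
  by_contra! hcon
  obtain ⟨hqd, hq2⟩ := hcon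
  have hJq : J ≤ Ideal.span {(q : 𝓞 K)} := by
    intro x hx
    rw [Ideal.mem_span_singleton]
    apply Q.dvd_of_dvd_sq hq hqd
    · rintro rfl
      have := hq2 rfl
      have : ¬ 2 ∣ d := hqd
      omega
    · have : x ^ 2 ∈ J ^ 2 := Ideal.pow_mem_pow hx 2
      rw [hJs, Ideal.mem_span_singleton] at this
      refine dvd_trans ?_ this
      exact_mod_cast Nat.cast_dvd_cast (α := 𝓞 K) hqs
  have h1 : J ^ 2 ≤ Ideal.span {((q ^ 2 : ℕ) : 𝓞 K)} := by
    have := Ideal.pow_right_mono hJq 2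
    rw [Ideal.span_singleton_pow] at this
    exact_mod_cast this
  rw [hJs, Ideal.span_singleton_le_span_singleton] at h1
  have h2 := sq_dvd_of_sq_dvd_coe h1
  rw [pow_two] at h2
  exact hq.one_lt.ne' (Nat.isUnit_iff.1 (hs q h2))

theorem exists_θ : ∃ t : 𝓞 K, algebraMap (𝓞 K) K t = Q.θ ∧ t ^ 2 = d := by
  have hi : IsIntegral ℤ Q.θ := by
    apply IsIntegral.of_pow (n := 2) two_pos
    rw [Q.θ_sq]
    exact map_natCast (algebraMap ℤ K) d ▸ isIntegral_algebraMap
  obtain ⟨t, ht⟩ := exists_coe_eq hi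
  refine ⟨t, ht, ?_⟩
  apply RingOfIntegers.coe_injective
  rw [map_pow, ht, Q.θ_sq, map_natCast]

/-- If the class number is odd, a ramified prime is a square up to a totally positive unit. -/
theorem exists_unit_mul_ramified (h : Odd (Nat.card (ClassGroup (𝓞 K)))) {q : ℕ}
    (hq : q.Prime) (hqd : q ∣ d ∨ (q = 2 ∧ d % 4 = 3)) :
    ∃ (u : (𝓞 K)ˣ) (β : 𝓞 K), (q : 𝓞 K) * u = β ^ 2 ∧ 0 < Q.ι (u : K) ∧
      Algebra.norm ℤ (u : 𝓞 K) = 1 := by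
  obtain ⟨t, -, ht⟩ := Q.exists_θ
  have key : ∃ (u : (𝓞 K)ˣ) (β : 𝓞 K), (q : 𝓞 K) * u = β ^ 2 := by
    rcases hqd with ⟨e, he⟩ | ⟨rfl, hd⟩
    · have hc : IsCoprime (q : ℤ) (e : ℤ) := by
        rw [Nat.isCoprime_iff_coprime, Nat.Prime.coprime_iff_not_dvd hq]
        rintro ⟨f, rfl⟩
        exact hq.one_lt.ne' (Nat.isUnit_iff.1 (Q.squarefree q ⟨f, by rw [he]; ring⟩))
      obtain ⟨x, y, hxy⟩ := hc
      have hxy' : (x : 𝓞 K) * q + y * e = 1 := by exact_mod_cast congrArg (Int.cast (R := 𝓞 K)) hxy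
      have ht' : t ^ 2 = q * e := by rw [ht, he]; push_cast; rfl
      apply exists_unit_mul_eq_sq_of_odd h (a := (q : 𝓞 K)) (b := t)
      · exact dvd_pow_self _ two_ne_zero
      · exact dvd_mul_right _ _
      · exact ⟨e, ht'⟩
      · exact ⟨x, 0, y, by linear_combination -(y : 𝓞 K) * ht' - (q : 𝓞 K) * hxy'⟩
    · obtain ⟨k, rfl⟩ : ∃ k, d = 4 * k + 3 := ⟨d / 4, by omega⟩
      push_cast at ht
      apply exists_unit_mul_eq_sq_of_odd h (a := ((2 : ℕ) : 𝓞 K)) (b := 1 + t)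
      · exact dvd_pow_self _ two_ne_zero
      · exact dvd_mul_right _ _
      · exact ⟨2 * k + 2 + t, by push_cast; linear_combination ht⟩
      · exact ⟨-k, -1, 1, by push_cast; linear_combination -ht⟩
  obtain ⟨u, β, hu⟩ := key
  have hq0 : (0 : ℝ) < q := by exact_mod_cast hq.pos
  have hβ0 : β ≠ 0 := by
    rintro rfl
    have : (q : 𝓞 K) ≠ 0 := by exact_mod_cast hq.ne_zero
    simp [this] at hu
  refine ⟨u, β, hu, ?_, ?_⟩
  · have h1 : (q : ℝ) * Q.ι (u : K) = Q.ι (β : K) ^ 2 := by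
      have := congrArg (fun z : 𝓞 K => Q.ι (algebraMap (𝓞 K) K z)) hu
      simpa using this
    have h2 : 0 < Q.ι (algebraMap (𝓞 K) K β) ^ 2 := by
      have : Q.ι (algebraMap (𝓞 K) K β) ≠ 0 := by simpa using hβ0
      positivity
    have h3 : 0 < (q : ℝ) * Q.ι (u : K) := h1 ▸ h2
    exact (pos_iff_pos_of_mul_pos h3).1 hq0
  · rcases norm_unit u with h1 | h1
    · exact h1
    · exfalso
      have := congrArg (Algebra.norm ℤ) hu
      rw [map_mul, map_pow, Q.norm_natCast, h1] at this
      have : (0 : ℤ) < q := by exact_mod_cast hq.pos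
      nlinarith [sq_nonneg (Algebra.norm ℤ β)]

end RealQuadratic

theorem IsSquare.of_mul_right₀ {F : Type*} [Field F] {a b : F} (hb : b ≠ 0) (h : IsSquare (a * b))
    (h' : IsSquare b) : IsSquare a := by
  have := h.div h'
  rwa [mul_div_cancel_right₀ _ hb] at this

theorem IsSquare.mul_of_mul_mul₀ {F : Type*} [Field F] {a b c : F} (hb : b ≠ 0)
    (h : IsSquare (b * c)) (h' : IsSquare (a * b)) : IsSquare (a * c) := by
  apply IsSquare.of_mul_right₀ (pow_ne_zero 2 hb) _ (IsSquare.sq b)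
  have := h'.mul h
  rwa [show a * b * (b * c) = a * c * b ^ 2 by ring] at this

theorem dvd_of_squarefree_of_forall_prime {s n : ℕ} (hs : Squarefree s)
    (h : ∀ q : ℕ, q.Prime → q ∣ s → q ∣ n) : s ∣ n := by
  by_cases hn : n = 0
  · simp [hn]
  rw [← Nat.prod_primeFactors_of_squarefree hs]
  refine dvd_trans (Finset.prod_dvd_prod_of_subset _ n.primeFactors _ ?_)
    (Nat.prod_primeFactors_dvd n)
  intro q hq
  rw [Nat.mem_primeFactors] at hq ⊢
  exact ⟨hq.1, h q hq.1 hq.2.1, hn⟩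

theorem eq_of_dvd_prime_mul_prime {p q s : ℕ} (hp : p.Prime) (hq : q.Prime) (h : s ∣ p * q) :
    s = 1 ∨ s = p ∨ s = q ∨ s = p * q := by
  obtain ⟨a, b, ha, hb, rfl⟩ := (Nat.dvd_mul).1 h
  rcases (Nat.dvd_prime hp).1 ha with rfl | rfl <;> rcases (Nat.dvd_prime hq).1 hb with rfl | rfl
    <;> simp

theorem exists_odd_sq_add_sq {d : ℕ} (hd : Squarefree d)
    (h : ∀ p : ℕ, p.Prime → p ∣ d → p % 4 ≠ 3) :
    ∃ a b : ℕ, d = a ^ 2 + b ^ 2 ∧ Odd a ∧ Nat.Coprime a b := by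
  have h1 : ∃ x y, d = x ^ 2 + y ^ 2 := by
    rw [Nat.eq_sq_add_sq_iff]
    intro q hq hq3
    rw [Nat.mem_primeFactors] at hq
    exact absurd hq3 (h q hq.1 hq.2.1)
  have h2 : ∃ a b, d = a ^ 2 + b ^ 2 ∧ Odd a := by
    obtain ⟨x, y, hxy⟩ := h1
    rcases Nat.even_or_odd x with hx | hx
    · rcases Nat.even_or_odd y with hy | hy
      · exfalso
        obtain ⟨x, rfl⟩ := hx
        obtain ⟨y, rfl⟩ := hy
        have := Nat.isUnit_iff.1 (hd 2 ⟨x ^ 2 + y ^ 2, by rw [hxy]; ring⟩)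
        omega
      · exact ⟨y, x, by rw [hxy, add_comm], hy⟩
    · exact ⟨x, y, hxy, hx⟩
  obtain ⟨a, b, hab, ha⟩ := h2
  refine ⟨a, b, hab, ha, Nat.isUnit_iff.1 (hd _ ?_)⟩
  rw [← pow_two, hab]
  exact dvd_add (pow_dvd_pow_of_dvd (Nat.gcd_dvd_left _ _) 2)
    (pow_dvd_pow_of_dvd (Nat.gcd_dvd_right _ _) 2)

namespace RealQuadratic

variable {K : Type*} [Field K] [NumberField K] {d : ℕ} (Q : RealQuadratic K d)
include Q

theorem norm_neg (x : 𝓞 K) : Algebra.norm ℤ (-x) = Algebra.norm ℤ x := by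
  have h : Algebra.norm ℤ (-1 : 𝓞 K) = 1 := by
    have : (-1 : 𝓞 K) = algebraMap ℤ (𝓞 K) (-1) := by simp
    rw [this, Algebra.norm_algebraMap, RingOfIntegers.rank, Q.finrank_eq]
    norm_num
  rw [← neg_one_mul, map_mul, h, one_mul]

omit [NumberField K] Q in
theorem norm_eq_one_of_isSquare {u : (𝓞 K)ˣ} (h : IsSquare (u : K)) :
    Algebra.norm ℤ (u : 𝓞 K) = 1 := by
  obtain ⟨v, rfl⟩ := isSquare_unit h
  rw [Units.val_mul, map_mul]
  rcases norm_unit v with h | h <;> rw [h] <;> norm_num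

theorem isSquare_natCast_self : IsSquare (d : K) := ⟨Q.θ, by rw [← Q.θ_sq, pow_two]⟩

/-- If the class number is odd and `d` is a sum of two squares, there is a unit of norm `-1`. -/
theorem exists_unit_norm_neg_one (h : Odd (Nat.card (ClassGroup (𝓞 K))))
    (hd : ∀ p : ℕ, p.Prime → p ∣ d → p % 4 ≠ 3) :
    ∃ u : (𝓞 K)ˣ, Algebra.norm ℤ (u : 𝓞 K) = -1 := by
  obtain ⟨t, htθ, ht⟩ := Q.exists_θ
  obtain ⟨a, b, hab, ha, hc⟩ := exists_odd_sq_add_sq Q.squarefree hd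
  have hc2 : IsCoprime (a : ℤ) ((2 * b : ℕ) : ℤ) := by
    rw [Nat.isCoprime_iff_coprime]
    exact Nat.Coprime.mul_right (Nat.coprime_two_right.2 ha) hc
  obtain ⟨x, y, hxy⟩ := hc2
  have hxy' : (x : 𝓞 K) * a + y * (2 * b) = 1 := by
    exact_mod_cast congrArg (Int.cast (R := 𝓞 K)) hxy
  have ht' : t ^ 2 = (a : 𝓞 K) ^ 2 + (b : 𝓞 K) ^ 2 := by rw [ht, hab]; push_cast; rfl
  obtain ⟨u, β, hu⟩ := exists_unit_mul_eq_sq_of_odd h (a := (a : 𝓞 K)) (b := b + t) (c := b + t)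
    ⟨t - b, by linear_combination -ht'⟩ (dvd_mul_left _ _) (dvd_pow_self _ two_ne_zero)
    ⟨-y, x, y, by linear_combination -(y : 𝓞 K) * ht' - ((b : 𝓞 K) + t) * hxy'⟩
  refine ⟨u, ?_⟩
  have hN : Algebra.norm ℤ ((b : 𝓞 K) + t) = -(a : ℤ) ^ 2 := by
    have h1 := norm_algebraMap_coe ((b : 𝓞 K) + t)
    have h2 : algebraMap (𝓞 K) K ((b : 𝓞 K) + t) = ((b : ℚ) : K) + ((1 : ℚ) : K) * Q.θ := by
      rw [map_add, htθ]; simp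
    rw [h2, norm_eq, hab] at h1
    have h3 : ((Algebra.norm ℤ ((b : 𝓞 K) + t) : ℤ) : ℚ) = -(a : ℚ) ^ 2 := by
      rw [← h1]; push_cast; ring
    exact_mod_cast h3
  rcases norm_unit u with h1 | h1
  · exfalso
    have h2 := congrArg (Algebra.norm ℤ) hu
    rw [map_mul, hN, h1, map_pow] at h2
    have : (0 : ℤ) < a := by exact_mod_cast ha.pos
    nlinarith [sq_nonneg (Algebra.norm ℤ β)]
  · exact h1

theorem eq_mul_of_odd (h : Odd (Nat.card (ClassGroup (𝓞 K)))) (hd : ¬ d.Prime) {p q : ℕ}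
    (hp : p.Prime) (hpd : p ∣ d ∨ (p = 2 ∧ d % 4 = 3)) (hq : q.Prime)
    (hqd : q ∣ d ∨ (q = 2 ∧ d % 4 = 3)) (hpq : p ≠ q) :
    d = p * q ∧ ∀ u : (𝓞 K)ˣ, Algebra.norm ℤ (u : 𝓞 K) = 1 := by
  have hns : ∀ {p : ℕ}, p.Prime → ∀ {u : (𝓞 K)ˣ} {β : 𝓞 K}, (p : 𝓞 K) * u = β ^ 2 →
      ¬ IsSquare (u : K) := by
    intro p hp u β hu hsq
    have h1 : IsSquare ((p : K) * (u : K)) := by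
      refine ⟨algebraMap (𝓞 K) K β, ?_⟩
      rw [← pow_two, ← map_pow, ← hu, map_mul, map_natCast]
    rcases Q.natCast_isSquare hp.prime.squarefree (h1.of_mul_right₀ (by simp) hsq) with h2 | h2
    · exact hp.ne_one h2
    · exact hd (h2 ▸ hp)
  obtain ⟨u, β, hu, hupos, -⟩ := Q.exists_unit_mul_ramified h hp hpd
  obtain ⟨v, γ, hv, hvpos, -⟩ := Q.exists_unit_mul_ramified h hq hqd
  have hu' := hns hp hu
  have hv' := hns hq hv
  constructor
  · rcases Q.isSquare_or_isSquare_mul hupos hvpos with h1 | h1 | h1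
    · exact absurd h1 hu'
    · exact absurd h1 hv'
    · have h2 : IsSquare (((p * q : ℕ) : K) * ((u : K) * (v : K))) := by
        refine ⟨algebraMap (𝓞 K) K (β * γ), ?_⟩
        rw [← pow_two, ← map_pow, mul_pow, ← hu, ← hv]
        simp only [map_mul, map_natCast]
        push_cast
        ring
      have h3 := h2.of_mul_right₀ (by simp) h1
      have hsf : Squarefree (p * q) :=
        (Nat.squarefree_mul ((Nat.coprime_primes hp hq).2 hpq)).2
          ⟨hp.prime.squarefree, hq.prime.squarefree⟩
      rcases Q.natCast_isSquare hsf h3 with h4 | h4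
      · exact absurd (Nat.eq_one_of_mul_eq_one_right h4) hp.ne_one
      · exact h4.symm
  · intro w
    obtain ⟨w', hw', hww'⟩ : ∃ w' : (𝓞 K)ˣ, 0 < Q.ι (w' : K) ∧
        Algebra.norm ℤ (w : 𝓞 K) = Algebra.norm ℤ (w' : 𝓞 K) := by
      rcases lt_or_gt_of_ne (Q.ι_unit_ne_zero w) with h | h
      · exact ⟨-w, by simpa using h, by rw [Units.val_neg, Q.norm_neg]⟩
      · exact ⟨w, h, rfl⟩
    rw [hww']
    rcases Q.isSquare_or_isSquare_mul hupos hw' with h1 | h1 | h1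
    · exact absurd h1 hu'
    · exact norm_eq_one_of_isSquare h1
    · have h2 : Algebra.norm ℤ ((u * w' : (𝓞 K)ˣ) : 𝓞 K) = 1 := by
        apply norm_eq_one_of_isSquare
        simpa using h1
      have h3 : Algebra.norm ℤ (u : 𝓞 K) = 1 := by
        have := congrArg (Algebra.norm ℤ) hu
        rw [map_mul, map_pow, Q.norm_natCast] at this
        rcases norm_unit u with h | h
        · exact h
        · rw [h] at this
          have : (0 : ℤ) < p := by exact_mod_cast hp.pos
          nlinarith [sq_nonneg (Algebra.norm ℤ β)]
      rwa [Units.val_mul, map_mul, h3, one_mul] at h2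

theorem prime_or_of_odd (h : Odd (Nat.card (ClassGroup (𝓞 K)))) :
    d.Prime ∨ (∃ p : ℕ, p.Prime ∧ p % 4 = 3 ∧ d = 2 * p) ∨
      (∃ p p' : ℕ, p.Prime ∧ p'.Prime ∧ p ≠ p' ∧ p % 4 = 3 ∧ p' % 4 = 3 ∧ d = p * p') := by
  by_cases hd : d.Prime
  · exact Or.inl hd
  right
  have hex : ∀ p : ℕ, p.Prime → p ∣ d → ∃ q : ℕ, q.Prime ∧ q ∣ d ∧ p ≠ q := by
    rintro p hp ⟨e, he⟩
    have he1 : e ≠ 1 := by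
      rintro rfl
      exact hd (by simpa [he] using hp)
    refine ⟨e.minFac, Nat.minFac_prime he1, ?_, ?_⟩
    · rw [he]; exact dvd_mul_of_dvd_right (Nat.minFac_dvd e) _
    · intro hpe
      have h1 : p ∣ e := hpe ▸ Nat.minFac_dvd e
      have h2 : p * p ∣ d := he ▸ mul_dvd_mul_left p h1
      exact hp.ne_one (Nat.isUnit_iff.1 (Q.squarefree p h2))
  have hd1 : d ≠ 1 := Q.one_lt.ne'
  have hd3 : d % 4 ≠ 3 := by
    intro h3
    have h1 := Nat.minFac_prime hd1
    have h2 := Nat.minFac_dvd d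
    have h4 : 2 ≠ d.minFac := by
      intro h5
      rw [← h5] at h2
      omega
    have := (Q.eq_mul_of_odd h hd Nat.prime_two (Or.inr ⟨rfl, h3⟩) h1 (Or.inl h2) h4).1
    omega
  obtain ⟨p, hp, hpd, hp3⟩ : ∃ p : ℕ, p.Prime ∧ p ∣ d ∧ p % 4 = 3 := by
    by_contra! hcon
    obtain ⟨u, hu⟩ := Q.exists_unit_norm_neg_one h hcon
    have h1 := Nat.minFac_prime hd1
    have h2 := Nat.minFac_dvd d
    obtain ⟨q, hq, hqd, hne⟩ := hex _ h1 h2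
    have := (Q.eq_mul_of_odd h hd h1 (Or.inl h2) hq (Or.inl hqd) hne).2 u
    omega
  obtain ⟨q, hq, hqd, hne⟩ := hex p hp hpd
  have hdpq := (Q.eq_mul_of_odd h hd hp (Or.inl hpd) hq (Or.inl hqd) hne).1
  rcases hq.eq_two_or_odd with rfl | hq2
  · exact Or.inl ⟨p, hp, hp3, by rw [hdpq, mul_comm]⟩
  · right
    refine ⟨p, q, hp, hq, hne, hp3, ?_, hdpq⟩
    by_contra hq3
    have hq1 : q % 4 = 1 := by omega
    apply hd3
    rw [hdpq, Nat.mul_mod, hp3, hq1]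

theorem norm_ne_neg_sq {p : ℕ} (hp : p.Prime) (hp3 : p % 4 = 3) (hpd : p ∣ d) {n : ℤ}
    (hn : n ≠ 0) (x : 𝓞 K) : Algebra.norm ℤ x ≠ -n ^ 2 := by
  intro h
  obtain ⟨A, B, -, -, hAB⟩ := Q.exists_half_int_coeff x
  rw [h] at hAB
  have h1 : d * B.natAbs ^ 2 = A.natAbs ^ 2 + (2 * n).natAbs ^ 2 := by
    zify
    simp only [sq_abs]
    linarith
  have hB : B.natAbs ≠ 0 := by
    intro h0
    rw [h0] at h1
    have : (2 * n).natAbs ≠ 0 := by omega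
    have := Nat.pos_of_ne_zero (pow_ne_zero 2 this)
    simp at h1
    omega
  have h2 := (Nat.eq_sq_add_sq_iff.1 ⟨_, _, h1⟩) p (by
    rw [Nat.mem_primeFactors]
    exact ⟨hp, dvd_mul_of_dvd_left hpd _, mul_ne_zero Q.ne_zero (pow_ne_zero 2 hB)⟩) hp3
  have : Fact p.Prime := ⟨hp⟩
  rw [padicValNat.mul Q.ne_zero (pow_ne_zero 2 hB), padicValNat.pow] at h2
  have h3 : padicValNat p d = 1 := by
    have h4 : 1 ≤ padicValNat p d := one_le_padicValNat_of_dvd Q.ne_zero hpd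
    have h5 : ¬ 2 ≤ padicValNat p d := by
      intro h6
      have h7 : p ^ 2 ∣ d := (padicValNat_dvd_iff_le Q.ne_zero).2 h6
      rw [pow_two] at h7
      exact hp.ne_one (Nat.isUnit_iff.1 (Q.squarefree p h7))
    omega
  rw [h3] at h2
  obtain ⟨k, hk⟩ := h2
  omega

theorem isPrincipal_of_isSquare_mul_unit {I : Ideal (𝓞 K)} {α : 𝓞 K} (hI0 : I ≠ ⊥)
    (hI : I ^ 2 = Ideal.span {α}) (hα : 0 < Algebra.norm ℤ α)
    (H : ∀ s : ℕ, Squarefree s → (∀ q : ℕ, q.Prime → q ∣ s → q ∣ d ∨ (q = 2 ∧ d % 4 = 3)) →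
      ∃ w : (𝓞 K)ˣ, IsSquare ((s : K) * (w : K))) : I.IsPrincipal := by
  obtain ⟨s, β, hs, -, hsI, hsr⟩ := Q.exists_squarefree_mul_eq_sq hI0 hI hα
  obtain ⟨w, x, hx⟩ := H s hs hsr
  have hi : IsIntegral ℤ x := by
    apply IsIntegral.of_pow (n := 2) two_pos
    rw [pow_two, ← hx, ← map_natCast (algebraMap (𝓞 K) K), ← map_mul]
    exact RingOfIntegers.isIntegral_coe _
  obtain ⟨δ, rfl⟩ := exists_coe_eq hi
  have hδ : (s : 𝓞 K) * w = δ ^ 2 := by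
    apply RingOfIntegers.coe_injective
    rw [map_mul, map_natCast, map_pow, hx, pow_two]
  have hδ2 : Ideal.span {(s : 𝓞 K)} = Ideal.span {δ} ^ 2 := by
    rw [Ideal.span_singleton_pow, ← hδ, Ideal.span_singleton_mul_right_unit w.isUnit]
  rw [hδ2, ← mul_pow] at hsI
  have h1 : Ideal.span {δ} * I = Ideal.span {β} := by
    apply le_antisymm <;> rw [← Ideal.dvd_iff_le,
      ← UniqueFactorizationMonoid.pow_dvd_pow_iff_dvd (n := 2) two_ne_zero, hsI]
  have hδ0 : δ ≠ 0 := by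
    rintro rfl
    have : (s : 𝓞 K) ≠ 0 := by exact_mod_cast hs.ne_zero
    simp [this] at hδ
  have h2 : δ ∣ β := by
    rw [← Ideal.mem_span_singleton]
    exact Ideal.mul_le_left (I := Ideal.span {δ}) (J := I)
      (h1 ▸ Ideal.mem_span_singleton_self β)
  obtain ⟨γ, rfl⟩ := h2
  rw [← Ideal.span_singleton_mul_span_singleton] at h1
  have h3 := mul_left_cancel₀ (by simpa using hδ0) h1
  exact ⟨⟨γ, h3⟩⟩

/-- Hilbert's Theorem 90 for a non-square totally positive unit. -/
theorem exists_ramified_mul_unit_isSquare {ε : (𝓞 K)ˣ} (hpos : 0 < Q.ι (ε : K))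
    (hns : ¬ IsSquare (ε : K)) (hε : Algebra.norm ℤ (ε : 𝓞 K) = 1) :
    ∃ s : ℕ, Squarefree s ∧ s ≠ 1 ∧ s ≠ d ∧ IsSquare ((s : K) * (ε : K)) ∧
      ∀ q : ℕ, q.Prime → q ∣ s → q ∣ d ∨ (q = 2 ∧ d % 4 = 3) := by
  obtain ⟨s, β, hs, hsq, -, hr⟩ := Q.exists_squarefree_mul_eq_sq (I := ⊤) (α := (ε : 𝓞 K))
    (by simp) (by rw [Ideal.span_singleton_eq_top.2 ε.isUnit, Ideal.top_pow]) (by rw [hε]; simp)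
  have hsq' : (s : 𝓞 K) * ε = β ^ 2 := by
    rcases hsq with h | h
    · exact h
    · exfalso
      have h1 := congrArg (fun z : 𝓞 K => Q.ι (algebraMap (𝓞 K) K z)) h
      simp only [map_neg, map_mul, map_natCast, map_pow] at h1
      have h2 : (0 : ℝ) < s := by exact_mod_cast Nat.pos_of_ne_zero hs.ne_zero
      have h3 := mul_pos h2 hpos
      nlinarith [sq_nonneg (Q.ι (algebraMap (𝓞 K) K β))]
  have hsK : IsSquare ((s : K) * (ε : K)) := by
    refine ⟨algebraMap (𝓞 K) K β, ?_⟩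
    rw [← pow_two, ← map_pow, ← hsq', map_mul, map_natCast]
  refine ⟨s, hs, ?_, ?_, hsK, hr⟩
  · rintro rfl
    exact hns (by simpa using hsK)
  · rintro rfl
    rw [mul_comm] at hsK
    exact hns (hsK.of_mul_right₀ (by exact_mod_cast Q.ne_zero) Q.isSquare_natCast_self)

theorem odd_of_prime (hd : d.Prime) (hd3 : d % 4 ≠ 3) : Odd (Nat.card (ClassGroup (𝓞 K))) := by
  have hram : ∀ s : ℕ, Squarefree s →
      (∀ q : ℕ, q.Prime → q ∣ s → q ∣ d ∨ (q = 2 ∧ d % 4 = 3)) → s = 1 ∨ s = d := by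
    intro s hs h
    rw [← Nat.dvd_prime hd]
    apply dvd_of_squarefree_of_forall_prime hs
    intro q hq hqs
    rcases h q hq hqs with h1 | h1
    · exact h1
    · exact absurd h1.2 hd3
  obtain ⟨ε, hpos, hns, -⟩ := Q.exists_fundamental_unit
  have hε : Algebra.norm ℤ (ε : 𝓞 K) = -1 := by
    rcases norm_unit ε with h | h
    · exfalso
      obtain ⟨s, hs, hs1, hsd, -, hr⟩ := Q.exists_ramified_mul_unit_isSquare hpos hns h
      rcases hram s hs hr with h | h <;> contradiction
    · exact h
  have H : ∀ s : ℕ, Squarefree s →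
      (∀ q : ℕ, q.Prime → q ∣ s → q ∣ d ∨ (q = 2 ∧ d % 4 = 3)) →
      ∃ w : (𝓞 K)ˣ, IsSquare ((s : K) * (w : K)) := by
    intro s hs hr
    refine ⟨1, ?_⟩
    rcases hram s hs hr with rfl | rfl
    · simp
    · simpa using Q.isSquare_natCast_self
  apply odd_card_classGroup_of_forall
  intro I α hI0 hI
  have hα : α ≠ 0 := by
    rintro rfl
    simp at hI
    exact hI0 ((pow_eq_zero_iff two_ne_zero).1 hI)
  have hN : Algebra.norm ℤ α ≠ 0 := by simpa [Algebra.norm_eq_zero_iff] using hα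
  rcases lt_or_gt_of_ne hN with h | h
  · apply Q.isPrincipal_of_isSquare_mul_unit (α := α * ε) hI0 _ _ H
    · rw [hI, Ideal.span_singleton_mul_right_unit ε.isUnit]
    · rw [map_mul, hε]; linarith
  · exact Q.isPrincipal_of_isSquare_mul_unit hI0 hI h H

theorem odd_of_two_ramified {p q : ℕ} (hp : p.Prime) (hq : q.Prime)
    (hr : ∀ r : ℕ, r.Prime → (r ∣ d ∨ (r = 2 ∧ d % 4 = 3)) → r ∣ p * q)
    (hd : d = p * q ∨ d = q) {l : ℕ} (hl : l.Prime) (hld : l ∣ d) (hl3 : l % 4 = 3) :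
    Odd (Nat.card (ClassGroup (𝓞 K))) := by
  have hram : ∀ s : ℕ, Squarefree s →
      (∀ q : ℕ, q.Prime → q ∣ s → q ∣ d ∨ (q = 2 ∧ d % 4 = 3)) →
      s = 1 ∨ s = p ∨ s = q ∨ s = p * q := fun s hs h =>
    eq_of_dvd_prime_mul_prime hp hq
      (dvd_of_squarefree_of_forall_prime hs fun r hr' hrs => hr r hr' (h r hr' hrs))
  obtain ⟨ε, hpos, hns, -⟩ := Q.exists_fundamental_unit
  have hε : Algebra.norm ℤ (ε : 𝓞 K) = 1 := by
    rcases norm_unit ε with h | h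
    · exact h
    · exact absurd (by simpa using h) (Q.norm_ne_neg_sq hl hl3 hld one_ne_zero (ε : 𝓞 K))
  obtain ⟨s, hs, hs1, hsd, hsq, hsr⟩ := Q.exists_ramified_mul_unit_isSquare hpos hns hε
  have hdsq := Q.isSquare_natCast_self
  have hpK : (p : K) ≠ 0 := by exact_mod_cast hp.ne_zero
  have hqK : (q : K) ≠ 0 := by exact_mod_cast hq.ne_zero
  have hp2 : IsSquare ((p : K) * p) := ⟨p, rfl⟩
  have H : ∀ r : ℕ, Squarefree r →
      (∀ q : ℕ, q.Prime → q ∣ r → q ∣ d ∨ (q = 2 ∧ d % 4 = 3)) →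
      ∃ w : (𝓞 K)ˣ, IsSquare ((r : K) * (w : K)) := by
    intro r hr' hrr
    suffices h : IsSquare (r : K) ∨ IsSquare ((r : K) * (ε : K)) by
      rcases h with h | h
      · exact ⟨1, by simpa using h⟩
      · exact ⟨ε, h⟩
    have hsK : (s : K) ≠ 0 := by exact_mod_cast hs.ne_zero
    have key : IsSquare ((r : K) * (s : K)) → IsSquare ((r : K) * (ε : K)) :=
      fun h => IsSquare.mul_of_mul_mul₀ hsK hsq h
    rcases hram r hr' hrr with rfl | rfl | rfl | rfl
    · left; simp
    · right
      apply key
      rcases hram s hs hsr with rfl | rfl | rfl | rfl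
      · contradiction
      · exact hp2
      · rcases hd with rfl | rfl
        · simpa using hdsq
        · contradiction
      · rcases hd with rfl | rfl
        · contradiction
        · have := hp2.mul hdsq
          push_cast
          rwa [← mul_assoc]
    · rcases hd with rfl | rfl
      · right
        apply key
        rcases hram s hs hsr with rfl | rfl | rfl | rfl
        · contradiction
        · rw [mul_comm]; simpa using hdsq
        · exact ⟨_, rfl⟩
        · contradiction
      · exact Or.inl hdsq
    · rcases hd with rfl | rfl
      · exact Or.inl hdsq
      · right
        apply key
        rcases hram s hs hsr with rfl | rfl | rfl | rfl
        · contradiction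
        · have := hp2.mul hdsq
          push_cast
          rwa [mul_right_comm]
        · contradiction
        · exact ⟨_, rfl⟩
  apply odd_card_classGroup_of_forall
  intro I α hI0 hI
  have hα : α ≠ 0 := by
    rintro rfl
    simp at hI
    exact hI0 ((pow_eq_zero_iff two_ne_zero).1 hI)
  have hN : Algebra.norm ℤ α ≠ 0 := by simpa [Algebra.norm_eq_zero_iff] using hα
  rcases lt_or_gt_of_ne hN with h | h
  · exfalso
    have h1 := congrArg Ideal.absNorm hI
    rw [map_pow, Ideal.absNorm_span_singleton] at h1
    have h2 : Algebra.norm ℤ α = -(Ideal.absNorm I : ℤ) ^ 2 := by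
      have : ((Algebra.norm ℤ α).natAbs : ℤ) = -Algebra.norm ℤ α := by omega
      rw [← h1] at this
      push_cast at this
      linarith
    refine Q.norm_ne_neg_sq hl hl3 hld ?_ α h2
    intro h0
    rw [h0] at h2
    simp at h2
    exact hα h2
  · exact Q.isPrincipal_of_isSquare_mul_unit hI0 hI h H

theorem odd_card_classGroup_iff : Odd (Nat.card (ClassGroup (𝓞 K))) ↔
    d.Prime ∨ (∃ p : ℕ, p.Prime ∧ p % 4 = 3 ∧ d = 2 * p) ∨
      (∃ p p' : ℕ, p.Prime ∧ p'.Prime ∧ p ≠ p' ∧ p % 4 = 3 ∧ p' % 4 = 3 ∧ d = p * p') := by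
  refine ⟨Q.prime_or_of_odd, ?_⟩
  rintro (hd | ⟨p, hp, hp3, hd⟩ | ⟨p, q, hp, hq, -, hp3, hq3, hd⟩)
  · by_cases hd3 : d % 4 = 3
    · refine Q.odd_of_two_ramified Nat.prime_two hd ?_ (Or.inr rfl) hd dvd_rfl hd3
      rintro r - (h | ⟨rfl, -⟩)
      · exact dvd_mul_of_dvd_right h _
      · exact dvd_mul_right _ _
    · exact Q.odd_of_prime hd hd3
  · refine Q.odd_of_two_ramified Nat.prime_two hp ?_ (Or.inl hd) hp (hd ▸ dvd_mul_left _ _) hp3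
    rintro r - (h | ⟨-, h⟩)
    · rwa [← hd]
    · omega
  · refine Q.odd_of_two_ramified hp hq ?_ (Or.inl hd) hp (hd ▸ dvd_mul_right _ _) hp3
    rintro r - (h | ⟨-, h⟩)
    · rwa [← hd]
    · rw [hd, Nat.mul_mod, hp3, hq3] at h
      omega

end RealQuadratic

theorem finrank_Qs {d : ℕ} (hsf : Squarefree d) (hd : 1 < d) :
    Module.finrank ℚ (Qs d) = 2 := by
  have hirr : Irreducible (Polynomial.X ^ 2 - Polynomial.C (d : ℚ)) := by
    apply X_pow_sub_C_irreducible_of_prime Nat.prime_two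
    intro b hb
    have h1 : IsSquare d := by
      rw [← Rat.isSquare_natCast_iff]
      exact ⟨b, by rw [← hb, pow_two]⟩
    exact hd.ne' (eq_one_of_squarefree_of_isSquare hsf h1)
  have hmin : Polynomial.X ^ 2 - Polynomial.C (d : ℚ) = minpoly ℚ (Real.sqrt d) := by
    apply minpoly.eq_of_irreducible_of_monic hirr _ (Polynomial.monic_X_pow_sub_C _ two_ne_zero)
    have : Real.sqrt d ^ 2 = (d : ℝ) := Real.sq_sqrt (by positivity)
    simp [this]
  rw [Qs, IntermediateField.adjoin.finrank (isIntegral_sqrt d), ← hmin,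
    Polynomial.natDegree_X_pow_sub_C]

/-- The field `ℚ(√d)` as a real quadratic field. -/
def realQuadraticQs {d : ℕ} (hsf : Squarefree d) (hd : 1 < d) : RealQuadratic (Qs d) d where
  θ := ⟨Real.sqrt d, IntermediateField.mem_adjoin_simple_self ℚ _⟩
  θ_sq := by
    apply Subtype.ext
    simp
  finrank_eq := finrank_Qs hsf hd
  ι := (Qs d).val.toRingHom
  squarefree := hsf
  one_lt := hd

/-- Let `d > 1` be squarefree. The class number of `ℚ(√d)` is odd iff `d` is prime, or
`d = 2p` with `p ≡ 3 (mod 4)` prime, or `d = p·p'` with distinct primes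
`p ≡ p' ≡ 3 (mod 4)`. -/
theorem statement_12 (d : ℕ) (hsf : Squarefree d) (hd : 1 < d) :
    Odd (classNum (Qs d)) ↔
      (d.Prime ∨
        (∃ p : ℕ, p.Prime ∧ p % 4 = 3 ∧ d = 2 * p) ∨
        (∃ p p' : ℕ, p.Prime ∧ p'.Prime ∧ p ≠ p' ∧ p % 4 = 3 ∧ p' % 4 = 3 ∧ d = p * p')) := by
  exact (realQuadraticQs hsf hd).odd_card_classGroup_iff
end
end

section
/- Let p1, q1, q2 be three distinct odd primes with q1 ≠ 3 and q2 ≠ 3, and set l = 16·p1·q1·q2. Then there exists an odd integer u with gcd(u, l) = 1 and gcd((u−1)/2, l) = 1 such that every prime p satisfying p ≡ u (mod l) satisfies (p1/p) = 1, (q1/p) = −1 and (q2/p) = −1. -/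
set_option synthInstance.maxHeartbeats 1000000
set_option maxHeartbeats 1000000

open NumberTheorySymbols in
/-- Quadratic reciprocity for a prime modulus `p ≡ 3 mod 4`: `(q/p) = (-p/q)`. -/
lemma legendreSym_eq_jacobiSym_neg {p q : ℕ} [Fact p.Prime] (hp : p % 4 = 3) (hq : Odd q) :
    legendreSym p q = J(-(p : ℤ) | q) := by
  rw [jacobiSym.legendreSym.to_jacobiSym, jacobiSym.neg _ hq]
  have hpo : Odd p := Nat.odd_iff.mpr (by omega)
  rcases Nat.odd_mod_four_iff.mp (Nat.odd_iff.mp hq) with h | h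
  · rw [jacobiSym.quadratic_reciprocity_one_mod_four h hpo, ZMod.χ₄_nat_one_mod_four h, one_mul]
  · rw [jacobiSym.quadratic_reciprocity_three_mod_four h hp, ZMod.χ₄_nat_three_mod_four h,
      neg_one_mul]

open NumberTheorySymbols in
/-- Modulo a prime `q > 3` there is a quadratic non-residue other than `-1`. -/
lemma exists_jacobiSym_eq_neg_one_not_dvd_add_one {q : ℕ} (hq : q.Prime) (hodd : Odd q)
    (h3 : q ≠ 3) : ∃ r : ℕ, J(r | q) = -1 ∧ ¬ q ∣ r + 1 := by
  have := Fact.mk hq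
  obtain ⟨a, ha⟩ := FiniteField.exists_nonsquare (F := ZMod q) (by
    rw [ZMod.ringChar_zmod_n]
    rintro rfl
    exact absurd hodd (by decide))
  have hJ : J(a.val | q) = -1 := by
    apply ZMod.nonsquare_iff_jacobiSym_eq_neg_one.mpr
    simpa using ha
  by_cases h : q ∣ a.val + 1
  · refine ⟨4 * a.val, ?_, fun h4 => h3 ?_⟩
    · rw [Nat.cast_mul, jacobiSym.mul_left, hJ, Nat.cast_ofNat, jacobiSym.at_four hodd, one_mul]
    · have : q ∣ 3 := by
        have := Nat.dvd_sub (h.mul_left 4) h4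
        rwa [show 4 * (a.val + 1) - (4 * a.val + 1) = 3 by omega] at this
      exact (Nat.prime_dvd_prime_iff_eq hq Nat.prime_three).mp this
  · exact ⟨a.val, hJ, h⟩

open NumberTheorySymbols in
lemma not_dvd_of_jacobiSym_ne_zero {q : ℕ} (hq : q.Prime) {r : ℤ} (h : J(r | q) ≠ 0) :
    ¬ (q : ℤ) ∣ r := by
  intro hd
  rw [jacobiSym.mod_left, Int.emod_eq_zero_of_dvd hd, jacobiSym.zero_left hq.one_lt] at h
  exact h rfl

/-- If `u = -v` is odd and `v` is neither `0` nor `-1` modulo the prime `q`, then `q` is coprime to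
both `u` and `(u - 1) / 2`. -/
lemma isCoprime_neg_and_half {q : ℕ} (hq : q.Prime) {v : ℤ} (hv : Odd v)
    (h0 : ¬ (q : ℤ) ∣ v) (h1 : ¬ (q : ℤ) ∣ v + 1) :
    IsCoprime (-v) (q : ℤ) ∧ IsCoprime ((-v - 1) / 2) (q : ℤ) := by
  have hq' := Nat.prime_iff_prime_int.mp hq
  refine ⟨((hq'.coprime_iff_not_dvd.mpr fun h => h0 (by simpa using h))).symm,
    (hq'.coprime_iff_not_dvd.mpr fun h => h1 ?_).symm⟩
  obtain ⟨k, rfl⟩ := hv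
  obtain ⟨c, hc⟩ := h
  exact ⟨-2 * c, by
    have : (-(2 * k + 1) - 1) / 2 = -k - 1 := by omega
    rw [this] at hc
    linear_combination -2 * hc⟩

/-- Let `p1, q1, q2` be three distinct odd primes with `q1 ≠ 3`, `q2 ≠ 3`, and set
`l = 16·p1·q1·q2`. Then there is an odd integer `u` with `gcd(u, l) = 1` and
`gcd((u-1)/2, l) = 1` such that every prime `p ≡ u (mod l)` satisfies `(p1/p) = 1`,
`(q1/p) = -1` and `(q2/p) = -1`. -/
theorem statement_15 (p1 q1 q2 : ℕ)
    (hp : p1.Prime) (hq1 : q1.Prime) (hq2 : q2.Prime)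
    (hodd1 : Odd p1) (hodd2 : Odd q1) (hodd3 : Odd q2)
    (hne1 : p1 ≠ q1) (hne2 : p1 ≠ q2) (hne3 : q1 ≠ q2)
    (hq13 : q1 ≠ 3) (hq23 : q2 ≠ 3) :
    ∃ u : ℤ, Odd u ∧
      Int.gcd u (16 * p1 * q1 * q2) = 1 ∧
      Int.gcd ((u - 1) / 2) (16 * p1 * q1 * q2) = 1 ∧
      ∀ (p : ℕ) [Fact p.Prime],
        Int.ModEq ((16 * p1 * q1 * q2 : ℕ) : ℤ) (p : ℤ) u →
          legendreSym p p1 = 1 ∧ legendreSym p q1 = -1 ∧ legendreSym p q2 = -1 := by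
  obtain ⟨r1, hr1, hr1'⟩ := exists_jacobiSym_eq_neg_one_not_dvd_add_one hq1 hodd2 hq13
  obtain ⟨r2, hr2, hr2'⟩ := exists_jacobiSym_eq_neg_one_not_dvd_add_one hq2 hodd3 hq23
  have c16 {q : ℕ} (h : Odd q) : Nat.Coprime 16 q :=
    Nat.Coprime.pow_left 4 (Nat.coprime_two_left.mpr h)
  obtain ⟨w, hw, hw1⟩ := Nat.chineseRemainder
    (Nat.Coprime.mul_left (c16 hodd2) ((Nat.coprime_primes hp hq1).mpr hne1)) 1 r1
  obtain ⟨v, hv, hv2⟩ := Nat.chineseRemainder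
    (Nat.Coprime.mul_left (Nat.Coprime.mul_left (c16 hodd3) ((Nat.coprime_primes hp hq2).mpr hne2))
      ((Nat.coprime_primes hq1 hq2).mpr hne3)) w r2
  have hv1 : v ≡ r1 [MOD q1] := (hv.of_mul_left _).trans hw1
  have hvw : v ≡ 1 [MOD 16 * p1] := (hv.of_mul_right _).trans hw
  have hv16 : v ≡ 1 [MOD 16] := hvw.of_mul_right _
  have hvp : v ≡ 1 [MOD p1] := hvw.of_mul_left _
  have hv16' : v % 16 = 1 := hv16
  have hJ {q r : ℕ} (h : v ≡ r [MOD q]) : jacobiSym v q = jacobiSym r q :=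
    jacobiSym.mod_left' (Int.natCast_modEq_iff.mpr h)
  have hJp : jacobiSym v p1 = 1 := by rw [hJ hvp, Nat.cast_one, jacobiSym.one_left]
  have hJ1 : jacobiSym v q1 = -1 := (hJ hv1).trans hr1
  have hJ2 : jacobiSym v q2 = -1 := (hJ hv2).trans hr2
  have hsucc {q r : ℕ} (h : v ≡ r [MOD q]) (hr : ¬ q ∣ r + 1) : ¬ (q : ℤ) ∣ (v : ℤ) + 1 := by
    intro hd
    exact hr (((h.add_right 1).dvd_iff dvd_rfl).mp (by exact_mod_cast hd))
  have hp2 : ¬ p1 ∣ 1 + 1 := by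
    intro h
    rw [(Nat.prime_dvd_prime_iff_eq hp Nat.prime_two).mp h] at hodd1
    exact absurd hodd1 (by decide)
  have hvo : Odd (v : ℤ) := Int.odd_iff.mpr (by omega)
  have kp := isCoprime_neg_and_half hp hvo
    (not_dvd_of_jacobiSym_ne_zero hp (by rw [hJp]; decide)) (hsucc hvp hp2)
  have k1 := isCoprime_neg_and_half hq1 hvo
    (not_dvd_of_jacobiSym_ne_zero hq1 (by rw [hJ1]; decide)) (hsucc hv1 hr1')
  have k2 := isCoprime_neg_and_half hq2 hvo
    (not_dvd_of_jacobiSym_ne_zero hq2 (by rw [hJ2]; decide)) (hsucc hv2 hr2')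
  have odd16 {x : ℤ} (hx : Odd x) : IsCoprime x 16 :=
    (Int.isCoprime_two_right.mpr hx).pow_right (n := 4)
  refine ⟨-v, hvo.neg, ?_, ?_, fun p _ hpu => ?_⟩
  · rw [← Int.isCoprime_iff_gcd_eq_one]
    exact (((odd16 hvo.neg).mul_right kp.1).mul_right k1.1).mul_right k2.1
  · rw [← Int.isCoprime_iff_gcd_eq_one]
    exact (((odd16 (Int.odd_iff.mpr (by omega))).mul_right kp.2).mul_right k1.2).mul_right k2.2
  · have hmod {m : ℕ} (hm : m ∣ 16 * p1 * q1 * q2) : -(p : ℤ) ≡ v [ZMOD m] := by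
      simpa using (hpu.of_dvd (Int.natCast_dvd_natCast.mpr hm)).neg
    have hp4 : p % 4 = 3 := by
      have h16 := hmod (m := 16) ⟨p1 * q1 * q2, by ring⟩
      have h16' : -(p : ℤ) % 16 = v % 16 := h16
      omega
    rw [legendreSym_eq_jacobiSym_neg hp4 hodd1, legendreSym_eq_jacobiSym_neg hp4 hodd2,
      legendreSym_eq_jacobiSym_neg hp4 hodd3,
      jacobiSym.mod_left' (hmod (m := p1) ⟨16 * q1 * q2, by ring⟩),
      jacobiSym.mod_left' (hmod (m := q1) ⟨16 * p1 * q2, by ring⟩),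
      jacobiSym.mod_left' (hmod (m := q2) ⟨16 * p1 * q1, by ring⟩)]
    exact ⟨hJp, hJ1, hJ2⟩
end
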